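/- Let U be a bounded quasiopen set with C_p(X \ U) > 0, f ∈ N^{1,p}(U), ψ : U → [−∞,∞], and assume the obstacle class K_{ψ,f}(U) is nonempty. Then any solution u of the K_{ψ,f}(U)-obstacle problem is a fine superminimizer in U; moreover, if ψ ≡ −∞ or ψ is a fine subminimizer in U, then u is a fine minimizer in U. -/

import Mathlib

open MeasureTheory Metric Set Filter ENNReal

noncomputable section

variable {X : Type*} [MetricSpace X] [MeasurableSpace X] [BorelSpace X]

/-- A nonconstant compact rectifiable curve, parameterized by arc length
(modelled as a `1`-Lipschitz map on `[0, len]`). -/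
structure Curve (X : Type*) [MetricSpace X] where
  len : ℝ
  len_pos : 0 < len
  toFun : ℝ → X
  lip : LipschitzOnWith 1 toFun (Set.Icc 0 len)

/-- The curve lies in the set `E`. -/
def Curve.InSet (γ : Curve X) (E : Set X) : Prop :=
  ∀ t ∈ Set.Icc (0 : ℝ) γ.len, γ.toFun t ∈ E

/-- Line integral (w.r.t. arc length) of a nonnegative function along a curve. -/
def curveLint (γ : Curve X) (g : X → ℝ≥0∞) : ℝ≥0∞ :=
  ∫⁻ t in Set.Icc (0 : ℝ) γ.len, g (γ.toFun t)

/-- The `p`-modulus of a family of curves. -/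
def pMod (μ : Measure X) (p : ℝ) (Γ : Set (Curve X)) : ℝ≥0∞ :=
  ⨅ (ρ : X → ℝ≥0∞) (_ : Measurable ρ) (_ : ∀ γ ∈ Γ, 1 ≤ curveLint γ ρ),
    ∫⁻ x, ρ x ^ p ∂μ

/-- A property holds for `p`-almost every curve. -/
def AECurve (μ : Measure X) (p : ℝ) (P : Curve X → Prop) : Prop :=
  pMod μ p {γ | ¬ P γ} = 0

/-- `g` is a `p`-weak upper gradient of `f` on `E`. -/
def IsWeakUpperGradientOn (μ : Measure X) (p : ℝ) (f : X → ℝ) (g : X → ℝ≥0∞)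
    (E : Set X) : Prop :=
  AECurve (μ.restrict E) p fun γ =>
    γ.InSet E → edist (f (γ.toFun 0)) (f (γ.toFun γ.len)) ≤ curveLint γ g

/-- The Newtonian `p`-energy `∫_E |f|^p dμ + inf_g ∫_E g^p dμ`,
the `p`-th power of the Newtonian norm. -/
def npEnergy (μ : Measure X) (p : ℝ) (f : X → ℝ) (E : Set X) : ℝ≥0∞ :=
  (∫⁻ x in E, ENNReal.ofReal |f x| ^ p ∂μ) +
    ⨅ (g : X → ℝ≥0∞) (_ : Measurable g) (_ : IsWeakUpperGradientOn μ p f g E),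
      ∫⁻ x in E, g x ^ p ∂μ

/-- The Newtonian norm `‖f‖_{N^{1,p}(E)}`. -/
def npNorm (μ : Measure X) (p : ℝ) (f : X → ℝ) (E : Set X) : ℝ≥0∞ :=
  npEnergy μ p f E ^ (1 / p)

/-- Membership in the Newtonian space `N^{1,p}(E)`. -/
def MemNp (μ : Measure X) (p : ℝ) (f : X → ℝ) (E : Set X) : Prop :=
  Measurable f ∧ npEnergy μ p f E < ⊤

/-- The Sobolev capacity `C_p(E)`. -/
def sobolevCap (μ : Measure X) (p : ℝ) (E : Set X) : ℝ≥0∞ :=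
  ⨅ (f : X → ℝ) (_ : MemNp μ p f Set.univ) (_ : ∀ x ∈ E, 1 ≤ f x),
    npEnergy μ p f Set.univ

/-- `f ∈ N^{1,p}_0(A)`: a global Newtonian function vanishing outside `A`. -/
def MemNp0 (μ : Measure X) (p : ℝ) (f : X → ℝ) (A : Set X) : Prop :=
  MemNp μ p f Set.univ ∧ ∀ x ∉ A, f x = 0

/-- The variational capacity `cap_p(E, A)`. -/
def varCap (μ : Measure X) (p : ℝ) (E A : Set X) : ℝ≥0∞ :=
  ⨅ (f : X → ℝ) (_ : MemNp0 μ p f A) (_ : ∀ x ∈ E, 1 ≤ f x)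
    (g : X → ℝ≥0∞) (_ : Measurable g)
    (_ : IsWeakUpperGradientOn μ p f g Set.univ),
    ∫⁻ x, g x ^ p ∂μ

/-- The Wiener-type integrand in the definition of thinness, with the
convention that it equals `1` when `cap_p(B(x,r), B(x,2r)) = 0`. -/
def thinIntegrand (μ : Measure X) (p : ℝ) (E : Set X) (x : X) (r : ℝ) : ℝ≥0∞ :=
  if varCap μ p (ball x r) (ball x (2 * r)) = 0 then 1
  else (varCap μ p (E ∩ ball x r) (ball x (2 * r)) /
        varCap μ p (ball x r) (ball x (2 * r))) ^ (1 / (p - 1))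

/-- `E` is thin at `x`:
`∫_0^1 (cap_p(E∩B(x,r),B(x,2r))/cap_p(B(x,r),B(x,2r)))^{1/(p-1)} dr/r < ∞`. -/
def Thin (μ : Measure X) (p : ℝ) (E : Set X) (x : X) : Prop :=
  ∫⁻ r in Set.Ioo (0 : ℝ) 1, thinIntegrand μ p E x r / ENNReal.ofReal r < ⊤

/-- A set is finely open if its complement is thin at each of its points. -/
def FinelyOpen (μ : Measure X) (p : ℝ) (V : Set X) : Prop :=
  ∀ x ∈ V, Thin μ p Vᶜ x

/-- A set `U` is quasiopen if for every `ε > 0` there is an open set `G`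
with `C_p(G) < ε` such that `G ∪ U` is open. -/
def Quasiopen (μ : Measure X) (p : ℝ) (U : Set X) : Prop :=
  ∀ ε : ℝ≥0∞, 0 < ε → ∃ G : Set X, IsOpen G ∧ sobolevCap μ p G < ε ∧ IsOpen (G ∪ U)

/-- The fine topology: the topology generated by the finely open sets. -/
def fineTopology (μ : Measure X) (p : ℝ) : TopologicalSpace X :=
  TopologicalSpace.generateFrom {V | FinelyOpen μ p V}

/-- `A` is a `p`-strict subset of `E`. -/
def PStrictSubset (μ : Measure X) (p : ℝ) (A E : Set X) : Prop :=
  A ⊆ E ∧ ∃ η : X → ℝ, MemNp0 μ p η E ∧ ∀ x ∈ A, η x = 1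

/-- `V` is a finely open `p`-strict subset of `U` with compact closure
contained in `U` (written `V ⋐ U`). -/
def GoodSubset (μ : Measure X) (p : ℝ) (V U : Set X) : Prop :=
  FinelyOpen μ p V ∧ PStrictSubset μ p V U ∧ IsCompact (closure V) ∧ closure V ⊆ U

/-- The fine local Newtonian space `N^{1,p}_{fine-loc}(U)`. -/
def MemNpFineLoc (μ : Measure X) (p : ℝ) (f : X → ℝ) (U : Set X) : Prop :=
  ∀ V : Set X, GoodSubset μ p V U → MemNp μ p f V

/-- The local Newtonian space `N^{1,p}_loc(G)`. -/
def MemNpLoc (μ : Measure X) (p : ℝ) (f : X → ℝ) (G : Set X) : Prop :=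
  ∀ x ∈ G, ∃ r : ℝ, 0 < r ∧ MemNp μ p f (ball x r ∩ G)

/-- `∫_S g_u^p dμ`, where `g_u` is the minimal `p`-weak upper gradient of `u`
taken with respect to `U`, expressed as the infimum of the energies of all
`p`-weak upper gradients of `u` on `U`. -/
def fineEnergy (μ : Measure X) (p : ℝ) (u : X → ℝ) (U S : Set X) : ℝ≥0∞ :=
  ⨅ (g : X → ℝ≥0∞) (_ : Measurable g) (_ : IsWeakUpperGradientOn μ p u g U),
    ∫⁻ x in S, g x ^ p ∂μ

/-- `u` is a fine superminimizer in `U`. -/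
def FineSuperminimizer (μ : Measure X) (p : ℝ) (u : X → ℝ) (U : Set X) : Prop :=
  MemNpFineLoc μ p u U ∧
    ∀ V : Set X, GoodSubset μ p V U →
      ∀ φ : X → ℝ, MemNp0 μ p φ V → (∀ x, 0 ≤ φ x) →
        fineEnergy μ p u U V ≤ fineEnergy μ p (fun x => u x + φ x) U V

/-- `u` is a fine minimizer in `U`. -/
def FineMinimizer (μ : Measure X) (p : ℝ) (u : X → ℝ) (U : Set X) : Prop :=
  MemNpFineLoc μ p u U ∧
    ∀ V : Set X, GoodSubset μ p V U →
      ∀ φ : X → ℝ, MemNp0 μ p φ V →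
        fineEnergy μ p u U V ≤ fineEnergy μ p (fun x => u x + φ x) U V

/-- `u` is a fine subminimizer in `U` if `-u` is a fine superminimizer. -/
def FineSubminimizer (μ : Measure X) (p : ℝ) (u : X → ℝ) (U : Set X) : Prop :=
  FineSuperminimizer μ p (fun x => -u x) U

/-- A doubling measure which is positive and finite on balls. -/
def DoublingMeasure (μ : Measure X) : Prop :=
  (∀ (x : X) (r : ℝ), 0 < r → 0 < μ (ball x r) ∧ μ (ball x r) < ⊤) ∧
    ∃ C : ℝ≥0∞, C < ⊤ ∧
      ∀ (x : X) (r : ℝ), 0 < r → μ (ball x (2 * r)) ≤ C * μ (ball x r)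

/-- `X` supports a `p`-Poincaré inequality. -/
def PoincareInequality (μ : Measure X) (p : ℝ) : Prop :=
  ∃ C : ℝ≥0∞, 0 < C ∧ ∃ lam : ℝ, 1 ≤ lam ∧
    ∀ (x : X) (r : ℝ), 0 < r → ∀ (f : X → ℝ) (g : X → ℝ≥0∞),
      Measurable f → Measurable g → IsWeakUpperGradientOn μ p f g Set.univ →
      (μ (ball x r))⁻¹ *
          ∫⁻ y in ball x r, ENNReal.ofReal |f y - ⨍ z in ball x r, f z ∂μ| ∂μ ≤
        C * ENNReal.ofReal (2 * r) *
          ((μ (ball x (lam * r)))⁻¹ * ∫⁻ y in ball x (lam * r), g y ^ p ∂μ) ^ (1 / p)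

/-- The obstacle class `K_{ψ,f}(U)`. -/
def obstacleClass {X : Type*} [MetricSpace X] [MeasurableSpace X] [BorelSpace X]
    (μ : Measure X) (p : ℝ) (U : Set X) (ψ : X → EReal) (f : X → ℝ) :
    Set (X → ℝ) :=
  {v | MemNp μ p v U ∧
    MemNp0 μ p (U.indicator fun x => v x - f x) U ∧
    sobolevCap μ p {x | x ∈ U ∧ ((v x : ℝ) : EReal) < ψ x} = 0}

set_option linter.unusedSectionVars false

section Modulus

variable {μ : Measure X} {p : ℝ}

lemma Curve.continuousOn (γ : Curve X) : ContinuousOn γ.toFun (Icc 0 γ.len) :=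
  γ.lip.continuousOn

lemma Curve.aemeasurable_comp {β : Type*} [MeasurableSpace β] (γ : Curve X) {g : X → β}
    (hg : Measurable g) :
    AEMeasurable (fun t => g (γ.toFun t)) (volume.restrict (Icc 0 γ.len)) :=
  hg.comp_aemeasurable (γ.continuousOn.aemeasurable measurableSet_Icc)

lemma curveLint_mono (γ : Curve X) {g h : X → ℝ≥0∞} (hgh : ∀ x, g x ≤ h x) :
    curveLint γ g ≤ curveLint γ h :=
  lintegral_mono fun _ => hgh _

lemma curveLint_const_mul (γ : Curve X) {g : X → ℝ≥0∞} (hg : Measurable g) (c : ℝ≥0∞) :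
    curveLint γ (fun x => c * g x) = c * curveLint γ g :=
  lintegral_const_mul'' c (γ.aemeasurable_comp hg)

lemma curveLint_congr {γ : Curve X} {E : Set X} (hγ : γ.InSet E) {g h : X → ℝ≥0∞}
    (hgh : ∀ x ∈ E, g x = h x) : curveLint γ g = curveLint γ h :=
  setLIntegral_congr_fun measurableSet_Icc fun t ht => hgh _ (hγ t ht)

/-- A curve family has zero modulus iff some function of finite `p`-energy has infinite
line integral along each of its members. -/
lemma pMod_eq_zero_iff (hp : 0 < p) {Γ : Set (Curve X)} :
    pMod μ p Γ = 0 ↔ ∃ ρ : X → ℝ≥0∞, Measurable ρ ∧ ∫⁻ x, ρ x ^ p ∂μ < ⊤ ∧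
      ∀ γ ∈ Γ, curveLint γ ρ = ⊤ := by
  constructor
  · intro h
    have key : ∀ n : ℕ, ∃ ρ : X → ℝ≥0∞, Measurable ρ ∧ (∀ γ ∈ Γ, 1 ≤ curveLint γ ρ) ∧
        ∫⁻ x, ((2 : ℝ≥0∞) ^ n * ρ x) ^ p ∂μ < (1 / 2 : ℝ≥0∞) ^ n := by
      intro n
      have hc0 : ((2 : ℝ≥0∞) ^ n) ^ p ≠ 0 := by
        simp [ENNReal.rpow_eq_zero_iff, hp.not_gt]
      have hct : ((2 : ℝ≥0∞) ^ n) ^ p ≠ ⊤ :=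
        ENNReal.rpow_ne_top_of_nonneg hp.le (by finiteness)
      have hlt : pMod μ p Γ < (1 / 2 : ℝ≥0∞) ^ n / ((2 : ℝ≥0∞) ^ n) ^ p := by
        rw [h]
        exact ENNReal.div_pos (pow_ne_zero _ (by simp)) hct
      simp only [pMod, iInf_lt_iff] at hlt
      obtain ⟨ρ, hρ, h1, hlt⟩ := hlt
      refine ⟨ρ, hρ, h1, ?_⟩
      simp_rw [ENNReal.mul_rpow_of_nonneg _ _ hp.le]
      rw [lintegral_const_mul _ (hρ.pow_const p), mul_comm]
      exact (ENNReal.lt_div_iff_mul_lt (Or.inl hc0) (Or.inl hct)).1 hlt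
    choose ρ hρ h1 hlt using key
    refine ⟨fun x => (∑' n, ((2 : ℝ≥0∞) ^ n * ρ n x) ^ p) ^ p⁻¹, ?_, ?_, ?_⟩
    · exact (Measurable.tsum fun n => ((hρ n).const_mul _).pow_const p).pow_const _
    · simp_rw [ENNReal.rpow_inv_rpow hp.ne']
      rw [lintegral_tsum fun n => (((hρ n).const_mul _).pow_const p).aemeasurable]
      calc ∑' n, ∫⁻ x, ((2 : ℝ≥0∞) ^ n * ρ n x) ^ p ∂μ ≤ ∑' n : ℕ, (1 / 2 : ℝ≥0∞) ^ n :=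
            ENNReal.tsum_le_tsum fun n => (hlt n).le
        _ < ⊤ := by
            rw [ENNReal.tsum_geometric]; norm_num
    · intro γ hγ
      refine ENNReal.eq_top_of_forall_nnreal_le fun r => ?_
      obtain ⟨n, hn⟩ := exists_nat_ge r
      have h2 : (r : ℝ≥0∞) ≤ 2 ^ n := by
        have : (n : ℝ≥0∞) ≤ 2 ^ n := by exact_mod_cast Nat.lt_two_pow_self.le
        refine le_trans ?_ this
        exact_mod_cast hn
      refine h2.trans ?_
      calc (2 : ℝ≥0∞) ^ n = 2 ^ n * 1 := (mul_one _).symm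
        _ ≤ 2 ^ n * curveLint γ (ρ n) := by gcongr; exact h1 n γ hγ
        _ = curveLint γ (fun x => 2 ^ n * ρ n x) := (curveLint_const_mul γ (hρ n) _).symm
        _ ≤ _ := curveLint_mono γ fun x => by
            rw [ENNReal.le_rpow_inv_iff hp]
            exact ENNReal.le_tsum (f := fun n => ((2 : ℝ≥0∞) ^ n * ρ n x) ^ p) n
  · rintro ⟨ρ, hρ, hfin, hinf⟩
    have bound : ∀ n : ℕ, pMod μ p Γ ≤ ((n : ℝ≥0∞)⁻¹ ^ p) * ∫⁻ x, ρ x ^ p ∂μ := by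
      intro n
      calc pMod μ p Γ ≤ ∫⁻ x, ((n : ℝ≥0∞)⁻¹ * ρ x) ^ p ∂μ := by
            refine iInf₂_le_of_le _ (hρ.const_mul _) (iInf_le_of_le (fun γ hγ => ?_) le_rfl)
            rw [curveLint_const_mul γ hρ, hinf γ hγ, ENNReal.mul_top (by simp)]
            exact le_top
        _ = _ := by
            simp_rw [ENNReal.mul_rpow_of_nonneg _ _ hp.le]
            rw [lintegral_const_mul _ (hρ.pow_const p)]
    have lim : Tendsto (fun n : ℕ => ((n : ℝ≥0∞)⁻¹ ^ p) * ∫⁻ x, ρ x ^ p ∂μ) atTop (nhds 0) := by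
      have h0 : Tendsto (fun n : ℕ => (n : ℝ≥0∞)⁻¹ ^ p) atTop (nhds 0) := by
        have := (ENNReal.continuous_rpow_const (y := p)).tendsto 0 |>.comp
          ENNReal.tendsto_inv_nat_nhds_zero
        simpa [Function.comp_def, ENNReal.zero_rpow_of_pos hp] using this
      simpa using ENNReal.Tendsto.mul_const h0 (Or.inr hfin.ne)
    exact le_antisymm (ge_of_tendsto' lim bound) bot_le

lemma pMod_mono {Γ Γ' : Set (Curve X)} (h : Γ ⊆ Γ') : pMod μ p Γ ≤ pMod μ p Γ' :=
  iInf₂_mono fun _ _ => le_iInf fun h' => iInf_le _ fun γ hγ => h' γ (h hγ)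

lemma pMod_iUnion_eq_zero (hp : 0 < p) {Γ : ℕ → Set (Curve X)}
    (h : ∀ n, pMod μ p (Γ n) = 0) : pMod μ p (⋃ n, Γ n) = 0 := by
  simp_rw [pMod_eq_zero_iff hp] at h ⊢
  choose ρ hρ hfin hinf using h
  have hc : ∀ n, ∃ c : ℝ≥0∞, c ≠ 0 ∧ c ^ p * ∫⁻ x, ρ n x ^ p ∂μ ≤ (1 / 2) ^ n := by
    intro n
    have h2 : (1 / 2 : ℝ≥0∞) ^ n ≠ 0 := pow_ne_zero _ (by simp)
    have h2t : (1 / 2 : ℝ≥0∞) ^ n ≠ ⊤ := by finiteness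
    refine ⟨((1 / 2) ^ n / (1 + ∫⁻ x, ρ n x ^ p ∂μ)) ^ p⁻¹, ?_, ?_⟩
    · have : (1 / 2 : ℝ≥0∞) ^ n / (1 + ∫⁻ x, ρ n x ^ p ∂μ) ≠ 0 :=
        (ENNReal.div_pos h2 (ENNReal.add_lt_top.2 ⟨one_lt_top, hfin n⟩).ne).ne'
      rw [Ne, ENNReal.rpow_eq_zero_iff]
      rintro (h | h)
      · exact this h.1
      · exact (inv_pos.2 hp).not_gt h.2
    · rw [ENNReal.rpow_inv_rpow hp.ne']
      calc _ ≤ (1 / 2) ^ n / (1 + ∫⁻ x, ρ n x ^ p ∂μ) * (1 + ∫⁻ x, ρ n x ^ p ∂μ) := by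
            gcongr; exact le_add_self
        _ ≤ _ := (ENNReal.div_mul_cancel (by simp)
            (ENNReal.add_lt_top.2 ⟨one_lt_top, hfin n⟩).ne).le
  choose c hc0 hc using hc
  refine ⟨fun x => (∑' n, (c n * ρ n x) ^ p) ^ p⁻¹, ?_, ?_, ?_⟩
  · exact (Measurable.tsum fun n => ((hρ n).const_mul _).pow_const p).pow_const _
  · simp_rw [ENNReal.rpow_inv_rpow hp.ne']
    rw [lintegral_tsum fun n => (((hρ n).const_mul _).pow_const p).aemeasurable]
    calc ∑' n, ∫⁻ x, (c n * ρ n x) ^ p ∂μ ≤ ∑' n : ℕ, (1 / 2 : ℝ≥0∞) ^ n := by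
          refine ENNReal.tsum_le_tsum fun n => ?_
          simp_rw [ENNReal.mul_rpow_of_nonneg _ _ hp.le]
          rw [lintegral_const_mul _ ((hρ n).pow_const p)]
          exact hc n
      _ < ⊤ := by
          rw [ENNReal.tsum_geometric]; norm_num
  · rintro γ hγ
    obtain ⟨n, hn⟩ := mem_iUnion.1 hγ
    refine top_unique ?_
    calc ⊤ = curveLint γ (fun x => c n * ρ n x) := by
          rw [curveLint_const_mul γ (hρ n), hinf n γ hn, ENNReal.mul_top (hc0 n)]
      _ ≤ _ := curveLint_mono γ fun x => by
          rw [ENNReal.le_rpow_inv_iff hp]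
          exact ENNReal.le_tsum (f := fun n => (c n * ρ n x) ^ p) n

lemma aeCurve_mono {P Q : Curve X → Prop} (h : ∀ γ, P γ → Q γ) (hP : AECurve μ p P) :
    AECurve μ p Q := by
  have hsub : {γ | ¬ Q γ} ⊆ {γ | ¬ P γ} := fun γ hγ hPγ => hγ (h γ hPγ)
  exact le_antisymm ((pMod_mono hsub).trans hP.le) bot_le

lemma aeCurve_forall_nat (hp : 0 < p) {P : ℕ → Curve X → Prop} (h : ∀ n, AECurve μ p (P n)) :
    AECurve μ p fun γ => ∀ n, P n γ := by
  have := pMod_iUnion_eq_zero hp h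
  refine le_antisymm ((pMod_mono fun γ hγ => ?_).trans this.le) bot_le
  simpa using hγ

lemma aeCurve_and (hp : 0 < p) {P Q : Curve X → Prop} (h : AECurve μ p P)
    (h' : AECurve μ p Q) : AECurve μ p fun γ => P γ ∧ Q γ :=
  aeCurve_mono (fun _ hγ => ⟨hγ 0, hγ 1⟩)
    (aeCurve_forall_nat hp (P := fun n => if n = 0 then P else Q) fun n => by
      by_cases hn : n = 0 <;> simp [hn, h, h'])

lemma aeCurve_of_forall (hp : 0 < p) {P : Curve X → Prop} (h : ∀ γ, P γ) : AECurve μ p P :=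
  (pMod_eq_zero_iff hp).2 ⟨0, measurable_const, by simp [ENNReal.zero_rpow_of_pos hp],
    fun γ hγ => (hγ (h γ)).elim⟩

/-- The filter of properties holding for `p`-almost every curve. -/
def curveFilter (μ : Measure X) (p : ℝ) (hp : 0 < p) : Filter (Curve X) where
  sets := {S | AECurve μ p (· ∈ S)}
  univ_sets := aeCurve_of_forall hp fun _ => mem_univ _
  sets_of_superset h hs := aeCurve_mono (fun _ hγ => hs hγ) h
  inter_sets h h' := aeCurve_and hp h h'

lemma eventually_curve_nat {hp : 0 < p} {P : ℕ → Curve X → Prop}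
    (h : ∀ n, ∀ᶠ γ in curveFilter μ p hp, P n γ) :
    ∀ᶠ γ in curveFilter μ p hp, ∀ n, P n γ :=
  aeCurve_forall_nat hp h

lemma eventually_curveLint_lt_top {hp : 0 < p} {g : X → ℝ≥0∞} (hg : Measurable g)
    (hfin : ∫⁻ x, g x ^ p ∂μ < ⊤) : ∀ᶠ γ in curveFilter μ p hp, curveLint γ g < ⊤ :=
  (pMod_eq_zero_iff hp).2 ⟨g, hg, hfin, fun γ hγ => by
    simpa [mem_ofPred_eq, not_lt, top_le_iff] using hγ⟩

lemma eventually_curve_iff {hp : 0 < p} {P : Curve X → Prop} :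
    (∀ᶠ γ in curveFilter μ p hp, P γ) ↔ ∃ ρ : X → ℝ≥0∞, Measurable ρ ∧
      ∫⁻ x, ρ x ^ p ∂μ < ⊤ ∧ ∀ γ, curveLint γ ρ < ⊤ → P γ := by
  refine (pMod_eq_zero_iff hp).trans ?_
  refine exists_congr fun ρ => and_congr_right fun _ => and_congr_right fun _ => ?_
  refine forall_congr' fun γ => ?_
  change (¬ P γ → _) ↔ _
  rw [← not_imp_not, not_not, lt_top_iff_ne_top]

/-- The restriction of a curve to a subinterval. -/
def Curve.sub (γ : Curve X) (s t : ℝ) (hs : 0 ≤ s) (hst : s < t) (ht : t ≤ γ.len) : Curve X where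
  len := t - s
  len_pos := sub_pos.2 hst
  toFun r := γ.toFun (s + r)
  lip := by
    refine LipschitzOnWith.of_dist_le_mul fun x hx y hy => ?_
    have := γ.lip.dist_le_mul (s + x) ⟨by linarith [hx.1], by linarith [hx.2]⟩ (s + y)
      ⟨by linarith [hy.1], by linarith [hy.2]⟩
    simpa using this

lemma curveLint_sub (γ : Curve X) {s t : ℝ} (hs : 0 ≤ s) (hst : s < t) (ht : t ≤ γ.len)
    (g : X → ℝ≥0∞) :
    curveLint (γ.sub s t hs hst ht) g = ∫⁻ r in Icc s t, g (γ.toFun r) := by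
  have h := (measurePreserving_add_left (volume : Measure ℝ) s).setLIntegral_comp_preimage_emb
    (measurableEmbedding_addLeft s) (fun r => g (γ.toFun r)) (Icc s t)
  rw [preimage_const_add_Icc, sub_self] at h
  exact h

lemma curveLint_sub_le (γ : Curve X) {s t : ℝ} (hs : 0 ≤ s) (hst : s < t) (ht : t ≤ γ.len)
    (g : X → ℝ≥0∞) : curveLint (γ.sub s t hs hst ht) g ≤ curveLint γ g := by
  rw [curveLint_sub]
  exact lintegral_mono_set (Icc_subset_Icc hs ht)

/-- Properties of almost every curve hold for all subcurves of almost every curve. -/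
lemma eventually_curve_sub {hp : 0 < p} {P : Curve X → Prop}
    (h : ∀ᶠ γ in curveFilter μ p hp, P γ) :
    ∀ᶠ γ in curveFilter μ p hp, ∀ (s t : ℝ) (hs : 0 ≤ s) (hst : s < t) (ht : t ≤ γ.len),
      P (γ.sub s t hs hst ht) := by
  rw [eventually_curve_iff] at h ⊢
  obtain ⟨ρ, hρ, hfin, hP⟩ := h
  exact ⟨ρ, hρ, hfin, fun γ hγ s t hs hst ht =>
    hP _ ((curveLint_sub_le γ hs hst ht ρ).trans_lt hγ)⟩

lemma pMod_mono_measure {ν : Measure X} (h : ν ≤ μ) (Γ : Set (Curve X)) :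
    pMod ν p Γ ≤ pMod μ p Γ :=
  iInf_mono fun _ => iInf_mono fun _ => iInf_mono fun _ => lintegral_mono' h le_rfl

/-- Weak upper gradients on `E` only depend on the curves contained in `E`. -/
lemma isWeakUpperGradientOn_iff [SFinite μ] (hp : 0 < p) {f : X → ℝ} {g : X → ℝ≥0∞} {E : Set X} :
    IsWeakUpperGradientOn μ p f g E ↔ ∀ᶠ γ in curveFilter μ p hp, γ.InSet E →
      edist (f (γ.toFun 0)) (f (γ.toFun γ.len)) ≤ curveLint γ g := by
  constructor
  · intro h
    obtain ⟨ρ, hρ, hfin, hP⟩ := (pMod_eq_zero_iff hp).1 h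
    set E' := toMeasurable μ E
    have hE' : MeasurableSet E' := measurableSet_toMeasurable _ _
    refine (pMod_eq_zero_iff hp).2 ⟨E'.indicator ρ, hρ.indicator hE', ?_, fun γ hγ => ?_⟩
    · have : (fun x => (E'.indicator ρ x) ^ p) = E'.indicator fun x => ρ x ^ p := by
        ext x
        by_cases hx : x ∈ E' <;> simp [hx, hp]
      rw [this, lintegral_indicator hE', Measure.restrict_toMeasurable_of_sFinite]
      exact hfin
    · have hγE : γ.InSet E := by
        by_contra hc
        exact hγ fun h => (hc h).elim
      rw [← hP γ hγ]
      exact curveLint_congr hγE fun x hx => indicator_of_mem (subset_toMeasurable _ _ hx) _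
  · intro h
    exact le_antisymm ((pMod_mono_measure Measure.restrict_le_self _).trans (le_of_eq h)) bot_le

/-- Finite energy on `E` gives finite line integrals on almost every curve in `E`. -/
lemma eventually_curveLint_lt_top_of_inSet [SFinite μ] {hp : 0 < p} {g : X → ℝ≥0∞}
    (hg : Measurable g) {E : Set X} (hfin : ∫⁻ x in E, g x ^ p ∂μ < ⊤) :
    ∀ᶠ γ in curveFilter μ p hp, γ.InSet E → curveLint γ g < ⊤ := by
  set E' := toMeasurable μ E
  have hE' : MeasurableSet E' := measurableSet_toMeasurable _ _
  refine (eventually_curveLint_lt_top (hg.indicator hE') ?_).mono fun γ hγ hγE => ?_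
  · have : (fun x => (E'.indicator g x) ^ p) = E'.indicator fun x => g x ^ p := by
      ext x
      by_cases hx : x ∈ E' <;> simp [hx, hp]
    rw [this, lintegral_indicator hE', Measure.restrict_toMeasurable_of_sFinite]
    exact hfin
  · rwa [curveLint_congr hγE fun x hx =>
      (indicator_of_mem (subset_toMeasurable μ E hx) g).symm]

end Modulus

section OneDimensional

lemma exists_integrable_density {k : ℝ → ℝ≥0∞} {S : Set ℝ} (hS : MeasurableSet S)
    (hk : AEMeasurable k (volume.restrict S)) (hfin : ∫⁻ t in S, k t < ⊤) :
    ∃ κ : ℝ → ℝ, Integrable κ ∧ 0 ≤ κ ∧ (∀ t, ENNReal.ofReal (κ t) ≤ k t) ∧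
      ∀ s t, s ≤ t → Icc s t ⊆ S →
        ∫⁻ r in Icc s t, k r = ENNReal.ofReal (∫ r in s..t, κ r) := by
  have hm : AEMeasurable (S.indicator k) := (aemeasurable_indicator_iff hS).2 hk
  have hf : ∫⁻ t, S.indicator k t ≠ ⊤ := by rw [lintegral_indicator hS]; exact hfin.ne
  refine ⟨fun t => (S.indicator k t).toReal, integrable_toReal_of_lintegral_ne_top hm hf,
    fun _ => ENNReal.toReal_nonneg,
    fun t => ENNReal.ofReal_toReal_le.trans (indicator_le_self _ _ _), fun s t hst hS' => ?_⟩
  have h1 : ∫⁻ r in Icc s t, k r = ∫⁻ r in Icc s t, S.indicator k r :=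
    setLIntegral_congr_fun measurableSet_Icc fun r hr => (indicator_of_mem (hS' hr) k).symm
  have h2 : ∫⁻ r in Icc s t, S.indicator k r ≠ ⊤ :=
    ((setLIntegral_le_lintegral _ _).trans_lt hf.lt_top).ne
  rw [intervalIntegral.integral_of_le hst, ← integral_Icc_eq_integral_Ioc,
    integral_toReal hm.restrict (ae_lt_top' hm.restrict h2), ENNReal.ofReal_toReal h2, h1]

lemma absolutelyContinuousOnInterval_of_dist_le {y K : ℝ → ℝ} {a b : ℝ}
    (hK : AbsolutelyContinuousOnInterval K a b)
    (h : ∀ s ∈ uIcc a b, ∀ t ∈ uIcc a b, dist (y s) (y t) ≤ dist (K s) (K t)) :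
    AbsolutelyContinuousOnInterval y a b := by
  rw [absolutelyContinuousOnInterval_iff] at hK ⊢
  intro ε hε
  obtain ⟨δ, hδ, H⟩ := hK ε hε
  refine ⟨δ, hδ, fun E hE hlt => (Finset.sum_le_sum fun i hi => ?_).trans_lt (H E hE hlt)⟩
  exact h _ (hE.1 i hi).1 _ (hE.1 i hi).2

lemma absolutelyContinuousOnInterval_of_edist_le {y : ℝ → ℝ} {k : ℝ → ℝ≥0∞} {a b : ℝ}
    (hab : a ≤ b) (hk : AEMeasurable k (volume.restrict (Icc a b)))
    (hfin : ∫⁻ t in Icc a b, k t < ⊤)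
    (h : ∀ s t, a ≤ s → s ≤ t → t ≤ b → edist (y s) (y t) ≤ ∫⁻ r in Icc s t, k r) :
    AbsolutelyContinuousOnInterval y a b := by
  obtain ⟨κ, hκ, hκ0, -, hint⟩ := exists_integrable_density measurableSet_Icc hk hfin
  refine absolutelyContinuousOnInterval_of_dist_le (K := fun x => ∫ v in a..x, κ v)
    (hκ.intervalIntegrable.absolutelyContinuousOnInterval_intervalIntegral (by simp)) ?_
  have main : ∀ s t, a ≤ s → s ≤ t → t ≤ b →
      dist (y s) (y t) ≤ dist (∫ v in a..s, κ v) (∫ v in a..t, κ v) := by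
    intro s t has hst htb
    have h1 := h s t has hst htb
    rw [hint s t hst (Icc_subset_Icc has htb)] at h1
    rw [dist_comm (∫ v in a..s, κ v), Real.dist_eq (∫ v in a..t, κ v),
      intervalIntegral.integral_interval_sub_left hκ.intervalIntegrable hκ.intervalIntegrable]
    rw [edist_dist] at h1
    exact ((ENNReal.ofReal_le_ofReal_iff (intervalIntegral.integral_nonneg hst
      fun r _ => hκ0 r)).1 h1).trans (le_abs_self _)
  rw [uIcc_of_le hab]
  intro s hs t ht
  rcases le_total s t with hst | hst
  · exact main s t hs.1 hst ht.2
  · rw [dist_comm, dist_comm (∫ v in a..s, κ v)]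
    exact main t s ht.1 hst hs.2

lemma ae_enorm_deriv_le {y : ℝ → ℝ} {k : ℝ → ℝ≥0∞} {S : Set ℝ} (hS : MeasurableSet S)
    (hk : AEMeasurable k (volume.restrict S)) (hfin : ∫⁻ t in S, k t < ⊤)
    (h : ∀ s t, s ≤ t → Icc s t ⊆ S → edist (y s) (y t) ≤ ∫⁻ r in Icc s t, k r) :
    ∀ᵐ t, S ∈ nhds t → DifferentiableAt ℝ y t → ‖deriv y t‖ₑ ≤ k t := by
  obtain ⟨κ, hκ, hκ0, hκk, hint⟩ := exists_integrable_density hS hk hfin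
  filter_upwards [LocallyIntegrable.ae_hasDerivAt_integral hκ.locallyIntegrable] with x hx hxS hy
  refine le_trans ?_ (hκk x)
  rw [← ofReal_norm]
  refine ENNReal.ofReal_le_ofReal ?_
  have hIoi : Ioi x ⊆ {x}ᶜ := fun z hz => (ne_of_gt hz : z ≠ x)
  have h1 := (hasDerivAt_iff_tendsto_slope.1 hy.hasDerivAt).mono_left
    (nhdsWithin_mono x hIoi)
  have h2 := (hasDerivAt_iff_tendsto_slope.1 (hx x)).mono_left
    (nhdsWithin_mono x hIoi)
  obtain ⟨ε, hε, hεS⟩ := Metric.mem_nhds_iff.1 hxS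
  have hev : ∀ᶠ z in nhdsWithin x (Ioi x), z < x + ε :=
    nhdsWithin_le_nhds (Iio_mem_nhds (by linarith))
  refine le_of_tendsto_of_tendsto h1.norm h2 ?_
  filter_upwards [hev, self_mem_nhdsWithin] with z hz hxz
  have hxz' : x < z := hxz
  have hsub : Icc x z ⊆ S := fun r hr => hεS (by
    rw [Metric.mem_ball, Real.dist_eq, abs_lt]; constructor <;> linarith [hr.1, hr.2])
  have h3 := h x z hxz'.le hsub
  rw [hint x z hxz'.le hsub, edist_dist, ENNReal.ofReal_le_ofReal_iff
    (intervalIntegral.integral_nonneg hxz'.le fun r _ => hκ0 r), dist_comm, Real.dist_eq] at h3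
  simp only [slope_def_field, intervalIntegral.integral_same, sub_zero, norm_div,
    Real.norm_eq_abs, abs_of_pos (sub_pos.2 hxz')]
  have : 0 < z - x := sub_pos.2 hxz'
  gcongr

lemma edist_le_of_enorm_deriv_le {y : ℝ → ℝ} {h : ℝ → ℝ≥0∞} {a b : ℝ} (hab : a ≤ b)
    (hy : AbsolutelyContinuousOnInterval y a b)
    (hd : ∀ᵐ t ∂volume.restrict (Icc a b), ‖deriv y t‖ₑ ≤ h t) :
    edist (y a) (y b) ≤ ∫⁻ t in Icc a b, h t := by
  rw [edist_comm, edist_eq_enorm_sub, ← hy.integral_deriv_eq_sub,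
    intervalIntegral.integral_of_le hab, ← integral_Icc_eq_integral_Ioc]
  exact (enorm_integral_le_lintegral_enorm _).trans (lintegral_mono_ae hd)

/-- Functions agreeing on a set have the same derivative at almost all of its points. -/
lemma ae_deriv_eq_of_eqOn {y z : ℝ → ℝ} {S : Set ℝ} (h : EqOn y z S) :
    ∀ᵐ t, t ∈ S → DifferentiableAt ℝ y t → DifferentiableAt ℝ z t → deriv y t = deriv z t := by
  have hc := (countable_setOfPred_isolated_right_within (s := S)).ae_notMem volume
  filter_upwards [hc] with t ht htS hy hz
  have hne : (nhdsWithin t (S ∩ Ioi t)).NeBot := ⟨fun hbot => ht ⟨htS, hbot⟩⟩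
  have hle : nhdsWithin t (S ∩ Ioi t) ≤ nhdsWithin t {t}ᶜ :=
    nhdsWithin_mono t fun z hz => (ne_of_gt hz.2 : z ≠ t)
  have h1 := (hasDerivAt_iff_tendsto_slope.1 hy.hasDerivAt).mono_left hle
  have h2 := (hasDerivAt_iff_tendsto_slope.1 hz.hasDerivAt).mono_left hle
  refine tendsto_nhds_unique_of_eventuallyEq h1 h2 ?_
  filter_upwards [self_mem_nhdsWithin] with r hr
  rw [slope_def_field, slope_def_field, h htS, h hr.1]

end OneDimensional

section CurveCalculus

variable {μ : Measure X} {p : ℝ}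

/-- The upper gradient inequality on all subcurves of `γ` contained in `E`. -/
def Curve.UGAlong (γ : Curve X) (f : X → ℝ) (g : X → ℝ≥0∞) (E : Set X) : Prop :=
  ∀ s t, 0 ≤ s → s ≤ t → t ≤ γ.len → (∀ r ∈ Icc s t, γ.toFun r ∈ E) →
    edist (f (γ.toFun s)) (f (γ.toFun t)) ≤ ∫⁻ r in Icc s t, g (γ.toFun r)

/-- Absolute continuity of a function along a curve. -/
def Curve.ACAlong (γ : Curve X) (f : X → ℝ) : Prop :=
  AbsolutelyContinuousOnInterval (fun t => f (γ.toFun t)) 0 γ.len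

/-- The derivative of `f` along `γ` is almost everywhere bounded by `g` while in `A`. -/
def Curve.DBound (γ : Curve X) (f : X → ℝ) (g : X → ℝ≥0∞) (A : Set X) : Prop :=
  ∀ᵐ t ∂volume.restrict (Icc 0 γ.len), γ.toFun t ∈ A →
    ‖deriv (fun t => f (γ.toFun t)) t‖ₑ ≤ g (γ.toFun t)

namespace Curve

variable {γ : Curve X} {f f₁ f₂ : X → ℝ} {g g₁ g₂ : X → ℝ≥0∞} {A B E : Set X}

lemma ae_mem_Ioo (γ : Curve X) : ∀ᵐ t ∂volume.restrict (Icc 0 γ.len), t ∈ Ioo 0 γ.len := by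
  rw [← restrict_Ioo_eq_restrict_Icc]
  exact ae_restrict_mem measurableSet_Ioo

lemma ACAlong.ae_differentiableAt (h : γ.ACAlong f) :
    ∀ᵐ t ∂volume.restrict (Icc 0 γ.len),
      DifferentiableAt ℝ (fun t => f (γ.toFun t)) t := by
  filter_upwards [ae_restrict_of_ae (AbsolutelyContinuousOnInterval.ae_differentiableAt h),
    ae_restrict_mem measurableSet_Icc] with t h1 h2
  exact h1 (by rwa [uIcc_of_le γ.len_pos.le])

lemma ACAlong.continuousOn (h : γ.ACAlong f) :
    ContinuousOn (fun t => f (γ.toFun t)) (Icc 0 γ.len) := by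
  have := AbsolutelyContinuousOnInterval.continuousOn h
  rwa [uIcc_of_le γ.len_pos.le] at this

lemma ACAlong.add (h₁ : γ.ACAlong f₁) (h₂ : γ.ACAlong f₂) :
    γ.ACAlong fun x => f₁ x + f₂ x :=
  AbsolutelyContinuousOnInterval.add h₁ h₂

lemma ACAlong.sub (h₁ : γ.ACAlong f₁) (h₂ : γ.ACAlong f₂) :
    γ.ACAlong fun x => f₁ x - f₂ x :=
  AbsolutelyContinuousOnInterval.sub h₁ h₂

lemma ACAlong.neg (h₁ : γ.ACAlong f₁) : γ.ACAlong fun x => - f₁ x :=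
  AbsolutelyContinuousOnInterval.neg h₁

lemma ACAlong.const_mul (h₁ : γ.ACAlong f₁) (c : ℝ) : γ.ACAlong fun x => c * f₁ x :=
  AbsolutelyContinuousOnInterval.const_mul c h₁

lemma acAlong_const (γ : Curve X) (c : ℝ) : γ.ACAlong fun _ => c :=
  absolutelyContinuousOnInterval_of_edist_le (k := 0) γ.len_pos.le aemeasurable_const (by simp)
    (by simp)

lemma ACAlong.of_dist_le (h₁ : γ.ACAlong f₁)
    (h : ∀ x y, dist (f₂ x) (f₂ y) ≤ dist (f₁ x) (f₁ y)) : γ.ACAlong f₂ :=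
  absolutelyContinuousOnInterval_of_dist_le h₁ fun _ _ _ _ => h _ _

lemma ACAlong.max (h₁ : γ.ACAlong f₁) (h₂ : γ.ACAlong f₂) :
    γ.ACAlong fun x => max (f₁ x) (f₂ x) := by
  have h : γ.ACAlong fun x => |f₁ x - f₂ x| := by
    refine (h₁.sub h₂).of_dist_le fun x y => ?_
    exact abs_abs_sub_abs_le _ _
  have h' := ((h₁.add h₂).add h).const_mul (1 / 2)
  convert h' using 2 with x
  rcases le_total (f₁ x) (f₂ x) with h | h
  · rw [max_eq_right h, abs_of_nonpos (by linarith)]; ring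
  · rw [max_eq_left h, abs_of_nonneg (by linarith)]; ring

lemma ACAlong.min (h₁ : γ.ACAlong f₁) (h₂ : γ.ACAlong f₂) :
    γ.ACAlong fun x => min (f₁ x) (f₂ x) := by
  have h := (h₁.neg.max h₂.neg).neg
  convert h using 2 with x
  rw [max_neg_neg, neg_neg]

lemma UGAlong.mono_set (h : γ.UGAlong f g E) (hA : A ⊆ E) : γ.UGAlong f g A :=
  fun s t hs hst ht hr => h s t hs hst ht fun r hr' => hA (hr r hr')

lemma UGAlong.acAlong (h : γ.UGAlong f g E) (hE : γ.InSet E) (hg : Measurable g)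
    (hfin : curveLint γ g < ⊤) : γ.ACAlong f :=
  absolutelyContinuousOnInterval_of_edist_le γ.len_pos.le (γ.aemeasurable_comp hg) hfin
    fun s t hs hst ht => h s t hs hst ht fun r hr => hE r ⟨hs.trans hr.1, hr.2.trans ht⟩

/-- Localization of derivative bounds to sets which are relatively open along the curve. -/
lemma UGAlong.dBound (h : γ.UGAlong f g A) (hac : γ.ACAlong f) (hg : Measurable g)
    (hA : MeasurableSet A) (hfin : curveLint γ (A.indicator g) < ⊤)
    (hopen : ∀ t ∈ Ioo 0 γ.len, γ.toFun t ∈ A → ∀ᶠ r in nhds t, γ.toFun r ∈ A) :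
    γ.DBound f g A := by
  obtain ⟨T, hT, hTeq⟩ : ∃ T : Set ℝ, MeasurableSet T ∧
      ∀ t, t ∈ T ↔ t ∈ Icc 0 γ.len ∧ γ.toFun t ∈ A := by
    refine ⟨{t | t ∈ Icc 0 γ.len ∧ IccExtend γ.len_pos.le (fun t => γ.toFun t) t ∈ A}, ?_, ?_⟩
    · refine measurableSet_Icc.inter ?_
      have : Continuous (IccExtend γ.len_pos.le (fun t : Icc 0 γ.len => γ.toFun t)) :=
        (continuousOn_iff_continuous_domRestrict.1 γ.continuousOn).Icc_extend'
      exact this.measurable hA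
    · intro t
      refine and_congr_right fun ht => ?_
      rw [IccExtend_of_mem _ _ ht]
  have hTI : T ⊆ Icc 0 γ.len := fun t ht => ((hTeq t).1 ht).1
  have hk : AEMeasurable (fun t => g (γ.toFun t)) (volume.restrict T) :=
    (γ.aemeasurable_comp hg).mono_measure (Measure.restrict_mono_set _ hTI)
  have hint : ∫⁻ t in T, g (γ.toFun t) < ⊤ := by
    refine lt_of_le_of_lt ?_ hfin
    calc ∫⁻ t in T, g (γ.toFun t) = ∫⁻ t in T, A.indicator g (γ.toFun t) :=
          setLIntegral_congr_fun hT fun t ht => (indicator_of_mem ((hTeq t).1 ht).2 g).symm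
      _ ≤ _ := lintegral_mono_set hTI
  have main := ae_enorm_deriv_le (y := fun t => f (γ.toFun t)) hT hk hint fun s t hst hsub =>
    h s t (hTI (hsub (left_mem_Icc.2 hst))).1 hst (hTI (hsub (right_mem_Icc.2 hst))).2
      fun r hr => ((hTeq r).1 (hsub hr)).2
  filter_upwards [ae_restrict_of_ae main, hac.ae_differentiableAt, γ.ae_mem_Ioo] with t h1 h2 h3 h4
  refine h1 ?_ h2
  filter_upwards [hopen t h3 h4, isOpen_Ioo.mem_nhds h3] with r hr hr'
  exact (hTeq r).2 ⟨Ioo_subset_Icc_self hr', hr⟩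

lemma UGAlong.dBound_univ (h : γ.UGAlong f g E) (hE : γ.InSet E) (hg : Measurable g)
    (hfin : curveLint γ g < ⊤) : γ.DBound f g univ := by
  have h' : γ.UGAlong f g univ := fun s t hs hst ht _ =>
    h s t hs hst ht fun r hr => hE r ⟨hs.trans hr.1, hr.2.trans ht⟩
  exact h'.dBound (h.acAlong hE hg hfin) hg .univ (by simpa using hfin) (by simp)

lemma DBound.mono (h : γ.DBound f g₁ A) (hB : B ⊆ A) (hg : ∀ x ∈ B, g₁ x ≤ g₂ x) :
    γ.DBound f g₂ B := by
  filter_upwards [h] with t ht hB'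
  exact (ht (hB hB')).trans (hg _ hB')

lemma DBound.union (h₁ : γ.DBound f g A) (h₂ : γ.DBound f g B) : γ.DBound f g (A ∪ B) := by
  filter_upwards [h₁, h₂] with t h1 h2
  rintro (h | h)
  exacts [h1 h, h2 h]

lemma DBound.congr (h : γ.DBound f₁ g A) (h₁ : γ.ACAlong f₁) (h₂ : γ.ACAlong f₂)
    (heq : EqOn f₁ f₂ A) : γ.DBound f₂ g A := by
  have := ae_deriv_eq_of_eqOn (y := fun t => f₁ (γ.toFun t)) (z := fun t => f₂ (γ.toFun t))
    (S := {t | γ.toFun t ∈ A}) fun t ht => heq ht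
  filter_upwards [h, h₁.ae_differentiableAt, h₂.ae_differentiableAt,
    ae_restrict_of_ae this] with t h1 h2 h3 h4 hA
  rw [← h4 hA h2 h3]
  exact h1 hA

lemma dBound_of_eqOn_const {c : ℝ} (h : γ.ACAlong f) (hA : ∀ x ∈ A, f x = c) :
    γ.DBound f g A := by
  refine DBound.congr (f₁ := fun _ => c) ?_ (acAlong_const γ c) h fun x hx => (hA x hx).symm
  exact ae_of_all _ fun t _ => by simp

lemma DBound.add (h₁ : γ.DBound f₁ g₁ A) (h₂ : γ.DBound f₂ g₂ A) (h₁' : γ.ACAlong f₁)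
    (h₂' : γ.ACAlong f₂) : γ.DBound (fun x => f₁ x + f₂ x) (fun x => g₁ x + g₂ x) A := by
  filter_upwards [h₁, h₂, h₁'.ae_differentiableAt, h₂'.ae_differentiableAt]
    with t h1 h2 h3 h4 hA
  rw [deriv_fun_add h3 h4]
  exact (enorm_add_le _ _).trans (add_le_add (h1 hA) (h2 hA))

lemma DBound.neg (h₁ : γ.DBound f₁ g₁ A) : γ.DBound (fun x => - f₁ x) g₁ A := by
  filter_upwards [h₁] with t h1 hA
  rw [deriv.fun_neg, enorm_neg]
  exact h1 hA

lemma DBound.edist_le (h : γ.DBound f g univ) (hac : γ.ACAlong f) :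
    edist (f (γ.toFun 0)) (f (γ.toFun γ.len)) ≤ curveLint γ g :=
  edist_le_of_enorm_deriv_le γ.len_pos.le hac (by
    filter_upwards [h] with t ht using ht (mem_univ _))

end Curve

variable [SFinite μ] {f : X → ℝ} {g : X → ℝ≥0∞} {E : Set X}

lemma IsWeakUpperGradientOn.eventually_ugAlong (hp : 0 < p)
    (h : IsWeakUpperGradientOn μ p f g E) :
    ∀ᶠ γ in curveFilter μ p hp, γ.UGAlong f g E := by
  filter_upwards [eventually_curve_sub ((isWeakUpperGradientOn_iff hp).1 h)]
    with γ hγ s t hs hst ht hE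
  rcases hst.eq_or_lt with rfl | hst
  · simp
  have := hγ s t hs hst ht fun r hr => hE _ ⟨by linarith [hr.1], by
    have : r ≤ t - s := hr.2
    linarith⟩
  rw [curveLint_sub] at this
  simpa [Curve.sub] using this

/-- Along almost every curve a function with a weak upper gradient in `L^p` is absolutely
continuous with derivative bounded by the weak upper gradient. -/
lemma IsWeakUpperGradientOn.eventually_acAlong (hp : 0 < p)
    (h : IsWeakUpperGradientOn μ p f g E) (hg : Measurable g)
    (hfin : ∫⁻ x in E, g x ^ p ∂μ < ⊤) :
    ∀ᶠ γ in curveFilter μ p hp, γ.InSet E →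
      γ.ACAlong f ∧ γ.DBound f g univ ∧ curveLint γ g < ⊤ := by
  filter_upwards [h.eventually_ugAlong hp, eventually_curveLint_lt_top_of_inSet hg hfin]
    with γ h1 h2 hE
  exact ⟨h1.acAlong hE hg (h2 hE), h1.dBound_univ hE hg (h2 hE), h2 hE⟩

lemma isWeakUpperGradientOn_of_eventually (hp : 0 < p)
    (h : ∀ᶠ γ in curveFilter μ p hp, γ.InSet E → curveLint γ g < ⊤ →
      γ.ACAlong f ∧ γ.DBound f g univ) :
    IsWeakUpperGradientOn μ p f g E := by
  refine (isWeakUpperGradientOn_iff hp).2 ?_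
  filter_upwards [h] with γ hγ hE
  rcases eq_top_or_lt_top (curveLint γ g) with ht | ht
  · rw [ht]; exact le_top
  · exact (hγ hE ht).2.edist_le (hγ hE ht).1

lemma IsWeakUpperGradientOn.mono_set (hp : 0 < p) {A : Set X}
    (h : IsWeakUpperGradientOn μ p f g E) (hA : A ⊆ E) : IsWeakUpperGradientOn μ p f g A := by
  rw [isWeakUpperGradientOn_iff hp] at h ⊢
  filter_upwards [h] with γ hγ hE
  exact hγ fun t ht => hA (hE t ht)

lemma MemNp.exists_gradient (h : MemNp μ p f E) : ∃ g : X → ℝ≥0∞, Measurable g ∧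
    IsWeakUpperGradientOn μ p f g E ∧ ∫⁻ x in E, g x ^ p ∂μ < ⊤ := by
  have := (ENNReal.add_lt_top.1 h.2).2
  simp only [iInf_lt_iff] at this
  obtain ⟨g, hg, hw, hlt⟩ := this
  exact ⟨g, hg, hw, hlt⟩

lemma memNp_of_gradient (hf : Measurable f) (hfin : ∫⁻ x in E, ENNReal.ofReal |f x| ^ p ∂μ < ⊤)
    (hg : Measurable g) (hw : IsWeakUpperGradientOn μ p f g E)
    (hgfin : ∫⁻ x in E, g x ^ p ∂μ < ⊤) : MemNp μ p f E :=
  ⟨hf, ENNReal.add_lt_top.2 ⟨hfin,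
    (iInf₂_le_of_le g hg (iInf_le_of_le hw le_rfl)).trans_lt hgfin⟩⟩

lemma MemNp.mono_set (hp : 0 < p) {A : Set X} (h : MemNp μ p f E) (hA : A ⊆ E) :
    MemNp μ p f A := by
  obtain ⟨g, hg, hw, hfin⟩ := h.exists_gradient
  exact memNp_of_gradient h.1
    ((lintegral_mono_set hA).trans_lt (ENNReal.add_lt_top.1 h.2).1) hg (hw.mono_set hp hA)
    ((lintegral_mono_set hA).trans_lt hfin)

lemma exists_of_fineEnergy_lt {S : Set X} {c : ℝ≥0∞} (h : fineEnergy μ p f E S < c) :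
    ∃ g : X → ℝ≥0∞, Measurable g ∧ IsWeakUpperGradientOn μ p f g E ∧
      ∫⁻ x in S, g x ^ p ∂μ < c := by
  simp only [fineEnergy, iInf_lt_iff] at h
  obtain ⟨g, hg, hw, hlt⟩ := h
  exact ⟨g, hg, hw, hlt⟩

lemma fineEnergy_le {S : Set X} (hg : Measurable g) (hw : IsWeakUpperGradientOn μ p f g E) :
    fineEnergy μ p f E S ≤ ∫⁻ x in S, g x ^ p ∂μ :=
  iInf₂_le_of_le g hg (iInf_le_of_le hw le_rfl)

lemma fineEnergy_lt_top_of_memNp {S : Set X} (h : MemNp μ p f E) (hS : S ⊆ E) :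
    fineEnergy μ p f E S < ⊤ := by
  obtain ⟨g, hg, hw, hfin⟩ := h.exists_gradient
  exact (fineEnergy_le hg hw).trans_lt ((lintegral_mono_set hS).trans_lt hfin)

end CurveCalculus

section LocalComparison

variable {μ : Measure X} {p : ℝ}

lemma lintegral_add_rpow_lt_top {α : Type*} [MeasurableSpace α] {ν : Measure α} (hp : 1 ≤ p)
    {a b : α → ℝ≥0∞} (ha : Measurable a)
    (haf : ∫⁻ x, a x ^ p ∂ν < ⊤) (hbf : ∫⁻ x, b x ^ p ∂ν < ⊤) :
    ∫⁻ x, (a x + b x) ^ p ∂ν < ⊤ := by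
  have h2 : ((2 : ℝ≥0∞) ^ (p - 1)) ≠ ⊤ :=
    ENNReal.rpow_ne_top_of_nonneg (by linarith) (by simp)
  calc ∫⁻ x, (a x + b x) ^ p ∂ν ≤ ∫⁻ x, 2 ^ (p - 1) * (a x ^ p + b x ^ p) ∂ν :=
        lintegral_mono fun x => ENNReal.rpow_add_le_mul_rpow_add_rpow _ _ hp
    _ = 2 ^ (p - 1) * (∫⁻ x, a x ^ p ∂ν + ∫⁻ x, b x ^ p ∂ν) := by
        rw [lintegral_const_mul' _ _ h2, lintegral_add_left (ha.pow_const p)]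
    _ < ⊤ := ENNReal.mul_lt_top h2.lt_top (ENNReal.add_lt_top.2 ⟨haf, hbf⟩)

lemma lintegral_const_mul_rpow_lt_top {α : Type*} [MeasurableSpace α] {ν : Measure α}
    (hp : 0 ≤ p) {a : α → ℝ≥0∞} (haf : ∫⁻ x, a x ^ p ∂ν < ⊤) {c : ℝ≥0∞} (hc : c ≠ ⊤) :
    ∫⁻ x, (c * a x) ^ p ∂ν < ⊤ := by
  simp_rw [ENNReal.mul_rpow_of_nonneg _ _ hp]
  rw [lintegral_const_mul' _ _ (ENNReal.rpow_ne_top_of_nonneg hp hc)]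
  exact ENNReal.mul_lt_top (ENNReal.rpow_lt_top_of_nonneg hp hc) haf

lemma setLIntegral_piecewise_rpow {W : Set X} [∀ x, Decidable (x ∈ W)] (hW : MeasurableSet W) (S : Set X)
    (a b : X → ℝ≥0∞) :
    ∫⁻ x in S, (W.piecewise a b x) ^ p ∂μ =
      ∫⁻ x in W ∩ S, a x ^ p ∂μ + ∫⁻ x in Wᶜ ∩ S, b x ^ p ∂μ := by
  rw [← lintegral_add_compl _ hW, Measure.restrict_restrict hW,
    Measure.restrict_restrict hW.compl]
  congr 1
  · rw [← Measure.restrict_restrict hW]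
    exact setLIntegral_congr_fun hW fun x hx => by simp only [piecewise_eq_of_mem _ _ _ hx]
  · rw [← Measure.restrict_restrict hW.compl]
    exact setLIntegral_congr_fun hW.compl fun x hx => by
      simp only [piecewise_eq_of_notMem _ _ _ hx]

lemma setLIntegral_inter_add_compl {W : Set X} (hW : MeasurableSet W) (S : Set X)
    (a : X → ℝ≥0∞) :
    ∫⁻ x in W ∩ S, a x ∂μ + ∫⁻ x in Wᶜ ∩ S, a x ∂μ = ∫⁻ x in S, a x ∂μ := by
  rw [← Measure.restrict_restrict hW, ← Measure.restrict_restrict hW.compl,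
    lintegral_add_compl _ hW]

lemma lintegral_indicator_rpow (hp : 0 < p) {W : Set X} (hW : MeasurableSet W)
    (a : X → ℝ≥0∞) : ∫⁻ x, (W.indicator a x) ^ p ∂μ = ∫⁻ x in W, a x ^ p ∂μ := by
  rw [← lintegral_indicator hW]
  congr 1 with x
  by_cases hx : x ∈ W <;> simp [hx, hp]

lemma Curve.ACAlong.eventually_ne {γ : Curve X} {f : X → ℝ} (h : γ.ACAlong f) {c : ℝ} :
    ∀ t ∈ Ioo 0 γ.len, γ.toFun t ∈ {x | f x ≠ c} → ∀ᶠ r in nhds t, γ.toFun r ∈ {x | f x ≠ c} :=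
  fun t ht hne => ((h.continuousOn t (Ioo_subset_Icc_self ht)).continuousAt
    (Icc_mem_nhds ht.1 ht.2)).eventually_ne hne

lemma Curve.ACAlong.eventually_lt {γ : Curve X} {f : X → ℝ} (h : γ.ACAlong f) {c : ℝ} :
    ∀ t ∈ Ioo 0 γ.len, γ.toFun t ∈ {x | c < f x} → ∀ᶠ r in nhds t, γ.toFun r ∈ {x | c < f x} :=
  fun t ht hne => ((h.continuousOn t (Ioo_subset_Icc_self ht)).continuousAt
    (Icc_mem_nhds ht.1 ht.2)).eventually (lt_mem_nhds hne)

lemma curveLint_mono_lt_top {γ : Curve X} {g h : X → ℝ≥0∞} (hgh : ∀ x, g x ≤ h x)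
    (hh : curveLint γ h < ⊤) : curveLint γ g < ⊤ :=
  (curveLint_mono γ hgh).trans_lt hh

lemma curveLint_add (γ : Curve X) {g : X → ℝ≥0∞} (hg : Measurable g) (h : X → ℝ≥0∞) :
    curveLint γ (fun x => g x + h x) = curveLint γ g + curveLint γ h :=
  lintegral_add_left' (γ.aemeasurable_comp hg) _

lemma MemNp.add [SFinite μ] (hp : 1 ≤ p) {f₁ f₂ : X → ℝ} {E : Set X} (h₁ : MemNp μ p f₁ E)
    (h₂ : MemNp μ p f₂ E) : MemNp μ p (fun x => f₁ x + f₂ x) E := by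
  have hp0 : 0 < p := by linarith
  obtain ⟨g₁, hg₁, hw₁, hfin₁⟩ := h₁.exists_gradient
  obtain ⟨g₂, hg₂, hw₂, hfin₂⟩ := h₂.exists_gradient
  refine memNp_of_gradient (g := fun x => g₁ x + g₂ x) (h₁.1.add h₂.1) ?_ (hg₁.add hg₂) ?_
    (lintegral_add_rpow_lt_top hp hg₁ hfin₁ hfin₂)
  · refine lt_of_le_of_lt (lintegral_mono fun x => ?_) (lintegral_add_rpow_lt_top hp
      (a := fun x => ENNReal.ofReal |f₁ x|) (b := fun x => ENNReal.ofReal |f₂ x|)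
      (by have := h₁.1; fun_prop)
      (ENNReal.add_lt_top.1 h₁.2).1 (ENNReal.add_lt_top.1 h₂.2).1)
    rw [← ENNReal.ofReal_add (abs_nonneg _) (abs_nonneg _)]
    gcongr
    exact abs_add_le _ _
  · refine isWeakUpperGradientOn_of_eventually hp0 ?_
    filter_upwards [hw₁.eventually_acAlong hp0 hg₁ hfin₁, hw₂.eventually_acAlong hp0 hg₂ hfin₂]
      with γ h1 h2 hE _
    obtain ⟨ha, hb, -⟩ := h1 hE
    obtain ⟨ha', hb', -⟩ := h2 hE
    exact ⟨ha.add ha', hb.add hb' ha ha'⟩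

lemma MemNp0.add [SFinite μ] (hp : 1 ≤ p) {f₁ f₂ : X → ℝ} {E : Set X} (h₁ : MemNp0 μ p f₁ E)
    (h₂ : MemNp0 μ p f₂ E) : MemNp0 μ p (fun x => f₁ x + f₂ x) E :=
  ⟨h₁.1.add hp h₂.1, fun x hx => by simp [h₁.2 x hx, h₂.2 x hx]⟩

lemma MemNp0.mono {f : X → ℝ} {A B : Set X} (h : MemNp0 μ p f A) (hAB : A ⊆ B) :
    MemNp0 μ p f B :=
  ⟨h.1, fun x hx => h.2 x fun hA => hx (hAB hA)⟩

lemma sobolevCap_mono {A B : Set X} (h : A ⊆ B) : sobolevCap μ p A ≤ sobolevCap μ p B :=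
  iInf₂_mono fun _ _ => le_iInf fun h' => iInf_le _ fun x hx => h' x (h hx)

open Classical in
/-- A global energy comparison between `u` and `u + φ` localizes to any set containing the
support of `φ`. -/
lemma fineEnergy_le_of_fineEnergy_le [SFinite μ] (hp : 1 < p) {u φ : X → ℝ} {U V : Set X}
    (hu : MemNp μ p u U) (hφ : MemNp0 μ p φ V) (hVU : V ⊆ U)
    (hmin : fineEnergy μ p u U U ≤ fineEnergy μ p (fun x => u x + φ x) U U) :
    fineEnergy μ p u U V ≤ fineEnergy μ p (fun x => u x + φ x) U V := by
  have hp0 : 0 < p := by linarith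
  refine le_iInf₂ fun g hg => le_iInf fun hw => ?_
  refine ENNReal.le_of_forall_pos_le_add fun η hη hgfin => ?_
  obtain ⟨gu, hgu, hwu, hlt⟩ := exists_of_fineEnergy_lt (ENNReal.lt_add_right
    (fineEnergy_lt_top_of_memNp hu subset_rfl).ne (ENNReal.coe_pos.2 hη).ne')
  have hufin : ∫⁻ x in U, gu x ^ p ∂μ < ⊤ :=
    hlt.trans_le le_top
  obtain ⟨gφ, hgφ, hwφ, hφfin⟩ := hφ.1.exists_gradient
  set W : Set X := {x | φ x ≠ 0} with hWdef
  have hW : MeasurableSet W := hφ.1.1 (measurableSet_singleton 0).compl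
  have hWV : W ⊆ V := fun x hx => by
    by_contra hV
    exact hx (hφ.2 x hV)
  have hvW : ∀ x ∈ Wᶜ, u x = u x + φ x := fun x hx => by
    have : φ x = 0 := by simpa [hWdef] using hx
    simp [this]
  have hWg : ∀ᶠ γ in curveFilter μ p hp0, curveLint γ (W.indicator g) < ⊤ := by
    refine eventually_curveLint_lt_top (hg.indicator hW) ?_
    rw [lintegral_indicator_rpow hp0 hW]
    exact (lintegral_mono_set hWV).trans_lt hgfin
  have hA : IsWeakUpperGradientOn μ p (fun x => u x + φ x) (W.piecewise g gu) U := by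
    refine isWeakUpperGradientOn_of_eventually hp0 ?_
    filter_upwards [hwu.eventually_acAlong hp0 hgu hufin, hwφ.eventually_acAlong hp0 hgφ hφfin,
      hw.eventually_ugAlong hp0, hWg] with γ h1 h2 h3 h4 hγ _
    obtain ⟨ha, hb, -⟩ := h1 hγ
    obtain ⟨hc, -, -⟩ := h2 fun t _ => mem_univ _
    refine ⟨ha.add hc, ?_⟩
    rw [← union_compl_self W]
    refine Curve.DBound.union ?_ ?_
    · have h3' : γ.UGAlong (fun x => u x + φ x) g W := h3.mono_set (hWV.trans hVU)
      exact (h3'.dBound (ha.add hc) hg hW h4 hc.eventually_ne).mono subset_rfl fun x hx => by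
        simp [hx]
    · refine (hb.mono (subset_univ _) fun x hx => ?_).congr ha (ha.add hc) hvW
      rw [piecewise_eq_of_notMem _ _ _ hx]
  have hB : IsWeakUpperGradientOn μ p u (W.piecewise gu g) U := by
    refine isWeakUpperGradientOn_of_eventually hp0 ?_
    filter_upwards [hwu.eventually_acAlong hp0 hgu hufin, hwφ.eventually_acAlong hp0 hgφ hφfin,
      hw.eventually_ugAlong hp0, hWg] with γ h1 h2 h3 h4 hγ hfin
    obtain ⟨ha, hb, -⟩ := h1 hγ
    obtain ⟨hc, -, -⟩ := h2 fun t _ => mem_univ _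
    refine ⟨ha, ?_⟩
    rw [← union_compl_self W]
    refine Curve.DBound.union ?_ ?_
    · exact hb.mono (subset_univ _) fun x hx => by simp [hx]
    · have hgγ : curveLint γ g < ⊤ := by
        refine lt_of_le_of_lt (curveLint_mono γ
          (h := fun x => W.indicator g x + W.piecewise gu g x) fun x => ?_) ?_
        · by_cases hx : x ∈ W <;> simp [hx]
        · rw [curveLint_add γ (hg.indicator hW)]
          exact ENNReal.add_lt_top.2 ⟨h4, hfin⟩
      refine ((h3.dBound_univ hγ hg hgγ).mono (subset_univ _) fun x hx => ?_).congr
        (ha.add hc) ha fun x hx => (hvW x hx).symm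
      rw [piecewise_eq_of_notMem _ _ _ hx]
  have hWU : W ∩ U = W := inter_eq_left.2 (hWV.trans hVU)
  have hWVi : W ∩ V = W := inter_eq_left.2 hWV
  have key : ∫⁻ x in W, gu x ^ p ∂μ ≤ ∫⁻ x in W, g x ^ p ∂μ + η := by
    have h1 := hmin.trans (fineEnergy_le (hg.piecewise hW hgu) hA)
    rw [setLIntegral_piecewise_rpow hW, hWU] at h1
    have h2 := hlt.le
    rw [← setLIntegral_inter_add_compl hW U, hWU] at h2
    have hne : ∫⁻ x in Wᶜ ∩ U, gu x ^ p ∂μ ≠ ⊤ :=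
      ((lintegral_mono_set inter_subset_right).trans_lt hufin).ne
    refine (ENNReal.add_le_add_iff_right hne).1 (h2.trans ?_)
    calc _ ≤ ∫⁻ x in W, g x ^ p ∂μ + ∫⁻ x in Wᶜ ∩ U, gu x ^ p ∂μ + η := by gcongr
      _ = _ := by ring
  refine (fineEnergy_le (hgu.piecewise hW hg) hB).trans ?_
  rw [setLIntegral_piecewise_rpow hW, hWVi, ← setLIntegral_inter_add_compl hW V (fun x => g x ^ p),
    hWVi]
  calc _ ≤ ∫⁻ x in W, g x ^ p ∂μ + η + ∫⁻ x in Wᶜ ∩ V, g x ^ p ∂μ := by gcongr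
    _ = _ := by ring

lemma add_mem_obstacleClass [SFinite μ] (hp : 1 < p) {U V : Set X} {ψ : X → EReal}
    {f u φ : X → ℝ} (hu : u ∈ obstacleClass μ p U ψ f) (hVU : V ⊆ U) (hφ : MemNp0 μ p φ V)
    (hψ : sobolevCap μ p {x | x ∈ U ∧ ((u x + φ x : ℝ) : EReal) < ψ x} = 0) :
    (fun x => u x + φ x) ∈ obstacleClass μ p U ψ f := by
  refine ⟨hu.1.add hp.le (hφ.1.mono_set (by linarith) (subset_univ _)), ?_, hψ⟩
  convert hu.2.1.add hp.le (hφ.mono hVU) using 1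
  ext x
  by_cases hx : x ∈ U
  · simp [hx]; ring
  · simp [hx, hφ.2 x fun hV => hx (hVU hV)]

lemma MemNp.memNpFineLoc [SFinite μ] (hp : 0 < p) {u : X → ℝ} {U : Set X}
    (hu : MemNp μ p u U) : MemNpFineLoc μ p u U :=
  fun _ hV => hu.mono_set hp (subset_closure.trans hV.2.2.2)

end LocalComparison

section Doubling

variable {μ : Measure X}

lemma DoublingMeasure.sigmaFinite (h : DoublingMeasure μ) : SigmaFinite μ := by
  rcases isEmpty_or_nonempty X with hX | ⟨⟨x⟩⟩
  · have : μ = 0 := Measure.eq_zero_of_isEmpty μ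
    rw [this]; infer_instance
  · refine ⟨⟨⟨fun n : ℕ => ball x (n + 1), fun _ => trivial,
      fun n => (h.1 x (n + 1) (by positivity)).2, ?_⟩⟩⟩
    refine eq_univ_of_forall fun y => mem_iUnion.2 ?_
    obtain ⟨n, hn⟩ := exists_nat_gt (dist y x)
    exact ⟨n, mem_ball.2 (by linarith)⟩

lemma measure_ball_two_pow_mul_le {C : ℝ≥0∞}
    (hC : ∀ (x : X) (r : ℝ), 0 < r → μ (ball x (2 * r)) ≤ C * μ (ball x r)) (x : X) {r : ℝ}
    (hr : 0 < r) (k : ℕ) : μ (ball x (2 ^ k * r)) ≤ C ^ k * μ (ball x r) := by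
  induction k with
  | zero => simp
  | succ k ih =>
    calc μ (ball x (2 ^ (k + 1) * r)) = μ (ball x (2 * (2 ^ k * r))) := by ring_nf
      _ ≤ C * μ (ball x (2 ^ k * r)) := hC x _ (by positivity)
      _ ≤ C * (C ^ k * μ (ball x r)) := by gcongr
      _ = C ^ (k + 1) * μ (ball x r) := by ring

lemma DoublingMeasure.totallyBounded_ball (h : DoublingMeasure μ) (x : X) {R : ℝ} (hR : 0 < R) :
    TotallyBounded (ball x R) := by
  obtain ⟨hpos, C, hCtop, hC⟩ := h
  refine Metric.totallyBounded_iff.2 fun ε hε => ?_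
  by_contra! hcon
  obtain ⟨f, hf, hsep⟩ := exists_seq_of_forall_finset_exists (· ∈ ball x R)
    (fun y z => ε ≤ dist z y) fun s hs => by
      obtain ⟨y, hy, hy'⟩ := not_subset.1 (hcon s s.finite_toSet)
      refine ⟨y, hy, fun z hz => ?_⟩
      by_contra! hlt
      exact hy' (mem_iUnion₂.2 ⟨z, hz, hlt⟩)
  obtain ⟨k, hk⟩ : ∃ k : ℕ, 2 * R / (ε / 2) < 2 ^ k := pow_unbounded_of_one_lt _ (by norm_num)
  have hε2 : 0 < ε / 2 := by positivity
  have hlow : ∀ n, μ (ball x R) / C ^ k ≤ μ (ball (f n) (ε / 2)) := fun n => by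
    refine ENNReal.div_le_of_le_mul ?_
    rw [mul_comm]
    refine le_trans (measure_mono ?_) (measure_ball_two_pow_mul_le hC (f n) hε2 k)
    have h1 : 2 * R < 2 ^ k * (ε / 2) := (div_lt_iff₀ hε2).1 hk
    have h2 : dist (f n) x < R := hf n
    refine ball_subset_ball' ?_
    rw [dist_comm]
    linarith
  have hdisj : Pairwise (Function.onFun Disjoint fun n => ball (f n) (ε / 2)) := by
    have : ∀ m n, m < n → Disjoint (ball (f m) (ε / 2)) (ball (f n) (ε / 2)) := fun m n hmn =>
      ball_disjoint_ball (by have := hsep m n hmn; rw [dist_comm] at this; linarith)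
    intro m n hmn
    rcases hmn.lt_or_gt with h | h
    exacts [this m n h, (this n m h).symm]
  have hsub : (⋃ n, ball (f n) (ε / 2)) ⊆ ball x (R + ε) := iUnion_subset fun n =>
    ball_subset_ball' (by have h2 : dist (f n) x < R := hf n; linarith)
  have hfin : μ (⋃ n, ball (f n) (ε / 2)) < ⊤ :=
    (measure_mono hsub).trans_lt (hpos x _ (by positivity)).2
  rw [measure_iUnion hdisj fun _ => measurableSet_ball] at hfin
  refine hfin.ne (top_unique (le_trans ?_ (ENNReal.tsum_le_tsum hlow)))
  rw [ENNReal.tsum_const_eq_top_of_ne_zero]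
  exact (ENNReal.div_pos (hpos x R hR).1.ne' (ENNReal.pow_ne_top hCtop.ne)).ne'

lemma DoublingMeasure.properSpace [CompleteSpace X] (h : DoublingMeasure μ) : ProperSpace X := by
  refine ⟨fun x r => ?_⟩
  have hb : TotallyBounded (closedBall x r) :=
    (h.totallyBounded_ball x (R := |r| + 1) (by positivity)).subset
      (closedBall_subset_ball (by linarith [le_abs_self r]))
  exact hb.isCompact_of_isClosed isClosed_closedBall

end Doubling

section Lusin

variable {μ : Measure X}

/-- Lusin's theorem, relative to an open set of finite measure. -/
lemma exists_isClosed_continuousOn {f : X → ℝ} (hf : Measurable f) {Ω : Set X} (hΩ : IsOpen Ω)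
    (hfin : μ Ω < ⊤) {e : ℝ≥0∞} (he : e ≠ 0) :
    ∃ A ⊆ Ω, IsClosed A ∧ ContinuousOn f A ∧ μ (Ω \ A) < e := by
  have : IsFiniteMeasure (μ.restrict Ω) := ⟨by simpa using hfin⟩
  have he2 : e / 2 ≠ 0 := (ENNReal.half_pos he).ne'
  obtain ⟨δ, hδ, hsum⟩ := ENNReal.exists_pos_sum_of_countable' he2 ℚ
  have hδ2 : ∀ q, δ q / 2 ≠ 0 := fun q => (ENNReal.half_pos (hδ q).ne').ne'
  have hS : ∀ q : ℚ, MeasurableSet {x | (q : ℝ) < f x} := fun q =>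
    measurableSet_lt measurable_const hf
  choose C hCS hC hCm using fun q : ℚ =>
    (hS q).exists_isClosed_sdiff_lt (μ := μ.restrict Ω) (measure_ne_top _ _) (hδ2 q)
  choose C' hCS' hC' hCm' using fun q : ℚ =>
    (hS q).compl.exists_isClosed_sdiff_lt (μ := μ.restrict Ω) (measure_ne_top _ _)
      (hδ2 q)
  obtain ⟨B, hBΩ, hB, hBm⟩ := hΩ.measurableSet.exists_isClosed_sdiff_lt (μ := μ.restrict Ω)
    (measure_ne_top _ _) he2
  set A : Set X := B ∩ ⋂ q, (C q ∪ C' q)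
  have hAC : ∀ (q : ℚ), ∀ x ∈ A, x ∈ C q ∪ C' q := fun q x hx => mem_iInter.1 hx.2 q
  have hA : IsClosed A := hB.inter (isClosed_iInter fun q => (hC q).union (hC' q))
  refine ⟨A, inter_subset_left.trans hBΩ, hA, ?_, ?_⟩
  · intro x hx
    refine tendsto_order.2 ⟨fun a ha => ?_, fun a ha => ?_⟩
    · obtain ⟨q, hq1, hq2⟩ := exists_rat_btwn ha
      have hxC : x ∉ C' q := fun h => hCS' q h hq2
      filter_upwards [self_mem_nhdsWithin,
        mem_nhdsWithin_of_mem_nhds ((hC' q).isOpen_compl.mem_nhds hxC)] with y hyA hy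
      exact hq1.trans (hCS q ((hAC q y hyA).resolve_right hy))
    · obtain ⟨q, hq1, hq2⟩ := exists_rat_btwn ha
      have hxC : x ∉ C q := fun h => (hCS q h : (q : ℝ) < f x).not_gt hq1
      filter_upwards [self_mem_nhdsWithin,
        mem_nhdsWithin_of_mem_nhds ((hC q).isOpen_compl.mem_nhds hxC)] with y hyA hy
      exact (show f y ≤ q from not_lt.1 (show ¬ (q : ℝ) < f y from
        hCS' q ((hAC q y hyA).resolve_left hy))).trans_lt hq2
  · have hcov : Ω \ A ⊆ (Ω \ B) ∪ ⋃ q : ℚ, ((({x | (q : ℝ) < f x} \ C q) ∪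
        ({x | (q : ℝ) < f x}ᶜ \ C' q)) ∩ Ω) := by
      rintro x ⟨hxΩ, hxA⟩
      by_cases hxB : x ∈ B
      · right
        obtain ⟨q, hq⟩ : ∃ q, x ∉ C q ∪ C' q := by
          by_contra! h
          exact hxA ⟨hxB, mem_iInter.2 h⟩
        refine mem_iUnion.2 ⟨q, ⟨?_, hxΩ⟩⟩
        by_cases hxq : (q : ℝ) < f x
        · exact Or.inl ⟨hxq, fun h => hq (Or.inl h)⟩
        · exact Or.inr ⟨hxq, fun h => hq (Or.inr h)⟩
      · exact Or.inl ⟨hxΩ, hxB⟩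
    refine (measure_mono hcov).trans_lt ((measure_union_le _ _).trans_lt ?_)
    rw [← ENNReal.add_halves e]
    refine ENNReal.add_lt_add ?_ (lt_of_le_of_lt ((measure_iUnion_le _).trans (ENNReal.tsum_le_tsum fun q => ?_)) hsum)
    · rw [Measure.restrict_apply (hΩ.measurableSet.diff hB.measurableSet),
        inter_eq_left.2 sdiff_subset] at hBm
      exact hBm
    · have hm := (hS q).diff (hC q).measurableSet
      have hm' := (hS q).compl.diff (hC' q).measurableSet
      rw [← Measure.restrict_apply (hm.union hm')]
      refine (measure_union_le _ _).trans ?_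
      rw [← ENNReal.add_halves (δ q)]
      exact add_le_add (hCm q).le (hCm' q).le

end Lusin

section Envelope

/-- The curve traversed backwards. -/
def Curve.reverse (γ : Curve X) : Curve X where
  len := γ.len
  len_pos := γ.len_pos
  toFun t := γ.toFun (γ.len - t)
  lip := by
    refine LipschitzOnWith.of_dist_le_mul fun x hx y hy => ?_
    have := γ.lip.dist_le_mul (γ.len - x) ⟨by linarith [hx.2], by linarith [hx.1]⟩ (γ.len - y)
      ⟨by linarith [hy.2], by linarith [hy.1]⟩
    rwa [Real.dist_eq, show γ.len - x - (γ.len - y) = y - x by ring, ← Real.dist_eq,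
      dist_comm y x] at this

lemma curveLint_reverse (γ : Curve X) (g : X → ℝ≥0∞) :
    curveLint γ.reverse g = curveLint γ g := by
  have h := (volume.measurePreserving_sub_left γ.len).setLIntegral_comp_preimage_emb
    (MeasurableEquiv.subLeft γ.len).measurableEmbedding (fun r => g (γ.toFun r)) (Icc 0 γ.len)
  rw [preimage_const_sub_Icc, sub_self, sub_zero] at h
  exact h

lemma Curve.exists_lipschitzWith (γ : Curve X) :
    ∃ σ : ℝ → X, LipschitzWith 1 σ ∧ EqOn σ γ.toFun (Icc 0 γ.len) := by
  refine ⟨IccExtend γ.len_pos.le fun t => γ.toFun t, ?_, fun t ht => ?_⟩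
  · exact (LipschitzWith.of_dist_le_mul fun s t => γ.lip.dist_le_mul s s.2 t t.2 :
      LipschitzWith 1 fun t : Icc 0 γ.len => γ.toFun t).comp (LipschitzWith.projIcc _) |>.weaken (by simp)
  · rw [IccExtend_of_mem _ _ ht]

/-- The cheapest way of connecting `x` to `A`, where the cost of a path is its `g`-length plus
the value of `f` at its end point. -/
def pathEnvelope (f : X → ℝ) (g : X → ℝ≥0∞) (A : Set X) (x : X) : ℝ≥0∞ :=
  ⨅ (σ : ℝ → X) (L : ℝ) (_ : 0 ≤ L) (_ : LipschitzWith 1 σ) (_ : σ 0 = x) (_ : σ L ∈ A),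
    ENNReal.ofReal (f (σ L)) + ∫⁻ t in Icc 0 L, g (σ t)

variable {f : X → ℝ} {g : X → ℝ≥0∞} {A : Set X}

lemma pathEnvelope_le {σ : ℝ → X} {L : ℝ} (hL : 0 ≤ L) (hσ : LipschitzWith 1 σ)
    (hA : σ L ∈ A) :
    pathEnvelope f g A (σ 0) ≤ ENNReal.ofReal (f (σ L)) + ∫⁻ t in Icc 0 L, g (σ t) :=
  iInf₂_le_of_le σ L (iInf₂_le_of_le hL hσ (iInf₂_le_of_le rfl hA le_rfl))

lemma exists_of_pathEnvelope_lt {x : X} {c : ℝ≥0∞} (h : pathEnvelope f g A x < c) :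
    ∃ (σ : ℝ → X) (L : ℝ), 0 ≤ L ∧ LipschitzWith 1 σ ∧ σ 0 = x ∧ σ L ∈ A ∧
      ENNReal.ofReal (f (σ L)) + ∫⁻ t in Icc 0 L, g (σ t) < c := by
  simp only [pathEnvelope, iInf_lt_iff] at h
  obtain ⟨σ, L, h1, h2, h3, h4, h5⟩ := h
  exact ⟨σ, L, h1, h2, h3, h4, h5⟩

lemma pathEnvelope_le_of_mem {x : X} (hx : x ∈ A) :
    pathEnvelope f g A x ≤ ENNReal.ofReal (f x) := by
  simpa using pathEnvelope_le (f := f) (g := g) (σ := fun _ => x) le_rfl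
    (LipschitzWith.const' x |>.weaken zero_le_one) hx

lemma ofReal_le_pathEnvelope (h : ∀ γ : Curve X, ENNReal.ofReal (f (γ.toFun 0)) ≤
    ENNReal.ofReal (f (γ.toFun γ.len)) + curveLint γ g) (x : X) :
    ENNReal.ofReal (f x) ≤ pathEnvelope f g A x := by
  refine le_iInf₂ fun σ L => le_iInf₂ fun hL hσ => le_iInf₂ fun h0 hA => ?_
  subst h0
  rcases hL.eq_or_lt with rfl | hL
  · exact le_self_add
  · exact h ⟨L, hL, σ, hσ.lipschitzOnWith⟩

lemma pathEnvelope_le_curveLint_add (γ : Curve X) :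
    pathEnvelope f g A (γ.toFun 0) ≤ curveLint γ g + pathEnvelope f g A (γ.toFun γ.len) := by
  obtain ⟨τ, hτ, hτγ⟩ := γ.exists_lipschitzWith
  have hs := γ.len_pos.le
  refine le_of_forall_gt fun c hc => ?_
  have hfin : curveLint γ g ≠ ⊤ := by
    rintro h
    rw [h, top_add] at hc
    exact not_top_lt hc
  obtain ⟨σ, L, hL, hσ, h0, hA, hlt⟩ := exists_of_pathEnvelope_lt
    (f := f) (g := g) (A := A) (x := γ.toFun γ.len) (c := c - curveLint γ g)
    (by rw [lt_tsub_iff_left]; exact hc)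
  set s := γ.len
  set ρ : ℝ → X := fun t => if t ≤ s then τ t else σ (t - s) with hρ
  have hτs : τ s = σ 0 := by rw [h0]; exact hτγ ⟨hs, le_rfl⟩
  have key : ∀ t t', t ≤ s → s < t' → dist (ρ t) (ρ t') ≤ dist t t' := fun t t' ht ht' => by
    simp only [hρ, if_pos ht, if_neg (not_le.2 ht')]
    have h1 := hτ.dist_le_mul t s
    have h2 := hσ.dist_le_mul 0 (t' - s)
    rw [NNReal.coe_one, one_mul, Real.dist_eq, abs_sub_comm, abs_of_nonneg (by linarith)] at h1 h2
    rw [Real.dist_eq, abs_sub_comm, abs_of_nonneg (by linarith)]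
    have h3 := dist_triangle (τ t) (τ s) (σ (t' - s))
    rw [hτs] at h3 h1
    linarith
  have hρL : LipschitzWith 1 ρ := by
    refine LipschitzWith.of_dist_le_mul fun t t' => ?_
    rw [NNReal.coe_one, one_mul]
    rcases le_or_gt t s with ht | ht <;> rcases le_or_gt t' s with ht' | ht'
    · simp only [hρ, if_pos ht, if_pos ht']
      simpa using hτ.dist_le_mul t t'
    · exact key t t' ht ht'
    · rw [dist_comm, dist_comm t]
      exact key t' t ht' ht
    · simp only [hρ, if_neg (not_le.2 ht), if_neg (not_le.2 ht')]
      simpa using hσ.dist_le_mul (t - s) (t' - s)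
  have hend : ρ (s + L) = σ L := by
    rcases hL.eq_or_lt with rfl | hL
    · simp [hρ, hτs]
    · simp [hρ, hL]
  have hstart : ρ 0 = γ.toFun 0 := by
    simp only [hρ, if_pos hs]
    exact hτγ ⟨le_rfl, hs⟩
  rw [← hstart]
  refine (pathEnvelope_le (add_nonneg hs hL) hρL (hend ▸ hA)).trans_lt ?_
  rw [hend]
  have hint : ∫⁻ t in Icc 0 (s + L), g (ρ t) ≤ curveLint γ g + ∫⁻ t in Icc 0 L, g (σ t) := by
    rw [← Icc_union_Ioc_eq_Icc hs (by linarith)]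
    refine (lintegral_union_le _ _ _).trans (add_le_add (le_of_eq ?_) (le_of_eq ?_))
    · refine setLIntegral_congr_fun measurableSet_Icc fun t ht => ?_
      simp only [hρ, if_pos ht.2]
      rw [hτγ ht]
    · have h := (measurePreserving_add_left (volume : Measure ℝ) (-s)).setLIntegral_comp_preimage_emb
        (measurableEmbedding_addLeft (-s)) (fun r => g (σ r)) (Ioc 0 L)
      rw [preimage_const_add_Ioc, zero_sub, neg_neg, sub_neg_eq_add, add_comm L] at h
      rw [restrict_Ioc_eq_restrict_Icc] at h
      rw [restrict_Ioc_eq_restrict_Icc (a := 0), ] at h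
      rw [← h, restrict_Ioc_eq_restrict_Icc.symm]
      refine setLIntegral_congr_fun measurableSet_Ioc fun t ht => ?_
      simp only [hρ, if_neg (not_le.2 ht.1)]
      rw [neg_add_eq_sub]
  calc ENNReal.ofReal (f (σ L)) + ∫⁻ t in Icc 0 (s + L), g (ρ t)
      ≤ curveLint γ g + (ENNReal.ofReal (f (σ L)) + ∫⁻ t in Icc 0 L, g (σ t)) := by
        refine (add_le_add le_rfl hint).trans (le_of_eq (by ring))
    _ < c := lt_tsub_iff_left.1 hlt

lemma edist_le_of_toReal {a b c : ℝ≥0∞} (ha : a ≤ 1) (hb : b ≤ 1) (h1 : a ≤ c + b)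
    (h2 : b ≤ c + a) : edist a.toReal b.toReal ≤ c := by
  have ha' : a ≠ ⊤ := (ha.trans_lt one_lt_top).ne
  have hb' : b ≠ ⊤ := (hb.trans_lt one_lt_top).ne
  rw [edist_dist, Real.dist_eq]
  rcases le_total a b with h | h
  · rw [abs_sub_comm, abs_of_nonneg (sub_nonneg.2 (ENNReal.toReal_mono hb' h)),
      ← ENNReal.toReal_sub_of_le h hb']
    exact ENNReal.ofReal_toReal_le.trans (tsub_le_iff_right.2 h2)
  · rw [abs_of_nonneg (sub_nonneg.2 (ENNReal.toReal_mono ha' h)),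
      ← ENNReal.toReal_sub_of_le h ha']
    exact ENNReal.ofReal_toReal_le.trans (tsub_le_iff_right.2 h1)

open BoundedContinuousFunction in
lemma lowerSemicontinuous_pathEnvelope [ProperSpace X] (hA : IsClosed A) (hf : ContinuousOn f A)
    (hg : LowerSemicontinuous g) {c : ℝ≥0∞} (hc : c ≠ 0)
    (hctop : c ≠ ⊤) (hcg : ∀ x, c ≤ g x) :
    LowerSemicontinuous (pathEnvelope f g A) := by
  intro x y hy
  by_contra hcon
  obtain ⟨y', hyy', hy'⟩ := exists_between hy
  have hy'top : y' ≠ ⊤ := (hy'.trans_le le_top).ne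
  obtain ⟨x', hx', hfreq⟩ := exists_seq_forall_of_frequently
    ((not_eventually.1 hcon).and_eventually (ball_mem_nhds x one_pos))
  choose σ L hL hσ h0 hend hcost using fun n =>
    exists_of_pathEnvelope_lt ((not_lt.1 (hfreq n).1).trans_lt hyy')
  set T := (y' / c).toReal
  have hLT : ∀ n, L n ≤ T := fun n => by
    have h1 : c * ENNReal.ofReal (L n) ≤ y' := by
      refine le_trans ?_ (le_add_self.trans (hcost n).le)
      calc c * ENNReal.ofReal (L n) = ∫⁻ t in Icc 0 (L n), c := by simp
        _ ≤ _ := lintegral_mono fun t => hcg _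
    have h2 : ENNReal.ofReal (L n) ≤ y' / c := by
      rw [ENNReal.le_div_iff_mul_le (Or.inl hc) (Or.inl hctop), mul_comm]
      exact h1
    exact (ENNReal.ofReal_le_iff_le_toReal (ENNReal.div_ne_top hy'top hc)).1 h2
  have hT : 0 ≤ T := ENNReal.toReal_nonneg
  let F : ℕ → (Icc (0 : ℝ) T →ᵇ X) := fun n =>
    BoundedContinuousFunction.mkOfCompact ⟨fun t => σ n t, by
      have := (hσ n).continuous; fun_prop⟩
  set S : Set (Icc (0 : ℝ) T →ᵇ X) :=
    {G | LipschitzWith 1 G ∧ ∀ t, G t ∈ closedBall x (T + 1)} with hS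
  have hScomp : IsCompact (closure S) := by
    refine arzela_ascoli (closedBall x (T + 1)) (isCompact_closedBall _ _) S
      (fun G t hG => hG.2 t) ?_
    refine LipschitzWith.uniformEquicontinuous _ 1 (fun G => G.2.1) |>.equicontinuous
  have hFS : ∀ n, F n ∈ S := fun n => by
    refine ⟨?_, fun t => ?_⟩
    · exact ((hσ n).comp (LipschitzWith.subtype_val _)).weaken (by simp)
    · have h1 := (hσ n).dist_le_mul t 0
      rw [h0, NNReal.coe_one, one_mul, Real.dist_eq, sub_zero, abs_of_nonneg t.2.1] at h1
      have h2 : dist (x' n) x < 1 := (hfreq n).2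
      have h3 := dist_triangle (σ n t) (x' n) x
      have h4 := t.2.2
      exact mem_closedBall.2 (show dist (σ n t) x ≤ T + 1 by linarith)
  obtain ⟨⟨G, L'⟩, hGL, φ, hφ, hlim⟩ := (hScomp.prod (isCompact_Icc (a := (0 : ℝ)) (b := T))
    ).tendsto_subseq (x := fun n => (F n, L n))
    fun n => ⟨subset_closure (hFS n), hL n, hLT n⟩
  have hlimF : Tendsto (fun n => F (φ n)) atTop (nhds G) := hlim.fst_nhds
  have hlimL : Tendsto (fun n => L (φ n)) atTop (nhds L') := hlim.snd_nhds
  have hL' : L' ∈ Icc 0 T := hGL.2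
  have hpt : ∀ (t : ℝ) (ht : t ∈ Icc 0 T), Tendsto (fun n => σ (φ n) t) atTop (nhds (G ⟨t, ht⟩)) :=
    fun t ht => ((continuous_eval_const (⟨t, ht⟩ : Icc (0 : ℝ) T)).tendsto G).comp hlimF
  have hGlip : LipschitzWith 1 G := by
    refine LipschitzWith.of_dist_le_mul fun s t => ?_
    refine le_of_tendsto ((hpt s s.2).dist (hpt t t.2)) (Eventually.of_forall fun n => ?_)
    exact (hσ (φ n)).dist_le_mul s t
  set ρ : ℝ → X := IccExtend hT G with hρ
  have hρG : ∀ (t : ℝ) (ht : t ∈ Icc 0 T), ρ t = G ⟨t, ht⟩ := fun t ht => IccExtend_of_mem _ _ ht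
  have hρlip : LipschitzWith 1 ρ := by
    exact hGlip.comp (LipschitzWith.projIcc _) |>.weaken (by simp)
  have hptρ : ∀ t ∈ Icc 0 T, Tendsto (fun n => σ (φ n) t) atTop (nhds (ρ t)) := fun t ht => by
    rw [hρG t ht]; exact hpt t ht
  have hρ0 : ρ 0 = x := by
    refine tendsto_nhds_unique (hptρ 0 ⟨le_rfl, hT⟩) ?_
    simp_rw [h0]
    exact hx'.comp hφ.tendsto_atTop
  have hendlim : Tendsto (fun n => σ (φ n) (L (φ n))) atTop (nhds (ρ L')) := by
    have h1 := hptρ L' hL'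
    refine (tendsto_iff_of_dist ?_).1 h1
    refine squeeze_zero (fun _ => dist_nonneg) (fun n => (hσ (φ n)).dist_le_mul _ _) ?_
    rw [tendsto_iff_dist_tendsto_zero] at hlimL
    simpa [dist_comm] using hlimL
  have hendA : ρ L' ∈ A := hA.mem_of_tendsto hendlim (Eventually.of_forall fun n => hend _)
  have hflim : Tendsto (fun n => ENNReal.ofReal (f (σ (φ n) (L (φ n))))) atTop
      (nhds (ENNReal.ofReal (f (ρ L')))) := by
    refine (ENNReal.continuous_ofReal.tendsto _).comp ((hf _ hendA).tendsto.comp ?_)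
    exact tendsto_nhdsWithin_iff.2 ⟨hendlim, Eventually.of_forall fun n => hend _⟩
  have hfatou : ∫⁻ t in Icc 0 L', g (ρ t) ≤ y' - ENNReal.ofReal (f (ρ L')) := by
    have hmeas : ∀ n, Measurable fun t => (Icc 0 (L (φ n))).indicator (fun t => g (σ (φ n) t)) t :=
      fun n => (hg.measurable.comp (hσ _).continuous.measurable).indicator measurableSet_Icc
    calc ∫⁻ t in Icc 0 L', g (ρ t) = ∫⁻ t in Ico 0 L', g (ρ t) := by
          rw [restrict_Ico_eq_restrict_Icc]
      _ ≤ ∫⁻ t in Ico 0 L', liminf (fun n =>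
            (Icc 0 (L (φ n))).indicator (fun t => g (σ (φ n) t)) t) atTop := by
          refine setLIntegral_mono' measurableSet_Ico fun t ht => ?_
          refine le_of_forall_lt_imp_le_of_dense fun z hz => ?_
          refine le_liminf_of_le (by isBoundedDefault) ?_
          filter_upwards [(hptρ t ⟨ht.1, ht.2.le.trans hL'.2⟩).eventually (hg (ρ t) z hz),
            hlimL.eventually (lt_mem_nhds ht.2)] with n h1 h2
          rw [indicator_of_mem (show t ∈ Icc 0 (L (φ n)) from ⟨ht.1, h2.le⟩)]
          exact h1.le
      _ ≤ ∫⁻ t, liminf (fun n =>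
            (Icc 0 (L (φ n))).indicator (fun t => g (σ (φ n) t)) t) atTop :=
          setLIntegral_le_lintegral _ _
      _ ≤ liminf (fun n => ∫⁻ t, (Icc 0 (L (φ n))).indicator (fun t => g (σ (φ n) t)) t) atTop :=
          lintegral_liminf_le hmeas
      _ ≤ liminf (fun n => y' - ENNReal.ofReal (f (σ (φ n) (L (φ n))))) atTop := by
          refine liminf_le_liminf (Eventually.of_forall fun n => ?_)
          rw [lintegral_indicator measurableSet_Icc]
          exact ENNReal.le_sub_of_add_le_left ofReal_ne_top (hcost (φ n)).le
      _ = y' - ENNReal.ofReal (f (ρ L')) :=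
          (ENNReal.Tendsto.sub tendsto_const_nhds hflim (Or.inl hy'top)).liminf_eq
  have hle : ENNReal.ofReal (f (ρ L')) ≤ y' :=
    le_of_tendsto hflim (Eventually.of_forall fun n => le_self_add.trans (hcost (φ n)).le)
  refine hy'.not_ge ?_
  rw [← hρ0]
  refine (pathEnvelope_le hL'.1 hρlip hendA).trans ?_
  exact (add_le_add le_rfl hfatou).trans (add_tsub_cancel_of_le hle).le

end Envelope

section LowerSemicontinuousApproximation

variable {μ : Measure X} {p : ℝ}

lemma exists_pos_lintegral_add_mul_rpow_le {α : Type*} [MeasurableSpace α] {ν : Measure α}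
    (hp : 1 ≤ p) {a b : α → ℝ≥0∞} (ha : Measurable a) (hb : Measurable b)
    (haf : ∫⁻ x, a x ^ p ∂ν < ⊤) (hbf : ∫⁻ x, b x ^ p ∂ν < ⊤) {e : ℝ≥0∞} (he : e ≠ 0) :
    ∃ δ : ℝ≥0∞, δ ≠ 0 ∧ δ ≠ ⊤ ∧ ∫⁻ x, (a x + δ * b x) ^ p ∂ν ≤ ∫⁻ x, a x ^ p ∂ν + e := by
  have hp0 : 0 < p := by linarith
  set I := ∫⁻ x, a x ^ p ∂ν
  set J := ∫⁻ x, b x ^ p ∂ν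
  have hJ : J ^ (1 / p) ≠ ⊤ := ENNReal.rpow_ne_top_of_nonneg (by positivity) hbf.ne
  have hlim : Tendsto (fun δ : ℝ≥0∞ => (I ^ (1 / p) + δ * J ^ (1 / p)) ^ p) (nhds 0)
      (nhds I) := by
    have h1 : Tendsto (fun δ : ℝ≥0∞ => I ^ (1 / p) + δ * J ^ (1 / p)) (nhds 0)
        (nhds (I ^ (1 / p) + 0 * J ^ (1 / p))) :=
      tendsto_const_nhds.add (ENNReal.Tendsto.mul_const tendsto_id (Or.inr hJ))
    have h2 := (ENNReal.continuous_rpow_const (y := p)).tendsto _ |>.comp h1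
    have h3 : (I ^ (1 / p) + 0 * J ^ (1 / p)) ^ p = I := by
      rw [zero_mul, add_zero, ← ENNReal.rpow_mul, one_div_mul_cancel hp0.ne', ENNReal.rpow_one]
    rwa [h3] at h2
  have hev := hlim.eventually (gt_mem_nhds (ENNReal.lt_add_right haf.ne he))
  obtain ⟨δ₀, hδ₀, hsub⟩ := (ENNReal.nhds_zero_basis_Iic.eventually_iff).1 hev
  refine ⟨min δ₀ 1, (lt_min hδ₀ zero_lt_one).ne',
    ((min_le_right _ _).trans_lt one_lt_top).ne, ?_⟩
  set δ := min δ₀ 1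
  have hδ : δ ≠ ⊤ := ((min_le_right _ _).trans_lt one_lt_top).ne
  have hmink := ENNReal.lintegral_Lp_add_le (p := p) (μ := ν) (f := a) (g := fun x => δ * b x)
    ha.aemeasurable (hb.const_mul δ).aemeasurable hp
  have hδb : (∫⁻ x, (δ * b x) ^ p ∂ν) ^ (1 / p) = δ * J ^ (1 / p) := by
    simp_rw [ENNReal.mul_rpow_of_nonneg _ _ hp0.le]
    rw [lintegral_const_mul' _ _ (ENNReal.rpow_ne_top_of_nonneg hp0.le hδ),
      ENNReal.mul_rpow_of_nonneg _ _ (by positivity), ← ENNReal.rpow_mul,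
      mul_one_div_cancel hp0.ne', ENNReal.rpow_one]
  rw [hδb] at hmink
  calc ∫⁻ x, (a x + δ * b x) ^ p ∂ν
      = ((∫⁻ x, (a x + δ * b x) ^ p ∂ν) ^ (1 / p)) ^ p := by
        rw [← ENNReal.rpow_mul, one_div_mul_cancel hp0.ne', ENNReal.rpow_one]
    _ ≤ (I ^ (1 / p) + δ * J ^ (1 / p)) ^ p := by
        gcongr
        exact hmink
    _ ≤ I + e := (hsub (mem_Iic.2 (min_le_left δ₀ 1))).le

lemma isWeakUpperGradientOn_of_forall [SFinite μ] (hp : 0 < p) {f : X → ℝ} {g : X → ℝ≥0∞}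
    {E : Set X}
    (h : ∀ γ : Curve X, edist (f (γ.toFun 0)) (f (γ.toFun γ.len)) ≤ curveLint γ g) :
    IsWeakUpperGradientOn μ p f g E :=
  (isWeakUpperGradientOn_iff hp).2 (Eventually.of_forall fun γ _ => h γ)

/-- If `h` is constant off an open set, an upper gradient may be replaced by zero there. -/
lemma edist_le_curveLint_indicator {h : X → ℝ} {g : X → ℝ≥0∞} {c : ℝ} {Ω : Set X}
    (hΩ : IsOpen Ω) (hc : ∀ x ∉ Ω, h x = c)
    (hg : ∀ γ : Curve X, edist (h (γ.toFun 0)) (h (γ.toFun γ.len)) ≤ curveLint γ g)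
    (γ : Curve X) :
    edist (h (γ.toFun 0)) (h (γ.toFun γ.len)) ≤ curveLint γ (Ω.indicator g) := by
  have piece : ∀ a b, 0 ≤ a → a ≤ b → b ≤ γ.len → (∀ t ∈ Ioo a b, γ.toFun t ∈ Ω) →
      edist (h (γ.toFun a)) (h (γ.toFun b)) ≤
        ∫⁻ t in Ioo a b, Ω.indicator g (γ.toFun t) := by
    intro a b ha hab hb hin
    rcases hab.eq_or_lt with rfl | hab
    · simp
    have h1 := hg (γ.sub a b ha hab hb)
    rw [curveLint_sub, ← restrict_Ioo_eq_restrict_Icc] at h1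
    simp only [Curve.sub, add_zero, add_sub_cancel] at h1
    refine h1.trans (le_of_eq (setLIntegral_congr_fun measurableSet_Ioo fun t ht => ?_))
    simp only [indicator_of_mem (hin t ht)]
  set T : Set ℝ := Icc 0 γ.len ∩ γ.toFun ⁻¹' Ωᶜ with hT
  have hTc : IsCompact T := isCompact_Icc.of_isClosed_subset
    (γ.continuousOn.preimage_isClosed_of_isClosed isClosed_Icc hΩ.isClosed_compl)
    inter_subset_left
  rcases T.eq_empty_or_nonempty with hTe | hTn
  · refine (piece 0 γ.len le_rfl γ.len_pos.le le_rfl fun t ht => ?_).trans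
      (lintegral_mono_set Ioo_subset_Icc_self)
    by_contra hcon
    exact (hTe ▸ (⟨Ioo_subset_Icc_self ht, hcon⟩ : t ∈ T) : t ∈ (∅ : Set ℝ))
  · obtain ⟨a, ha, hamin⟩ := hTc.exists_isLeast hTn
    obtain ⟨b, hb, hbmax⟩ := hTc.exists_isGreatest hTn
    have hab : a ≤ b := hamin hb
    have h1 := piece 0 a le_rfl ha.1.1 ha.1.2 fun t ht => by
      by_contra hcon
      exact (hamin ⟨⟨ht.1.le, ht.2.le.trans ha.1.2⟩, hcon⟩).not_gt ht.2
    have h2 := piece b γ.len hb.1.1 hb.1.2 le_rfl fun t ht => by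
      by_contra hcon
      exact (hbmax ⟨⟨hb.1.1.trans ht.1.le, ht.2.le⟩, hcon⟩).not_gt ht.1
    rw [hc _ ha.2] at h1
    rw [hc _ hb.2] at h2
    refine (edist_triangle _ c _).trans ((add_le_add h1 h2).trans ?_)
    rw [← lintegral_union measurableSet_Ioo]
    · refine lintegral_mono_set (union_subset ?_ ?_)
      · exact fun t ht => ⟨ht.1.le, ht.2.le.trans ha.1.2⟩
      · exact fun t ht => ⟨hb.1.1.trans ht.1.le, ht.2.le⟩
    · refine disjoint_left.2 fun t ht ht' => ?_
      have := ht.2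
      have := ht'.1
      linarith

/-- Newtonian functions can be approximated from above by lower semicontinuous ones, which agree
with the given function off a small set. -/
lemma exists_lowerSemicontinuous_ge [ProperSpace X] [SFinite μ] (hp : 1 ≤ p) {f : X → ℝ}
    (hf : Measurable f) (hf0 : ∀ x, 0 ≤ f x) (hf1 : ∀ x, f x ≤ 1) {Ω : Set X} (hΩ : IsOpen Ω)
    (hΩfin : μ Ω < ⊤) {c : ℝ} (hc : ∀ x ∉ Ω, f x = c) {g : X → ℝ≥0∞} (hg : Measurable g)
    (hw : IsWeakUpperGradientOn μ p f g univ) (hgfin : ∫⁻ x, g x ^ p ∂μ < ⊤)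
    {q : X → ℝ≥0∞} (hq : ∫⁻ x, q x ∂μ < ⊤) {e : ℝ≥0∞} (he : e ≠ 0) (hetop : e ≠ ⊤) :
    ∃ (h : X → ℝ) (k : X → ℝ≥0∞) (A : Set X), LowerSemicontinuous h ∧ (∀ x, f x ≤ h x) ∧
      (∀ x, h x ≤ 1) ∧ (∀ x ∉ Ω, h x = c) ∧ Measurable k ∧
      IsWeakUpperGradientOn μ p h k univ ∧ ∫⁻ x, k x ^ p ∂μ ≤ ∫⁻ x, g x ^ p ∂μ + e ∧
      MeasurableSet A ∧ (∀ x ∈ A, h x = f x) ∧ ∫⁻ x in Aᶜ, q x ∂μ < e ∧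
      ∫⁻ x in Aᶜ, k x ^ p ∂μ < e := by
  have hp0 : 0 < p := by linarith
  obtain ⟨ρ, hρ, hρfin, hUG⟩ := eventually_curve_iff.1 ((isWeakUpperGradientOn_iff hp0).1 hw)
  have he2 : e / 2 ≠ 0 := (ENNReal.half_pos he).ne'
  obtain ⟨δ, hδ, hδtop, hδle⟩ := exists_pos_lintegral_add_mul_rpow_le (ν := μ.restrict Ω) hp hg
    (b := fun x => ρ x + 1) (by fun_prop) ((lintegral_mono' Measure.restrict_le_self le_rfl).trans_lt hgfin)
    (lintegral_add_rpow_lt_top hp hρ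
      ((lintegral_mono' Measure.restrict_le_self le_rfl).trans_lt hρfin) (by simpa using hΩfin)) he2
  have : IsFiniteMeasure (μ.restrict Ω) := ⟨by simpa using hΩfin⟩
  obtain ⟨w, hw1, hw2, hw3⟩ := exists_le_lowerSemicontinuous_lintegral_ge (μ.restrict Ω)
    (fun x => (g x + δ * (ρ x + 1)) ^ p) (by fun_prop) he2
  set G : X → ℝ≥0∞ := fun x => w x ^ (1 / p) with hG
  have hGlsc : LowerSemicontinuous G :=
    (ENNReal.continuous_rpow_const (y := 1 / p)).comp_lowerSemicontinuous hw2
      (ENNReal.monotone_rpow_of_nonneg (by positivity))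
  have hGge : ∀ x, g x + δ * (ρ x + 1) ≤ G x := fun x => by
    have := ENNReal.rpow_le_rpow (hw1 x) (z := 1 / p) (by positivity)
    rwa [← ENNReal.rpow_mul, mul_one_div_cancel hp0.ne', ENNReal.rpow_one] at this
  have hGp : ∀ x, G x ^ p = w x := fun x => by
    rw [hG, ← ENNReal.rpow_mul, one_div_mul_cancel hp0.ne', ENNReal.rpow_one]
  have hGUG : ∀ γ : Curve X, edist (f (γ.toFun 0)) (f (γ.toFun γ.len)) ≤ curveLint γ G := by
    intro γ
    by_cases hfin : curveLint γ ρ < ⊤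
    · exact (hUG γ hfin fun _ _ => mem_univ _).trans
        (curveLint_mono γ fun x => le_self_add.trans (hGge x))
    · have h1 : curveLint γ (fun x => δ * ρ x) ≤ curveLint γ G := curveLint_mono γ fun x =>
        le_trans (le_trans (by gcongr; exact le_self_add) le_add_self) (hGge x)
      rw [curveLint_const_mul γ hρ, not_lt_top_iff.1 hfin, ENNReal.mul_top hδ] at h1
      exact le_top.trans h1
  set k : X → ℝ≥0∞ := Ω.indicator G with hk
  have hkm : Measurable k := hGlsc.measurable.indicator hΩ.measurableSet
  have hkint : ∫⁻ x, k x ^ p ∂μ = ∫⁻ x in Ω, w x ∂μ := by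
    rw [hk, lintegral_indicator_rpow hp0 hΩ.measurableSet]
    simp_rw [hGp]
  have hkle : ∫⁻ x, k x ^ p ∂μ ≤ ∫⁻ x, g x ^ p ∂μ + e := by
    rw [hkint]
    refine hw3.trans ((add_le_add hδle le_rfl).trans ?_)
    rw [add_assoc, ENNReal.add_halves]
    exact add_le_add (lintegral_mono' Measure.restrict_le_self le_rfl) le_rfl
  have hkfin : ∫⁻ x, k x ^ p ∂μ < ⊤ :=
    hkle.trans_lt (ENNReal.add_lt_top.2 ⟨hgfin, lt_top_iff_ne_top.2 hetop⟩)
  obtain ⟨δ₁, hδ₁, hsmall₁⟩ := exists_pos_setLIntegral_lt_of_measure_lt hq.ne he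
  obtain ⟨δ₂, hδ₂, hsmall₂⟩ := exists_pos_setLIntegral_lt_of_measure_lt hkfin.ne he
  obtain ⟨A₀, hA₀Ω, hA₀, hA₀f, hA₀μ⟩ := exists_isClosed_continuousOn (μ := μ) hf hΩ hΩfin
    (lt_min hδ₁ hδ₂).ne'
  set A := A₀ ∪ Ωᶜ with hA
  have hAcl : IsClosed A := hA₀.union hΩ.isClosed_compl
  have hAf : ContinuousOn f A := hA₀f.union_of_isClosed
    (continuousOn_const.congr fun x hx => hc x hx) hA₀ hΩ.isClosed_compl
  have hAc : Aᶜ = Ω \ A₀ := by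
    rw [hA, compl_union, compl_compl, inter_comm]; rfl
  set F := fun x => min 1 (pathEnvelope f G A x) with hF
  have hF1 : ∀ x, F x ≤ 1 := fun x => min_le_left _ _
  have hFtop : ∀ x, F x ≠ ⊤ := fun x => ((hF1 x).trans_lt one_lt_top).ne
  have hFf : ∀ x, ENNReal.ofReal (f x) ≤ F x := fun x => by
    refine le_min (by simpa using hf1 x) (ofReal_le_pathEnvelope (fun γ => ?_) x)
    have h1 := hGUG γ
    have h2 : f (γ.toFun 0) ≤ f (γ.toFun γ.len) + dist (f (γ.toFun 0)) (f (γ.toFun γ.len)) := by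
      rw [Real.dist_eq]
      linarith [le_abs_self (f (γ.toFun 0) - f (γ.toFun γ.len))]
    refine (ENNReal.ofReal_le_ofReal h2).trans ?_
    rw [ENNReal.ofReal_add (hf0 _) dist_nonneg, ← edist_dist]
    gcongr
  have hFA : ∀ x ∈ A, F x = ENNReal.ofReal (f x) := fun x hx =>
    le_antisymm ((min_le_right _ _).trans (pathEnvelope_le_of_mem hx)) (hFf x)
  have hhA : ∀ x ∈ A, (F x).toReal = f x := fun x hx => by
    rw [hFA x hx, ENNReal.toReal_ofReal (hf0 x)]
  have hhc : ∀ x ∉ Ω, (F x).toReal = c := fun x hx => by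
    rw [hhA x (Or.inr hx), hc x hx]
  have hstep : ∀ γ : Curve X, F (γ.toFun 0) ≤ curveLint γ G + F (γ.toFun γ.len) := fun γ => by
    simp only [hF]
    rw [← min_add_add_left]
    refine le_min ((min_le_left _ _).trans le_add_self) ?_
    exact (min_le_right _ _).trans (pathEnvelope_le_curveLint_add γ)
  have hFUG : ∀ γ : Curve X, edist (F (γ.toFun 0)).toReal (F (γ.toFun γ.len)).toReal ≤
      curveLint γ G := fun γ => by
    refine edist_le_of_toReal (hF1 _) (hF1 _) (hstep γ) ?_
    have := hstep γ.reverse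
    rw [curveLint_reverse] at this
    simpa [Curve.reverse] using this
  have hFlsc : LowerSemicontinuous F :=
    lowerSemicontinuous_const.inf (lowerSemicontinuous_pathEnvelope hAcl hAf hGlsc hδ hδtop
      fun x => le_trans (le_trans (by rw [mul_add, mul_one]; exact le_add_self) le_add_self)
        (hGge x))
  refine ⟨fun x => (F x).toReal, k, A, ?_, fun x => ?_, fun x => ?_, hhc, hkm,
    isWeakUpperGradientOn_of_forall hp0 (edist_le_curveLint_indicator hΩ hhc hFUG), hkle,
    hAcl.measurableSet, hhA, ?_, ?_⟩
  · intro x y hy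
    rcases lt_or_ge y 0 with hy0 | hy0
    · exact Eventually.of_forall fun z => hy0.trans_le ENNReal.toReal_nonneg
    filter_upwards [hFlsc x (ENNReal.ofReal y) ((ENNReal.ofReal_lt_iff_lt_toReal hy0 (hFtop x)).2 hy)]
      with z hz
    exact (ENNReal.ofReal_lt_iff_lt_toReal hy0 (hFtop z)).1 hz
  · have := ENNReal.toReal_mono (hFtop x) (hFf x)
    rwa [ENNReal.toReal_ofReal (hf0 x)] at this
  · simpa using ENNReal.toReal_mono one_ne_top (hF1 x)
  · exact hsmall₁ _ (hAc ▸ hA₀μ.trans_le (min_le_left _ _))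
  · exact hsmall₂ _ (hAc ▸ hA₀μ.trans_le (min_le_right _ _))

end LowerSemicontinuousApproximation

section UniformConvexity

variable {p : ℝ}

lemma exists_abs_sub_rpow_le (hp : 1 < p) {ε : ℝ} (hε : 0 < ε) :
    ∃ C : ℝ, 0 ≤ C ∧ ∀ a b : ℝ, 0 ≤ a → 0 ≤ b →
      |a - b| ^ p ≤ ε * (a ^ p + b ^ p) + C * ((a ^ p + b ^ p) / 2 - ((a + b) / 2) ^ p) := by
  have hp0 : 0 < p := by linarith
  have hconv : ∀ a b : ℝ, 0 ≤ a → 0 ≤ b → ((a + b) / 2) ^ p ≤ (a ^ p + b ^ p) / 2 := by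
    intro a b ha hb
    have := (convexOn_rpow hp.le).2 (mem_Ici.2 ha) (mem_Ici.2 hb) (show (0 : ℝ) ≤ 1 / 2 by norm_num)
      (show (0 : ℝ) ≤ 1 / 2 by norm_num) (by norm_num)
    simp only [smul_eq_mul] at this
    rw [show 1 / 2 * a + 1 / 2 * b = (a + b) / 2 by ring] at this
    linarith
  set φ : ℝ → ℝ := fun b => (1 + b ^ p) / 2 - ((1 + b) / 2) ^ p with hφ
  have hφc : Continuous φ := by
    have h1 : Continuous fun b : ℝ => b ^ p := Real.continuous_rpow_const hp0.le
    have h2 : Continuous fun b : ℝ => ((1 + b) / 2) ^ p :=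
      h1.comp (by fun_prop : Continuous fun b : ℝ => (1 + b) / 2)
    exact ((continuous_const.add h1).div_const 2).sub h2
  set S : Set ℝ := {b | b ∈ Icc (0 : ℝ) 1 ∧ ε ≤ (1 - b) ^ p} with hS
  have hScompact : IsCompact S := isCompact_Icc.inter_right
    (isClosed_le continuous_const ((Real.continuous_rpow_const hp0.le).comp
      (by fun_prop : Continuous fun b : ℝ => 1 - b)))
  have hpos : ∀ b ∈ S, 0 < φ b := by
    rintro b ⟨hb, hb'⟩
    have hb1 : (1 : ℝ) ≠ b := by
      rintro rfl
      rw [sub_self, Real.zero_rpow hp0.ne'] at hb'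
      linarith
    have := (strictConvexOn_rpow hp).2 (mem_Ici.2 zero_le_one) (mem_Ici.2 hb.1) hb1
      (show (0 : ℝ) < 1 / 2 by norm_num) (show (0 : ℝ) < 1 / 2 by norm_num) (by norm_num)
    simp only [smul_eq_mul, Real.one_rpow] at this
    have h3 : 1 / 2 * 1 + 1 / 2 * b = (1 + b) / 2 := by ring
    rw [h3] at this
    simp only [hφ]
    linarith
  have hone : ∃ C : ℝ, 0 ≤ C ∧ ∀ b ∈ Icc (0 : ℝ) 1, (1 - b) ^ p ≤ ε + C * φ b := by
    have hφ0 : ∀ b ∈ Icc (0 : ℝ) 1, 0 ≤ φ b := fun b hb => by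
      have := hconv 1 b zero_le_one hb.1
      rw [Real.one_rpow] at this
      exact sub_nonneg.2 this
    rcases S.eq_empty_or_nonempty with he | hn
    · refine ⟨0, le_rfl, fun b hb => ?_⟩
      by_contra hcon
      have : b ∈ S := ⟨hb, by nlinarith⟩
      simp [he] at this
    · obtain ⟨b₀, hb₀, hmin⟩ := hScompact.exists_isMinOn hn hφc.continuousOn
      have hm := hpos b₀ hb₀
      refine ⟨1 / φ b₀, by positivity, fun b hb => ?_⟩
      by_cases hbS : b ∈ S
      · have h1 : φ b₀ ≤ φ b := hmin hbS
        have h2 : (1 - b) ^ p ≤ 1 := Real.rpow_le_one (by linarith [hb.2]) (by linarith [hb.1]) hp0.le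
        have h3 : 1 ≤ 1 / φ b₀ * φ b := by
          rw [one_div, inv_mul_eq_div, le_div_iff₀ hm]; linarith
        linarith
      · have h1 : (1 - b) ^ p < ε := by
          by_contra hcon
          exact hbS ⟨hb, by linarith⟩
        have := mul_nonneg (one_div_pos.2 hm).le (hφ0 b hb)
        linarith
  obtain ⟨C, hC0, hC⟩ := hone
  have hle : ∀ a b : ℝ, 0 ≤ b → b ≤ a →
      |a - b| ^ p ≤ ε * (a ^ p + b ^ p) + C * ((a ^ p + b ^ p) / 2 - ((a + b) / 2) ^ p) := by
    intro a b hb hba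
    rcases (hb.trans hba).eq_or_lt with h0 | h0
    · have hb0 : b = 0 := le_antisymm (h0 ▸ hba) hb
      subst hb0
      rw [← h0]
      simp [Real.zero_rpow hp0.ne']
    have h1 := hC (b / a) ⟨by positivity, (div_le_one h0).2 hba⟩
    have h2 : |a - b| ^ p = a ^ p * (1 - b / a) ^ p := by
      rw [← Real.mul_rpow h0.le (by rw [sub_nonneg]; exact (div_le_one h0).2 hba),
        abs_of_nonneg (by linarith)]
      congr 1; field_simp
    have h3 : a ^ p * (b / a) ^ p = b ^ p := by
      rw [← Real.mul_rpow h0.le (by positivity)]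
      congr 1; field_simp
    have h4 : a ^ p * ((1 + b / a) / 2) ^ p = ((a + b) / 2) ^ p := by
      rw [← Real.mul_rpow h0.le (by positivity)]
      congr 1; field_simp
    have ha : 0 < a ^ p := by positivity
    have hbp : 0 ≤ b ^ p := by positivity
    calc |a - b| ^ p ≤ a ^ p * (ε + C * φ (b / a)) := by
          rw [h2]; gcongr
      _ = ε * a ^ p + C * ((a ^ p + a ^ p * (b / a) ^ p) / 2 - a ^ p * ((1 + b / a) / 2) ^ p) := by
          simp only [hφ]; ring
      _ ≤ _ := by
          rw [h3, h4]
          nlinarith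
  refine ⟨C, hC0, fun a b ha hb => ?_⟩
  rcases le_total b a with h | h
  · exact hle a b hb h
  · have := hle b a ha h
    rwa [abs_sub_comm, add_comm (b ^ p), add_comm b] at this

lemma exists_tsub_add_tsub_rpow_le (hp : 1 < p) {ε : ℝ≥0∞} (hε : ε ≠ 0) (hεtop : ε ≠ ⊤) :
    ∃ C : ℝ≥0∞, C ≠ ⊤ ∧ ∀ a b : ℝ≥0∞, a ≠ ⊤ → b ≠ ⊤ →
      ((a - b) + (b - a)) ^ p + C * ((a + b) / 2) ^ p ≤
        ε * (a ^ p + b ^ p) + C * ((a ^ p + b ^ p) / 2) := by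
  have hp0 : 0 < p := by linarith
  obtain ⟨C, hC0, hC⟩ := exists_abs_sub_rpow_le hp (ENNReal.toReal_pos hε hεtop)
  refine ⟨ENNReal.ofReal C, ENNReal.ofReal_ne_top, fun a b ha hb => ?_⟩
  lift a to NNReal using ha
  lift b to NNReal using hb
  have h := hC a b a.2 b.2
  have h1 : ((a : ℝ≥0∞) - b) + (b - a) = ENNReal.ofReal |(a : ℝ) - b| := by
    rcases le_total a b with hab | hab
    · rw [tsub_eq_zero_of_le (by exact_mod_cast hab), zero_add, abs_sub_comm,
        abs_of_nonneg (sub_nonneg.2 (by exact_mod_cast hab)), ENNReal.ofReal_sub _ (NNReal.coe_nonneg a),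
        ENNReal.ofReal_coe_nnreal, ENNReal.ofReal_coe_nnreal]
    · rw [tsub_eq_zero_of_le (by exact_mod_cast hab : (b : ℝ≥0∞) ≤ a), add_zero,
        abs_of_nonneg (sub_nonneg.2 (by exact_mod_cast hab)), ENNReal.ofReal_sub _ (NNReal.coe_nonneg b),
        ENNReal.ofReal_coe_nnreal, ENNReal.ofReal_coe_nnreal]
  have ha' : (a : ℝ≥0∞) = ENNReal.ofReal a := (ENNReal.ofReal_coe_nnreal).symm
  have hb' : (b : ℝ≥0∞) = ENNReal.ofReal b := (ENNReal.ofReal_coe_nnreal).symm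
  have h2 : (2 : ℝ≥0∞) = ENNReal.ofReal 2 := by simp
  have ha0 : (0 : ℝ) ≤ a := a.2
  have hb0 : (0 : ℝ) ≤ b := b.2
  rw [h1, ha', hb', ← ENNReal.ofReal_toReal hεtop, h2, ← ENNReal.ofReal_add ha0 hb0,
    ← ENNReal.ofReal_div_of_pos two_pos, ENNReal.ofReal_rpow_of_nonneg (by positivity) hp0.le,
    ENNReal.ofReal_rpow_of_nonneg (by positivity) hp0.le,
    ENNReal.ofReal_rpow_of_nonneg ha0 hp0.le, ENNReal.ofReal_rpow_of_nonneg hb0 hp0.le,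
    ← ENNReal.ofReal_add (by positivity) (by positivity), ← ENNReal.ofReal_div_of_pos two_pos,
    ← ENNReal.ofReal_mul hC0, ← ENNReal.ofReal_mul hC0, ← ENNReal.ofReal_mul (by positivity),
    ← ENNReal.ofReal_add (by positivity) (by positivity),
    ← ENNReal.ofReal_add (by positivity) (by positivity)]
  exact ENNReal.ofReal_le_ofReal (by linarith)

end UniformConvexity

section VariationalCapacity

variable {μ : Measure X} {p : ℝ}

lemma lintegral_tsum_rpow_le {α : Type*} [MeasurableSpace α] {ν : Measure α} (hp : 1 ≤ p)
    {D : ℕ → α → ℝ≥0∞} (hD : ∀ n, Measurable (D n)) :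
    (∫⁻ x, (∑' n, D n x) ^ p ∂ν) ^ (1 / p) ≤ ∑' n, (∫⁻ x, D n x ^ p ∂ν) ^ (1 / p) := by
  have hp0 : 0 < p := by linarith
  have hfin : ∀ N : ℕ, (∫⁻ x, (∑ n ∈ Finset.range N, D n x) ^ p ∂ν) ^ (1 / p) ≤
      ∑ n ∈ Finset.range N, (∫⁻ x, D n x ^ p ∂ν) ^ (1 / p) := by
    intro N
    induction N with
    | zero => simp [hp0]
    | succ N ih =>
      simp_rw [Finset.sum_range_succ]
      refine (ENNReal.lintegral_Lp_add_le
        (f := fun x => ∑ n ∈ Finset.range N, D n x) (g := D N)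
        (Finset.measurable_fun_sum _ fun n _ => hD n).aemeasurable
        (hD N).aemeasurable hp).trans ?_
      gcongr
  have hsup : ∀ x, (∑' n, D n x) ^ p = ⨆ N : ℕ, (∑ n ∈ Finset.range N, D n x) ^ p := by
    intro x
    rw [ENNReal.tsum_eq_iSup_nat]
    exact (ENNReal.monotone_rpow_of_nonneg hp0.le).map_iSup_of_continuousAt
      ENNReal.continuous_rpow_const.continuousAt (by simp [hp0])
  have hmono : Monotone fun (N : ℕ) x => (∑ n ∈ Finset.range N, D n x) ^ p := by
    intro M N h x
    dsimp only
    gcongr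
  simp_rw [hsup]
  rw [lintegral_iSup (fun N => (Finset.measurable_fun_sum _ fun n _ => hD n).pow_const p) hmono,
    (ENNReal.monotone_rpow_of_nonneg (by positivity : 0 ≤ 1 / p)).map_iSup_of_continuousAt
      ENNReal.continuous_rpow_const.continuousAt (by simp [hp0])]
  exact iSup_le fun N => (hfin N).trans (ENNReal.sum_le_tsum _)

lemma IsWeakUpperGradientOn.of_edist_le {f f' : X → ℝ} {g : X → ℝ≥0∞} {E : Set X}
    (h : IsWeakUpperGradientOn μ p f g E) (hd : ∀ x y, edist (f' x) (f' y) ≤ edist (f x) (f y)) :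
    IsWeakUpperGradientOn μ p f' g E :=
  aeCurve_mono (fun _ h hγ => (hd _ _).trans (h hγ)) h

/-- A function with values in `[0, 1]`, equal to one on `E` and to zero off `A`, together with a
weak upper gradient. -/
structure CapPair (μ : Measure X) (p : ℝ) (E A : Set X) (f : X → ℝ) (G : X → ℝ≥0∞) : Prop where
  meas : Measurable f
  nonneg : ∀ x, 0 ≤ f x
  le_one : ∀ x, f x ≤ 1
  eq_one : ∀ x ∈ E, f x = 1
  eq_zero : ∀ x ∉ A, f x = 0
  grad_meas : Measurable G
  grad : IsWeakUpperGradientOn μ p f G univ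

lemma CapPair.mono {E E' A A' : Set X} {f : X → ℝ} {G : X → ℝ≥0∞} (h : CapPair μ p E A f G)
    (hE : E' ⊆ E) (hA : A ⊆ A') : CapPair μ p E' A' f G :=
  { h with
    eq_one := fun x hx => h.eq_one x (hE hx)
    eq_zero := fun x hx => h.eq_zero x fun hx' => hx (hA hx') }

lemma exists_capPair_of_varCap_lt {E A : Set X} {c : ℝ≥0∞} (h : varCap μ p E A < c) :
    ∃ f G, CapPair μ p E A f G ∧ ∫⁻ x, G x ^ p ∂μ < c := by
  simp only [varCap, iInf_lt_iff] at h
  obtain ⟨f, hf, hE, G, hG, hw, hlt⟩ := h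
  refine ⟨fun x => max 0 (min (f x) 1), G, ⟨?_, fun x => le_max_left _ _,
    fun x => max_le zero_le_one (min_le_right _ _), fun x hx => ?_, fun x hx => ?_, hG,
    hw.of_edist_le fun x y => ?_⟩, hlt⟩
  · exact measurable_const.max (hf.1.1.min measurable_const)
  · rw [min_eq_right (hE x hx), max_eq_right zero_le_one]
  · rw [hf.2 x hx, min_eq_left zero_le_one, max_self]
  · rw [edist_dist, edist_dist]
    refine ENNReal.ofReal_le_ofReal ?_
    rw [Real.dist_eq, Real.dist_eq]
    refine (abs_max_sub_max_le_max _ _ _ _).trans ?_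
    rw [sub_self, abs_zero]
    refine max_le (abs_nonneg _) ((abs_min_sub_min_le_max _ _ _ _).trans ?_)
    simp

lemma CapPair.memNp0 [SFinite μ] {E A : Set X} {f : X → ℝ} {G : X → ℝ≥0∞} (h : CapPair μ p E A f G)
    (hp : 0 < p) (hA : μ A < ⊤) (hfin : ∫⁻ x, G x ^ p ∂μ < ⊤) : MemNp0 μ p f A := by
  refine ⟨memNp_of_gradient h.meas ?_ h.grad_meas h.grad (by simpa using hfin), h.eq_zero⟩
  have hle : ∀ x, ENNReal.ofReal |f x| ^ p ≤ ({x | f x ≠ 0} : Set X).indicator 1 x := by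
    intro x
    by_cases hx : f x = 0
    · simp [hx, hp]
    · rw [indicator_of_mem (show x ∈ {x | f x ≠ 0} from hx), abs_of_nonneg (h.nonneg x)]
      exact ENNReal.rpow_le_one (by simpa using h.le_one x) hp.le
  rw [setLIntegral_univ]
  refine (lintegral_mono hle).trans_lt ?_
  have hm : MeasurableSet {x | f x ≠ 0} := (h.meas (measurableSet_singleton 0)).compl
  rw [lintegral_indicator_one hm]
  refine (measure_mono fun x hx => ?_).trans_lt hA
  by_contra hcon
  exact hx (h.eq_zero x hcon)

lemma CapPair.varCap_le [SFinite μ] {E A : Set X} {f : X → ℝ} {G : X → ℝ≥0∞} (h : CapPair μ p E A f G)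
    (hp : 0 < p) (hA : μ A < ⊤) : varCap μ p E A ≤ ∫⁻ x, G x ^ p ∂μ := by
  rcases eq_top_or_lt_top (∫⁻ x, G x ^ p ∂μ) with hfin | hfin
  · rw [hfin]; exact le_top
  · exact iInf₂_le_of_le f (h.memNp0 hp hA hfin) (iInf₂_le_of_le (fun x hx => (h.eq_one x hx).ge) G
      (iInf₂_le h.grad_meas h.grad))

lemma varCap_mono {E E' A A' : Set X} (hE : E ⊆ E') (hA : A' ⊆ A) :
    varCap μ p E A ≤ varCap μ p E' A' := by
  refine le_iInf₂ fun f hf => le_iInf₂ fun h1 G => le_iInf₂ fun hG hw => ?_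
  exact iInf₂_le_of_le f (hf.mono hA) (iInf₂_le_of_le (fun x hx => h1 x (hE hx)) G
    (iInf₂_le hG hw))

/-- Along a sequence of functions whose gradients form a Cauchy series, the pointwise upper limit
inherits weak upper gradients. -/
lemma isWeakUpperGradientOn_limsup [SFinite μ] (hp : 0 < p) {f : ℕ → X → ℝ} {G : ℕ → X → ℝ≥0∞}
    (hf0 : ∀ n x, 0 ≤ f n x) (hf1 : ∀ n x, f n x ≤ 1)
    (hw : ∀ n, IsWeakUpperGradientOn μ p (f n) (G n) univ) (k : ℕ) :
    IsWeakUpperGradientOn μ p (fun x => limsup (fun n => f n x) atTop)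
      (fun x => G k x + ∑' j, (G (k + j + 1) x - G (k + j) x)) univ := by
  have hG : ∀ x, ∀ n, k ≤ n → G n x ≤ G k x + ∑' j, (G (k + j + 1) x - G (k + j) x) := by
    intro x n hn
    obtain ⟨m, rfl⟩ := Nat.exists_eq_add_of_le hn
    have hm : G (k + m) x ≤ G k x + ∑ j ∈ Finset.range m, (G (k + j + 1) x - G (k + j) x) := by
      clear hn
      induction m with
      | zero => simp
      | succ m ih =>
        rw [Finset.sum_range_succ, ← add_assoc (G k x)]
        exact le_add_tsub.trans (add_le_add ih le_rfl)
    exact hm.trans (add_le_add le_rfl (ENNReal.sum_le_tsum _))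
  rw [isWeakUpperGradientOn_iff hp]
  filter_upwards [eventually_curve_nat fun n => (isWeakUpperGradientOn_iff hp).1 (hw n)]
    with γ hγ hin
  set S := curveLint γ fun x => G k x + ∑' j, (G (k + j + 1) x - G (k + j) x)
  rcases eq_top_or_lt_top S with hS | hS
  · rw [hS]; exact le_top
  have hlim : ∀ a b : X, (∀ n, k ≤ n → edist (f n a) (f n b) ≤ S) →
      limsup (fun n => f n a) atTop ≤ limsup (fun n => f n b) atTop + S.toReal := by
    intro a b hab
    have h1 : ∀ᶠ n in atTop, f n a ≤ f n b + S.toReal := by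
      filter_upwards [eventually_ge_atTop k] with n hn
      have h2 := hab n hn
      rw [edist_dist] at h2
      have h3 := (ENNReal.ofReal_le_iff_le_toReal hS.ne).1 h2
      rw [Real.dist_eq] at h3
      linarith [le_abs_self (f n a - f n b)]
    have hbdd : ∀ x, IsBoundedUnder (· ≤ ·) atTop fun n => f n x := fun x =>
      isBoundedUnder_of ⟨1, fun n => hf1 n x⟩
    have hcob : ∀ x, IsCoboundedUnder (· ≤ ·) atTop fun n => f n x := fun x =>
      (isBoundedUnder_of ⟨0, fun n => hf0 n x⟩ :
        IsBoundedUnder (· ≥ ·) atTop fun n => f n x).isCoboundedUnder_le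
    rw [← limsup_add_const atTop (fun n => f n b) S.toReal (hbdd b) (hcob b)]
    refine limsup_le_limsup h1 (hcob a) ?_
    exact isBoundedUnder_of ⟨1 + S.toReal, fun n => by linarith [hf1 n b]⟩
  have hab : ∀ n, k ≤ n → edist (f n (γ.toFun 0)) (f n (γ.toFun γ.len)) ≤ S := fun n hn =>
    (hγ n hin).trans (curveLint_mono γ fun x => hG x n hn)
  rw [edist_dist, Real.dist_eq]
  refine (ENNReal.ofReal_le_iff_le_toReal hS.ne).2 (abs_sub_le_iff.2 ⟨?_, ?_⟩)
  · linarith [hlim _ _ hab]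
  · linarith [hlim (γ.toFun γ.len) (γ.toFun 0) fun n hn => edist_comm (f n _) (f n _) ▸ hab n hn]

lemma isWeakUpperGradientOn_zero [SFinite μ] (hp : 1 ≤ p) {f : X → ℝ}
    (h : ∀ e : ℝ≥0∞, e ≠ 0 → ∃ G : X → ℝ≥0∞, Measurable G ∧ IsWeakUpperGradientOn μ p f G univ ∧
      ∫⁻ x, G x ^ p ∂μ ≤ e) :
    IsWeakUpperGradientOn μ p f (fun _ => 0) univ := by
  have hp0 : 0 < p := by linarith
  have h2 : ∀ n : ℕ, ((1 / 2 : ℝ≥0∞) ^ n) ^ p ≠ 0 := fun n => by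
    simp [ENNReal.rpow_eq_zero_iff, hp0.not_gt]
  choose G hG hw hle using fun n : ℕ => h _ (h2 n)
  have hsum : ∫⁻ x, (∑' n, G n x) ^ p ∂μ < ⊤ := by
    have h3 := lintegral_tsum_rpow_le (ν := μ) hp hG
    have h4 : ∑' n, (∫⁻ x, G n x ^ p ∂μ) ^ (1 / p) ≤ 2 := by
      refine (ENNReal.tsum_le_tsum fun n => ?_).trans ENNReal.tsum_geometric_two.le
      refine (ENNReal.rpow_le_rpow (hle n) (by positivity)).trans ?_
      rw [← ENNReal.rpow_mul, mul_one_div_cancel hp0.ne', ENNReal.rpow_one, one_div]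
    have h5 := (h3.trans h4).trans_lt (by norm_num : (2 : ℝ≥0∞) < ⊤)
    exact (ENNReal.rpow_lt_top_iff_of_pos (by positivity)).1 h5
  rw [isWeakUpperGradientOn_iff hp0]
  filter_upwards [eventually_curve_nat fun n => (isWeakUpperGradientOn_iff hp0).1 (hw n),
    eventually_curveLint_lt_top (Measurable.tsum hG) hsum] with γ hγ hfin hin
  have h6 : curveLint γ (fun x => ∑' n, G n x) = ∑' n, curveLint γ (G n) :=
    lintegral_tsum fun n => γ.aemeasurable_comp (hG n)
  rw [h6] at hfin
  have h7 := ENNReal.tendsto_atTop_zero_of_tsum_ne_top hfin.ne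
  exact (ge_of_tendsto' h7 fun n => hγ n hin).trans zero_le

end VariationalCapacity

section CapacityLimits

variable {μ : Measure X} {p : ℝ}

lemma CapPair.exists_max_min [SFinite μ] (hp : 1 ≤ p) {E E' A A' : Set X} {f f' : X → ℝ}
    {G G' : X → ℝ≥0∞} (h : CapPair μ p E A f G) (h' : CapPair μ p E' A' f' G')
    (hfin : ∫⁻ x, G x ^ p ∂μ < ⊤) (hfin' : ∫⁻ x, G' x ^ p ∂μ < ⊤) :
    ∃ G₁ G₂, CapPair μ p (E ∪ E') (A ∪ A') (fun x => max (f x) (f' x)) G₁ ∧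
      CapPair μ p (E ∩ E') (A ∩ A') (fun x => min (f x) (f' x)) G₂ ∧
      ∫⁻ x, G₁ x ^ p ∂μ + ∫⁻ x, G₂ x ^ p ∂μ = ∫⁻ x, G x ^ p ∂μ + ∫⁻ x, G' x ^ p ∂μ := by
  classical
  have hp0 : 0 < p := by linarith
  set W : Set X := {x | f' x < f x} with hW
  have hWm : MeasurableSet W := measurableSet_lt h'.meas h.meas
  have hcurve : ∀ᶠ γ in curveFilter μ p hp0,
      (γ.ACAlong f ∧ γ.DBound f G univ) ∧ γ.ACAlong f' ∧ γ.DBound f' G' univ := by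
    filter_upwards [h.grad.eventually_acAlong hp0 h.grad_meas (by simpa using hfin),
      h'.grad.eventually_acAlong hp0 h'.grad_meas (by simpa using hfin')] with γ h1 h2
    have h1 := h1 fun _ _ => mem_univ _
    have h2 := h2 fun _ _ => mem_univ _
    exact ⟨⟨h1.1, h1.2.1⟩, h2.1, h2.2.1⟩
  have hcomp : ∀ {γ : Curve X} {a : X → ℝ} {b₁ b₂ : X → ℝ≥0∞},
      γ.DBound a b₁ W → γ.DBound a b₂ Wᶜ → γ.DBound a (W.piecewise b₁ b₂) univ := by
    intro γ a b₁ b₂ h1 h2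
    rw [← union_compl_self W]
    refine (h1.mono Subset.rfl fun x hx => ?_).union (h2.mono Subset.rfl fun x hx => ?_)
    · rw [piecewise_eq_of_mem _ _ _ hx]
    · rw [piecewise_eq_of_notMem _ _ _ hx]
  refine ⟨W.piecewise G G', W.piecewise G' G,
    ⟨h.meas.max h'.meas, fun x => (h.nonneg x).trans (le_max_left _ _),
      fun x => max_le (h.le_one x) (h'.le_one x), fun x hx => ?_, fun x hx => ?_,
      h.grad_meas.piecewise hWm h'.grad_meas, ?_⟩,
    ⟨h.meas.min h'.meas, fun x => le_min (h.nonneg x) (h'.nonneg x),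
      fun x => (min_le_left _ _).trans (h.le_one x), fun x hx => ?_, fun x hx => ?_,
      h'.grad_meas.piecewise hWm h.grad_meas, ?_⟩, ?_⟩
  · rcases hx with hx | hx
    · rw [h.eq_one x hx, max_eq_left (h'.le_one x)]
    · rw [h'.eq_one x hx, max_eq_right (h.le_one x)]
  · rw [h.eq_zero x fun hx' => hx (Or.inl hx'), h'.eq_zero x fun hx' => hx (Or.inr hx'), max_self]
  · refine isWeakUpperGradientOn_of_eventually hp0 ?_
    filter_upwards [hcurve] with γ hγ _ _
    obtain ⟨⟨h1, h2⟩, h3, h4⟩ := hγ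
    refine ⟨h1.max h3, hcomp ?_ ?_⟩
    · exact (h2.mono (subset_univ _) fun _ _ => le_rfl).congr h1 (h1.max h3) fun x hx =>
        (max_eq_left (le_of_lt hx)).symm
    · exact (h4.mono (subset_univ _) fun _ _ => le_rfl).congr h3 (h1.max h3) fun x hx =>
        (max_eq_right (le_of_not_gt (mem_compl_iff _ _ |>.1 hx))).symm
  · rw [h.eq_one x hx.1, h'.eq_one x hx.2, min_self]
  · by_cases hxA : x ∈ A
    · rw [h'.eq_zero x fun hx' => hx ⟨hxA, hx'⟩, min_eq_right (h.nonneg x)]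
    · rw [h.eq_zero x hxA, min_eq_left (h'.nonneg x)]
  · refine isWeakUpperGradientOn_of_eventually hp0 ?_
    filter_upwards [hcurve] with γ hγ _ _
    obtain ⟨⟨h1, h2⟩, h3, h4⟩ := hγ
    refine ⟨h1.min h3, hcomp ?_ ?_⟩
    · exact (h4.mono (subset_univ _) fun _ _ => le_rfl).congr h3 (h1.min h3) fun x hx =>
        (min_eq_right (le_of_lt hx)).symm
    · exact (h2.mono (subset_univ _) fun _ _ => le_rfl).congr h1 (h1.min h3) fun x hx =>
        (min_eq_left (le_of_not_gt (mem_compl_iff _ _ |>.1 hx))).symm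
  · have e1 := setLIntegral_piecewise_rpow (μ := μ) (p := p) hWm univ G G'
    have e2 := setLIntegral_piecewise_rpow (μ := μ) (p := p) hWm univ G' G
    have e3 := setLIntegral_inter_add_compl (μ := μ) hWm univ fun x => G x ^ p
    have e4 := setLIntegral_inter_add_compl (μ := μ) hWm univ fun x => G' x ^ p
    simp only [setLIntegral_univ, inter_univ] at e1 e2 e3 e4
    rw [e1, e2, ← e3, ← e4]
    abel

/-- Strong subadditivity of the variational capacity, in both variables. -/
lemma varCap_union_add_varCap_inter_le [SFinite μ] (hp : 1 ≤ p) {E E' A A' : Set X}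
    (hA : μ A < ⊤) (hA' : μ A' < ⊤) :
    varCap μ p (E ∪ E') (A ∪ A') + varCap μ p (E ∩ E') (A ∩ A') ≤
      varCap μ p E A + varCap μ p E' A' := by
  have hp0 : 0 < p := by linarith
  refine ENNReal.le_of_forall_pos_le_add fun ε hε hlt => ?_
  have hε' : (ε / 2 : ℝ≥0∞) ≠ 0 := by simpa using hε.ne'
  obtain ⟨h1, h2⟩ := ENNReal.add_lt_top.1 hlt
  obtain ⟨f, G, hG, hGlt⟩ := exists_capPair_of_varCap_lt (ENNReal.lt_add_right h1.ne hε')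
  obtain ⟨f', G', hG', hGlt'⟩ := exists_capPair_of_varCap_lt (ENNReal.lt_add_right h2.ne hε')
  obtain ⟨G₁, G₂, hG₁, hG₂, heq⟩ := hG.exists_max_min hp hG' (hGlt.trans_le le_top)
    (hGlt'.trans_le le_top)
  calc _ ≤ ∫⁻ x, G₁ x ^ p ∂μ + ∫⁻ x, G₂ x ^ p ∂μ := by
        refine add_le_add (hG₁.varCap_le hp0 ?_) (hG₂.varCap_le hp0 ?_)
        · exact (measure_union_le _ _).trans_lt (ENNReal.add_lt_top.2 ⟨hA, hA'⟩)
        · exact (measure_mono inter_subset_left).trans_lt hA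
    _ ≤ (varCap μ p E A + ε / 2) + (varCap μ p E' A' + ε / 2) := by
        rw [heq]
        exact add_le_add hGlt.le hGlt'.le
    _ = _ := by
        rw [add_add_add_comm, ENNReal.add_halves]

lemma CapPair.midpoint [SFinite μ] (hp : 0 < p) {E A : Set X} {f f' : X → ℝ} {G G' : X → ℝ≥0∞}
    (h : CapPair μ p E A f G) (h' : CapPair μ p E A f' G') :
    CapPair μ p E A (fun x => (f x + f' x) / 2) fun x => (G x + G' x) / 2 where
  meas := (h.meas.add h'.meas).div_const 2
  nonneg x := by linarith [h.nonneg x, h'.nonneg x]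
  le_one x := by linarith [h.le_one x, h'.le_one x]
  eq_one x hx := by linarith [h.eq_one x hx, h'.eq_one x hx]
  eq_zero x hx := by linarith [h.eq_zero x hx, h'.eq_zero x hx]
  grad_meas := (h.grad_meas.add h'.grad_meas).div_const 2
  grad := by
    rw [isWeakUpperGradientOn_iff hp]
    filter_upwards [(isWeakUpperGradientOn_iff hp).1 h.grad,
      (isWeakUpperGradientOn_iff hp).1 h'.grad] with γ h1 h2 hin
    simp_rw [ENNReal.div_eq_inv_mul]
    rw [curveLint_const_mul γ (g := fun x => G x + G' x) (h.grad_meas.add h'.grad_meas),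
      curveLint_add γ h.grad_meas]
    refine le_trans ?_ (mul_le_mul_right (add_le_add (h1 hin) (h2 hin)) _)
    rw [edist_dist, edist_dist, edist_dist, ← ENNReal.ofReal_add dist_nonneg dist_nonneg,
      ← ENNReal.div_eq_inv_mul, show (2 : ℝ≥0∞) = ENNReal.ofReal 2 by simp,
      ← ENNReal.ofReal_div_of_pos two_pos]
    refine ENNReal.ofReal_le_ofReal ?_
    simp only [Real.dist_eq]
    rw [← sub_div, abs_div, abs_two, add_sub_add_comm]
    gcongr
    exact abs_add_le _ _

lemma capPair_limsup [SFinite μ] (hp : 0 < p) {E : ℕ → Set X} {F A : Set X} {f : ℕ → X → ℝ}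
    {G : ℕ → X → ℝ≥0∞} (h : ∀ n, CapPair μ p (E n) A (f n) (G n))
    (hF : ∀ x ∈ F, ∀ᶠ n in atTop, x ∈ E n) (k : ℕ) :
    CapPair μ p F A (fun x => limsup (fun n => f n x) atTop)
      (fun x => G k x + ∑' j, (G (k + j + 1) x - G (k + j) x)) where
  meas := Measurable.limsup fun n => (h n).meas
  nonneg x := le_limsup_of_frequently_le (Frequently.of_forall fun n => (h n).nonneg x)
    (isBoundedUnder_of ⟨1, fun n => (h n).le_one x⟩)
  le_one x := limsup_le_of_le
    (isBoundedUnder_of ⟨0, fun n => (h n).nonneg x⟩ :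
      IsBoundedUnder (· ≥ ·) atTop fun n => f n x).isCoboundedUnder_le
    (Eventually.of_forall fun n => (h n).le_one x)
  eq_one x hx := by
    have : (fun n => f n x) =ᶠ[atTop] fun _ => 1 := by
      filter_upwards [hF x hx] with n hn using (h n).eq_one x hn
    rw [limsup_congr this, limsup_const]
  eq_zero x hx := by
    simp only [(h _).eq_zero x hx, limsup_const]
  grad_meas := (h k).grad_meas.add
    (Measurable.tsum fun j => (h (k + j + 1)).grad_meas.sub (h (k + j)).grad_meas)
  grad := isWeakUpperGradientOn_limsup hp (fun n => (h n).nonneg) (fun n => (h n).le_one)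
    (fun n => (h n).grad) k

lemma lintegral_add_tsum_rpow_le (hp : 1 ≤ p) {G : ℕ → X → ℝ≥0∞} (hG : ∀ n, Measurable (G n))
    (hD : ∀ n, (∫⁻ x, (G (n + 1) x - G n x) ^ p ∂μ) ^ (1 / p) ≤ (1 / 2) ^ n) (k : ℕ) :
    ∫⁻ x, (G k x + ∑' j, (G (k + j + 1) x - G (k + j) x)) ^ p ∂μ ≤
      ((∫⁻ x, G k x ^ p ∂μ) ^ (1 / p) + 2 * (1 / 2) ^ k) ^ p := by
  have hp0 : 0 < p := by linarith
  have hDm : ∀ j, Measurable fun x => G (k + j + 1) x - G (k + j) x := fun j =>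
    (hG _).sub (hG _)
  have h1 := ENNReal.lintegral_Lp_add_le (μ := μ) (f := G k)
    (g := fun x => ∑' j, (G (k + j + 1) x - G (k + j) x)) (hG k).aemeasurable
    (Measurable.tsum hDm).aemeasurable hp
  have h2 : ∑' j, (∫⁻ x, (G (k + j + 1) x - G (k + j) x) ^ p ∂μ) ^ (1 / p) ≤
      2 * (1 / 2) ^ k := by
    refine (ENNReal.tsum_le_tsum fun j => hD (k + j)).trans ?_
    simp_rw [pow_add, ENNReal.tsum_mul_left, one_div]
    rw [ENNReal.tsum_geometric_two, mul_comm]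
  have h3 := h1.trans (add_le_add le_rfl ((lintegral_tsum_rpow_le hp hDm).trans h2))
  have h4 := ENNReal.rpow_le_rpow h3 hp0.le
  rwa [← ENNReal.rpow_mul, one_div_mul_cancel hp0.ne', ENNReal.rpow_one] at h4

lemma exists_capPair_zero_of_varCap_eq_zero [SFinite μ] (hp : 1 ≤ p) {E A : Set X}
    (h : varCap μ p E A = 0) : ∃ f, CapPair μ p E A f fun _ => 0 := by
  have hp0 : 0 < p := by linarith
  have h2 : ∀ n : ℕ, 0 < ((1 / 2 : ℝ≥0∞) ^ n) ^ p := fun n => by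
    rw [pos_iff_ne_zero]
    simp [ENNReal.rpow_eq_zero_iff, hp0.not_gt]
  choose f G hG hlt using fun n : ℕ => exists_capPair_of_varCap_lt (h.trans_lt (h2 n))
  have hle : ∀ n, (∫⁻ x, G n x ^ p ∂μ) ^ (1 / p) ≤ (1 / 2) ^ n := fun n => by
    refine (ENNReal.rpow_le_rpow (hlt n).le (by positivity)).trans ?_
    rw [← ENNReal.rpow_mul, mul_one_div_cancel hp0.ne', ENNReal.rpow_one]
  have hD : ∀ n, (∫⁻ x, (G (n + 1) x - G n x) ^ p ∂μ) ^ (1 / p) ≤ (1 / 2) ^ n := fun n => by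
    refine le_trans ?_ ((hle (n + 1)).trans (pow_le_pow_right_of_le_one' (by simp) n.le_succ))
    gcongr
    exact tsub_le_self
  have hlim := fun k => capPair_limsup hp0 hG (F := E) (fun x hx => Eventually.of_forall fun _ => hx) k
  refine ⟨_, { hlim 0 with
    grad_meas := measurable_const
    grad := isWeakUpperGradientOn_zero hp fun e he => ?_ }⟩
  have hten : Tendsto (fun k : ℕ => ((1 / 2 : ℝ≥0∞) ^ k + 2 * (1 / 2) ^ k) ^ p) atTop (nhds 0) := by
    have h0 : Tendsto (fun k : ℕ => (1 / 2 : ℝ≥0∞) ^ k) atTop (nhds 0) :=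
      ENNReal.tendsto_pow_atTop_nhds_zero_of_lt_one (by simp)
    have h1 := h0.add (ENNReal.Tendsto.const_mul (a := 2) h0 (Or.inr (by simp)))
    have h3 := (ENNReal.continuous_rpow_const (y := p)).tendsto _ |>.comp h1
    simpa [Function.comp_def, hp0] using h3
  obtain ⟨k, hk⟩ := (hten.eventually (gt_mem_nhds (pos_iff_ne_zero.2 he))).exists
  refine ⟨_, (hlim k).grad_meas, (hlim k).grad, ?_⟩
  refine (lintegral_add_tsum_rpow_le hp (fun n => (hG n).grad_meas) hD k).trans
    (le_trans ?_ hk.le)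
  gcongr
  exact hle k

end CapacityLimits

section IncreasingSets

variable {μ : Measure X} {p : ℝ}

/-- Near-minimizers of the capacity have close gradients, by uniform convexity. -/
lemma exists_gradient_close [SFinite μ] (hp : 1 < p) {c τ : ℝ≥0∞} (hc : c ≠ ⊤) (hτ : τ ≠ 0)
    (hτtop : τ ≠ ⊤) :
    ∃ δ : ℝ≥0∞, δ ≠ 0 ∧ δ ≤ 1 ∧ ∀ (E A : Set X) (f f' : X → ℝ) (G G' : X → ℝ≥0∞),
      μ A < ⊤ → CapPair μ p E A f G → CapPair μ p E A f' G' → c ≤ varCap μ p E A + δ →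
      ∫⁻ x, G x ^ p ∂μ ≤ c + δ → ∫⁻ x, G' x ^ p ∂μ ≤ c + δ →
      ∫⁻ x, ((G x - G' x) + (G' x - G x)) ^ p ∂μ ≤ τ := by
  have hp0 : 0 < p := by linarith
  have hτ2 : τ / 2 ≠ 0 := (ENNReal.half_pos hτ).ne'
  have hτ2t : τ / 2 ≠ ⊤ := (ENNReal.div_lt_top hτtop (by simp)).ne
  have hc1 : 2 * (c + 1) ≠ ⊤ := by finiteness
  have hc10 : 2 * (c + 1) ≠ 0 := by simp
  obtain ⟨C, hC, hUC⟩ := exists_tsub_add_tsub_rpow_le hp (ε := τ / 2 / (2 * (c + 1)))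
    (ENNReal.div_pos hτ2 hc1).ne' (ENNReal.div_lt_top hτ2t hc10).ne
  have hC1 : 2 * C + 1 ≠ ⊤ := by finiteness
  refine ⟨min 1 (τ / 2 / (2 * C + 1)), (lt_min one_pos (ENNReal.div_pos hτ2 hC1)).ne',
    min_le_left _ _, ?_⟩
  set δ := min 1 (τ / 2 / (2 * C + 1))
  set ε := τ / 2 / (2 * (c + 1))
  intro E A f f' G G' hA h h' hcap hG hG'
  have hcδ : c + δ < ⊤ := (add_le_add le_rfl (min_le_left _ _ : δ ≤ 1)).trans_lt (by finiteness)
  have hGm := h.grad_meas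
  have hGm' := h'.grad_meas
  have hmid := (h.midpoint hp0 h').varCap_le hp0 hA
  have hae : ∀ᵐ x ∂μ, ((G x - G' x) + (G' x - G x)) ^ p + C * ((G x + G' x) / 2) ^ p ≤
      ε * (G x ^ p + G' x ^ p) + C * ((G x ^ p + G' x ^ p) / 2) := by
    filter_upwards [ae_lt_top (hGm.pow_const p) (hG.trans_lt hcδ).ne,
      ae_lt_top (hGm'.pow_const p) (hG'.trans_lt hcδ).ne] with x h1 h2
    exact hUC _ _ ((ENNReal.rpow_lt_top_iff_of_pos hp0).1 h1).ne
      ((ENNReal.rpow_lt_top_iff_of_pos hp0).1 h2).ne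
  have hint := lintegral_mono_ae hae
  have m1 : Measurable fun x => ((G x - G' x) + (G' x - G x)) ^ p :=
    ((hGm.sub hGm').add (hGm'.sub hGm)).pow_const p
  have m2 : Measurable fun x => ((G x + G' x) / 2) ^ p := ((hGm.add hGm').div_const 2).pow_const p
  have m3 : Measurable fun x => G x ^ p + G' x ^ p := (hGm.pow_const p).add (hGm'.pow_const p)
  have m4 : Measurable fun x => (G x ^ p + G' x ^ p) / 2 := m3.div_const 2
  have m5 : Measurable fun x => ε * (G x ^ p + G' x ^ p) := m3.const_mul _
  rw [lintegral_add_left m1, lintegral_const_mul _ m2, lintegral_add_left m5,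
    lintegral_const_mul _ m3, lintegral_const_mul _ m4] at hint
  simp_rw [ENNReal.div_eq_inv_mul (a := G _ ^ p + G' _ ^ p)] at hint
  rw [lintegral_const_mul _ m3, lintegral_add_left (hGm.pow_const p)] at hint
  simp_rw [← ENNReal.div_eq_inv_mul] at hint
  set I := ∫⁻ x, ((G x - G' x) + (G' x - G x)) ^ p ∂μ
  set M := ∫⁻ x, ((G x + G' x) / 2) ^ p ∂μ
  have hCc : C * c ≠ ⊤ := ENNReal.mul_ne_top hC hc
  have hmain : I + C * c ≤ (ε * (2 * (c + 1)) + 2 * C * δ) + C * c := by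
    calc I + C * c ≤ I + C * (M + δ) := by
          gcongr
          exact hcap.trans (add_le_add hmid le_rfl)
      _ = (I + C * M) + C * δ := by ring
      _ ≤ (ε * ((c + δ) + (c + δ)) + C * (((c + δ) + (c + δ)) / 2)) + C * δ := by
          refine add_le_add (hint.trans ?_) le_rfl
          gcongr
      _ = ε * (2 * (c + δ)) + C * (c + δ) + C * δ := by
          rw [← two_mul, mul_comm 2 (c + δ), ENNReal.mul_div_cancel_right (by simp) (by simp)]
      _ ≤ ε * (2 * (c + 1)) + C * (c + δ) + C * δ := by
          gcongr
          exact min_le_left _ _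
      _ = _ := by ring
  refine (ENNReal.le_of_add_le_add_right hCc hmain).trans ?_
  calc ε * (2 * (c + 1)) + 2 * C * δ ≤ τ / 2 + τ / 2 := by
        refine add_le_add (ENNReal.div_mul_cancel hc10 hc1).le ?_
        calc 2 * C * δ ≤ (2 * C + 1) * (τ / 2 / (2 * C + 1)) := by
              gcongr
              · exact le_self_add
              · exact min_le_right _ _
          _ ≤ τ / 2 := ENNReal.mul_div_le
    _ = τ := ENNReal.add_halves τ

lemma varCap_iUnion_le [SFinite μ] (hp : 1 < p) {A : ℕ → Set X} (hA : Monotone A) {Ω : Set X}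
    (hΩ : μ Ω < ⊤) {L : ℝ≥0∞} (hL : ∀ n, varCap μ p (A n) Ω ≤ L) :
    varCap μ p (⋃ n, A n) Ω ≤ L := by
  have hp0 : 0 < p := by linarith
  rcases eq_top_or_lt_top L with rfl | hLt
  · exact le_top
  set c := ⨆ n, varCap μ p (A n) Ω with hc
  have hcL : c ≤ L := iSup_le hL
  have hct : c ≠ ⊤ := (hcL.trans_lt hLt).ne
  refine le_trans ?_ hcL
  have hτ : ∀ n : ℕ, ((1 / 2 : ℝ≥0∞) ^ n) ^ p ≠ 0 := fun n => by
    simp [ENNReal.rpow_eq_zero_iff, hp0.not_gt]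
  have hτt : ∀ n : ℕ, ((1 / 2 : ℝ≥0∞) ^ n) ^ p ≠ ⊤ := fun n =>
    ENNReal.rpow_ne_top_of_nonneg hp0.le (by finiteness)
  choose δ hδ0 hδ1 hδ using fun n : ℕ => exists_gradient_close (μ := μ) hp hct (hτ n) (hτt n)
  set η : ℕ → ℝ≥0∞ := fun n => (1 / 2) ^ n * ∏ i ∈ Finset.range (n + 1), δ i with hη
  have hη0 : ∀ n, η n ≠ 0 := fun n =>
    mul_ne_zero (pow_ne_zero _ (by simp)) (Finset.prod_ne_zero_iff.2 fun i _ => hδ0 i)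
  have hhalf : ∀ n : ℕ, (1 / 2 : ℝ≥0∞) ^ n ≤ 1 := fun n => pow_le_one₀ zero_le (by simp)
  have hηδ : ∀ n, η n ≤ δ n := fun n => by
    calc η n ≤ 1 * (1 * δ n) := by
          simp only [hη, Finset.prod_range_succ]
          gcongr
          · exact hhalf n
          · exact Finset.prod_le_one (fun _ _ => zero_le) fun i _ => hδ1 i
      _ = δ n := by simp
  have hηsucc : ∀ n, η (n + 1) ≤ η n := fun n => by
    simp only [hη]
    rw [Finset.prod_range_succ (n := n + 1), pow_succ]
    calc _ ≤ (1 / 2 : ℝ≥0∞) ^ n * 1 * ((∏ i ∈ Finset.range (n + 1), δ i) * 1) := by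
          gcongr
          · simp
          · exact hδ1 _
      _ = _ := by simp
  have hηhalf : ∀ n, η n ≤ (1 / 2) ^ n := fun n =>
    mul_le_of_le_one_right zero_le (Finset.prod_le_one (fun _ _ => zero_le) fun i _ => hδ1 i)
  have hev : ∀ n, ∀ᶠ N in atTop, c ≤ varCap μ p (A N) Ω + η n := by
    intro n
    rcases eq_or_ne c 0 with h0 | h0
    · exact Eventually.of_forall fun N => h0 ▸ zero_le
    obtain ⟨N, hN⟩ := lt_iSup_iff.1 (ENNReal.sub_lt_self hct h0 (hη0 n))
    filter_upwards [eventually_ge_atTop N] with M hM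
    exact tsub_le_iff_right.1 (hN.le.trans (varCap_mono (hA hM) Subset.rfl))
  obtain ⟨φ, hφ, hφn⟩ := extraction_forall_of_eventually hev
  have hlt : ∀ n, varCap μ p (A (φ n)) Ω < c + η n := fun n =>
    (le_iSup (fun n => varCap μ p (A n) Ω) (φ n)).trans_lt (ENNReal.lt_add_right hct (hη0 n))
  choose f G hG hGlt using fun n => exists_capPair_of_varCap_lt (hlt n)
  have hD : ∀ n, (∫⁻ x, (G (n + 1) x - G n x) ^ p ∂μ) ^ (1 / p) ≤ (1 / 2) ^ n := fun n => by
    have h1 := hδ n (A (φ n)) Ω (f n) (f (n + 1)) (G n) (G (n + 1)) hΩ (hG n)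
      ((hG (n + 1)).mono (hA (hφ.monotone n.le_succ)) Subset.rfl)
      ((hφn n).trans (by gcongr; exact hηδ n))
      ((hGlt n).le.trans (by gcongr; exact hηδ n))
      ((hGlt (n + 1)).le.trans (by gcongr; exact (hηsucc n).trans (hηδ n)))
    have h2 : ∫⁻ x, (G (n + 1) x - G n x) ^ p ∂μ ≤ ((1 / 2) ^ n) ^ p :=
      (lintegral_mono fun x => ENNReal.rpow_le_rpow le_add_self hp0.le).trans h1
    refine (ENNReal.rpow_le_rpow h2 (by positivity)).trans ?_
    rw [← ENNReal.rpow_mul, mul_one_div_cancel hp0.ne', ENNReal.rpow_one]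
  have hF : ∀ x ∈ ⋃ n, A n, ∀ᶠ n in atTop, x ∈ A (φ n) := by
    intro x hx
    obtain ⟨m, hm⟩ := mem_iUnion.1 hx
    filter_upwards [eventually_ge_atTop m] with n hn
    exact hA (hn.trans (hφ.id_le n)) hm
  have hbound : ∀ k : ℕ, varCap μ p (⋃ n, A n) Ω ≤
      ((c + (1 / 2) ^ k) ^ (1 / p) + 2 * (1 / 2) ^ k) ^ p := fun k => by
    refine ((capPair_limsup hp0 hG hF k).varCap_le hp0 hΩ).trans
      ((lintegral_add_tsum_rpow_le hp.le (fun n => (hG n).grad_meas) hD k).trans ?_)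
    gcongr
    exact (hGlt k).le.trans (by gcongr; exact hηhalf k)
  refine ge_of_tendsto' (x := (atTop : Filter ℕ)) ?_ hbound
  have h0 : Tendsto (fun k : ℕ => (1 / 2 : ℝ≥0∞) ^ k) atTop (nhds 0) :=
    ENNReal.tendsto_pow_atTop_nhds_zero_of_lt_one (by simp)
  have h1 := (ENNReal.continuous_rpow_const (y := 1 / p)).tendsto _ |>.comp
    ((tendsto_const_nhds (x := c) (f := (atTop : Filter ℕ))).add h0)
  have h2 := h1.add (ENNReal.Tendsto.const_mul (a := 2) h0 (Or.inr (by simp)))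
  have h3 := (ENNReal.continuous_rpow_const (y := p)).tendsto _ |>.comp h2
  have h4 : ((c + 0) ^ (1 / p) + 2 * 0) ^ p = c := by
    rw [add_zero, mul_zero, add_zero, ← ENNReal.rpow_mul, one_div_mul_cancel hp0.ne',
      ENNReal.rpow_one]
  rw [h4] at h3
  exact h3

/-- If adding each `B n` to `A` increases the capacity only a little, so does adding all of them. -/
lemma varCap_union_iUnion_le [SFinite μ] (hp : 1 < p) {A Ω : Set X} (hΩ : μ Ω < ⊤)
    (hfin : varCap μ p A Ω ≠ ⊤) {B : ℕ → Set X} {e : ℕ → ℝ≥0∞}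
    (hB : ∀ n, varCap μ p (A ∪ B n) Ω ≤ varCap μ p A Ω + e n) :
    varCap μ p (A ∪ ⋃ n, B n) Ω ≤ varCap μ p A Ω + ∑' n, e n := by
  have hpartial : ∀ N : ℕ, varCap μ p (A ∪ ⋃ n ∈ Finset.range N, B n) Ω ≤
      varCap μ p A Ω + ∑ n ∈ Finset.range N, e n := by
    intro N
    induction N with
    | zero => simp
    | succ N ih =>
      have h1 := varCap_union_add_varCap_inter_le (μ := μ) hp.le (E := A ∪ ⋃ n ∈ Finset.range N, B n)
        (E' := A ∪ B N) hΩ hΩ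
      rw [union_self, inter_self] at h1
      have h2 : varCap μ p A Ω ≤
          varCap μ p ((A ∪ ⋃ n ∈ Finset.range N, B n) ∩ (A ∪ B N)) Ω :=
        varCap_mono (subset_inter subset_union_left subset_union_left) Subset.rfl
      have h3 : (A ∪ ⋃ n ∈ Finset.range N, B n) ∪ (A ∪ B N) =
          A ∪ ⋃ n ∈ Finset.range (N + 1), B n := by
        rw [Finset.range_add_one, Finset.set_biUnion_insert]
        ext x
        simp only [mem_union]
        tauto
      rw [h3] at h1
      refine ENNReal.le_of_add_le_add_right hfin ?_
      calc _ ≤ _ := (add_le_add le_rfl h2).trans (h1.trans (add_le_add ih (hB N)))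
        _ = _ := by
          rw [Finset.sum_range_succ]; ring
  have hmono : Monotone fun N : ℕ => A ∪ ⋃ n ∈ Finset.range N, B n := by
    intro M N h
    exact union_subset_union_right _ (biUnion_subset_biUnion_left fun n hn =>
      Finset.mem_coe.2 (Finset.range_mono h hn))
  have heq : A ∪ ⋃ n, B n = ⋃ N : ℕ, A ∪ ⋃ n ∈ Finset.range N, B n := by
    ext x
    simp only [mem_union, mem_iUnion, Finset.mem_range, exists_prop]
    constructor
    · rintro (h | ⟨n, h⟩)
      · exact ⟨0, Or.inl h⟩
      · exact ⟨n + 1, Or.inr ⟨n, n.lt_succ_self, h⟩⟩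
    · rintro ⟨N, h | ⟨n, _, h⟩⟩
      · exact Or.inl h
      · exact Or.inr ⟨n, h⟩
  rw [heq]
  exact varCap_iUnion_le hp hmono hΩ fun N =>
    (hpartial N).trans (add_le_add le_rfl (ENNReal.sum_le_tsum _))

end IncreasingSets

/-! ### Capacities of balls -/

section CapacityOfBalls

variable {μ : Measure X} {p : ℝ}

lemma edist_le_curveLint_of_lipschitz {K : NNReal} {f : X → ℝ} (hf : LipschitzWith K f)
    (γ : Curve X) :
    edist (f (γ.toFun 0)) (f (γ.toFun γ.len)) ≤ curveLint γ fun _ => K := by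
  have h0 : (0 : ℝ) ∈ Icc 0 γ.len := ⟨le_rfl, γ.len_pos.le⟩
  have h1 : γ.len ∈ Icc 0 γ.len := ⟨γ.len_pos.le, le_rfl⟩
  calc edist (f (γ.toFun 0)) (f (γ.toFun γ.len))
      ≤ K * edist (γ.toFun 0) (γ.toFun γ.len) := hf _ _
    _ ≤ K * ENNReal.ofReal γ.len := by
        gcongr
        have := γ.lip h0 h1
        rwa [ENNReal.coe_one, one_mul, edist_dist (0 : ℝ), Real.dist_eq, zero_sub, abs_neg,
          abs_of_pos γ.len_pos] at this
    _ = curveLint γ fun _ => K := by simp [curveLint]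

lemma lipschitzWith_clamp_dist (x : X) {c : ℝ} (hc : 0 ≤ c) (a : ℝ) :
    LipschitzWith c.toNNReal fun y => max 0 (min 1 (c * (a - dist y x))) := by
  have h1 : LipschitzWith c.toNNReal fun y : X => c * (a - dist y x) := by
    refine LipschitzWith.of_dist_le_mul fun y z => ?_
    rw [Real.coe_toNNReal c hc, Real.dist_eq]
    have : c * (a - dist y x) - c * (a - dist z x) = c * (dist z x - dist y x) := by ring
    rw [this, abs_mul, abs_of_nonneg hc]
    gcongr
    rw [abs_sub_comm]
    exact abs_dist_sub_le y z x
  exact (h1.const_min 1).const_max 0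

lemma varCap_ball_lt_top [SFinite μ] (hd : DoublingMeasure μ) (hp : 0 < p) (x : X) {r R : ℝ}
    (hrR : r < R) : varCap μ p (ball x r) (ball x R) < ⊤ := by
  have hpos : 0 < R - r := sub_pos.2 hrR
  set c := (R - r)⁻¹
  have hc : 0 ≤ c := by positivity
  have hL := lipschitzWith_clamp_dist x hc R
  have hμ : μ (ball x R) < ⊤ := by
    rcases le_or_gt R 0 with h | h
    · simp [ball_eq_empty.2 h]
    · exact (hd.1 x R h).2
  have hzero : ∀ y ∉ ball x R, max 0 (min 1 (c * (R - dist y x))) = 0 := by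
    intro y hy
    have : R ≤ dist y x := not_lt.1 hy
    refine max_eq_left (min_le_of_right_le ?_)
    exact mul_nonpos_of_nonneg_of_nonpos hc (by linarith)
  have hcap : CapPair μ p (ball x r) (ball x R) (fun y => max 0 (min 1 (c * (R - dist y x))))
      ((ball x R).indicator fun _ => (c.toNNReal : ℝ≥0∞)) :=
    { meas := hL.continuous.measurable
      nonneg := fun _ => le_max_left _ _
      le_one := fun _ => max_le zero_le_one (min_le_left _ _)
      eq_one := fun y hy => by
        have : dist y x < r := hy
        have h1 : 1 ≤ c * (R - dist y x) := by
          rw [← inv_mul_cancel₀ hpos.ne']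
          exact mul_le_mul_of_nonneg_left (by linarith) hc
        rw [min_eq_left h1, max_eq_right zero_le_one]
      eq_zero := hzero
      grad_meas := measurable_const.indicator measurableSet_ball
      grad := isWeakUpperGradientOn_of_forall hp fun γ =>
        edist_le_curveLint_indicator isOpen_ball hzero (edist_le_curveLint_of_lipschitz hL) γ }
  refine (hcap.varCap_le hp hμ).trans_lt ?_
  rw [lintegral_indicator_rpow hp measurableSet_ball, lintegral_const, Measure.restrict_apply_univ]
  exact ENNReal.mul_lt_top (ENNReal.rpow_lt_top_of_nonneg hp.le ENNReal.coe_ne_top) hμ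

/-- Under a Poincaré inequality, a ball that some other point stays away from has positive
capacity. -/
lemma varCap_ball_ne_zero [SFinite μ] (hp : 1 ≤ p) (hd : DoublingMeasure μ)
    (hPI : PoincareInequality μ p) {x z : X} {s t : ℝ} (hs : 0 < s) (ht : t < dist z x) :
    varCap μ p (ball x s) (ball x t) ≠ 0 := by
  intro h0
  have hp0 : 0 < p := zero_lt_one.trans_le hp
  obtain ⟨f, hf⟩ := exists_capPair_zero_of_varCap_eq_zero hp h0
  obtain ⟨C, -, lam, -, hC⟩ := hPI
  set R := dist z x + s + 1
  have hR : 0 < R := by positivity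
  have hPI := hC x R hR f (fun _ => 0) hf.meas hf.grad_meas hf.grad
  rw [ENNReal.zero_rpow_of_pos hp0, lintegral_zero, mul_zero,
    ENNReal.zero_rpow_of_pos (by positivity), mul_zero, nonpos_iff_eq_zero, mul_eq_zero] at hPI
  have hint := hPI.resolve_left (ENNReal.inv_ne_zero.2 (hd.1 x R hR).2.ne)
  set a := ⨍ z in ball x R, f z ∂μ
  have hm : Measurable fun y => ENNReal.ofReal |f y - a| :=
    ENNReal.measurable_ofReal.comp (continuous_abs.measurable.comp (hf.meas.sub_const a))
  rw [lintegral_eq_zero_iff hm] at hint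
  have hae : ∀ᵐ y ∂μ.restrict (ball x R), f y = a := by
    filter_upwards [hint] with y hy
    have : |f y - a| ≤ 0 := ENNReal.ofReal_eq_zero.1 hy
    exact sub_eq_zero.1 (abs_nonpos_iff.1 this)
  have key : ∀ (w : X) (r : ℝ), 0 < r → ball w r ⊆ ball x R → ∀ b : ℝ,
      (∀ y ∈ ball w r, f y = b) → b = a := by
    intro w r hr hsub b hb
    have hae' := ae_restrict_of_ae_restrict_of_subset hsub hae
    have hne : (ae (μ.restrict (ball w r))).NeBot := by
      rw [ae_neBot, Ne, Measure.restrict_eq_zero]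
      exact (hd.1 w r hr).1.ne'
    obtain ⟨y, hy1, hy2⟩ := (hae'.and (ae_restrict_mem measurableSet_ball)).exists
    rw [← hb y hy2, hy1]
  have h1 : (1 : ℝ) = a :=
    key x s hs (ball_subset_ball (by linarith [dist_nonneg (x := z) (y := x)])) 1 hf.eq_one
  have h2 : (0 : ℝ) = a := by
    refine key z (min (dist z x - t) 1) (lt_min (by linarith) one_pos) ?_ 0 fun y hy => ?_
    · intro y hy
      have hy1 : dist y z < 1 := (mem_ball.1 hy).trans_le (min_le_right _ _)
      have := dist_triangle y z x
      exact mem_ball.2 (by linarith)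
    · refine hf.eq_zero y fun hyx => ?_
      have hy1 : dist y z < dist z x - t := (mem_ball.1 hy).trans_le (min_le_left _ _)
      have hy2 : dist y x < t := hyx
      have := dist_triangle z y x
      rw [dist_comm z y] at this
      linarith
  exact one_ne_zero (h1.trans h2.symm)

/-- Capacities of balls with centers in a compact set and radii bounded below are bounded below. -/
lemma exists_pos_le_varCap_ball [SFinite μ] (hp : 1 ≤ p) (hd : DoublingMeasure μ)
    (hPI : PoincareInequality μ p) {K : Set X} (hK : IsCompact K) {z : X} {D d : ℝ}
    (hd0 : 0 < d) (hdD : d ≤ D / 4) (hz : ∀ x ∈ K, D ≤ dist z x) :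
    ∃ κ : ℝ≥0∞, κ ≠ 0 ∧ κ ≠ ⊤ ∧
      ∀ x ∈ K, ∀ r, d ≤ r → r ≤ D / 4 → κ ≤ varCap μ p (ball x r) (ball x (2 * r)) := by
  have hp0 : 0 < p := zero_lt_one.trans_le hp
  obtain ⟨t, htK, ht⟩ := hK.elim_nhds_subcover (fun x => ball x (d / 2))
    fun x _ => ball_mem_nhds x (half_pos hd0)
  set F : X → ℝ≥0∞ := fun x => varCap μ p (ball x (d / 2)) (ball x (3 * D / 4))
  refine ⟨t.inf F ⊓ 1, ?_, ((min_le_right _ _).trans_lt ENNReal.one_lt_top).ne,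
    fun x hx r hr hrD => ?_⟩
  · refine (lt_min ?_ one_pos).ne'
    rw [Finset.lt_inf_iff (by simp)]
    intro x hx
    refine pos_iff_ne_zero.2 (varCap_ball_ne_zero hp hd hPI (z := z) (half_pos hd0) ?_)
    have := hz x (htK x hx)
    linarith
  · obtain ⟨y, hy, hxy⟩ := mem_iUnion₂.1 (ht hx)
    refine (min_le_left _ _).trans ((Finset.inf_le hy).trans (varCap_mono ?_ ?_))
    · intro w hw
      have h1 : dist w y < d / 2 := hw
      have h2 : dist x y < d / 2 := hxy
      have := dist_triangle_right w x y
      exact mem_ball.2 (by linarith)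
    · intro w hw
      have h1 : dist w x < 2 * r := hw
      have h2 : dist x y < d / 2 := hxy
      have := dist_triangle w x y
      exact mem_ball.2 (by linarith)

end CapacityOfBalls

/-! ### Lower semicontinuous layers -/

section Layers

variable {μ : Measure X} {p : ℝ}

lemma IsWeakUpperGradientOn.of_abs_sub_le [SFinite μ] (hp : 0 < p) {f f₁ f₂ : X → ℝ}
    {g₁ g₂ : X → ℝ≥0∞} {E : Set X} (h₁ : IsWeakUpperGradientOn μ p f₁ g₁ E)
    (h₂ : IsWeakUpperGradientOn μ p f₂ g₂ E) (a b : NNReal)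
    (hd : ∀ x y, |f x - f y| ≤ a * |f₁ x - f₁ y| + b * |f₂ x - f₂ y|) :
    IsWeakUpperGradientOn μ p f (fun x => a * g₁ x + b * g₂ x) E := by
  rw [isWeakUpperGradientOn_iff hp] at h₁ h₂ ⊢
  filter_upwards [h₁, h₂] with γ h1 h2 hγ
  have he : ∀ x y, edist (f x) (f y) ≤ a * edist (f₁ x) (f₁ y) + b * edist (f₂ x) (f₂ y) := by
    intro x y
    simp only [edist_dist, Real.dist_eq]
    calc ENNReal.ofReal |f x - f y|
        ≤ ENNReal.ofReal (a * |f₁ x - f₁ y| + b * |f₂ x - f₂ y|) :=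
          ENNReal.ofReal_le_ofReal (hd x y)
      _ = _ := by
          rw [ENNReal.ofReal_add (by positivity) (by positivity), ENNReal.ofReal_mul (by positivity),
            ENNReal.ofReal_mul (by positivity), ENNReal.ofReal_coe_nnreal,
            ENNReal.ofReal_coe_nnreal]
  calc edist (f (γ.toFun 0)) (f (γ.toFun γ.len))
      ≤ a * edist (f₁ (γ.toFun 0)) (f₁ (γ.toFun γ.len)) +
        b * edist (f₂ (γ.toFun 0)) (f₂ (γ.toFun γ.len)) := he _ _
    _ ≤ a * curveLint γ g₁ + b * curveLint γ g₂ := by gcongr; exacts [h1 hγ, h2 hγ]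
    _ ≤ curveLint γ (fun x => a * g₁ x) + curveLint γ (fun x => b * g₂ x) :=
        add_le_add (lintegral_const_mul_le _ _) (lintegral_const_mul_le _ _)
    _ ≤ curveLint γ fun x => a * g₁ x + b * g₂ x := le_lintegral_add _ _

/-- For all but countably many radii, the capacity is insensitive to small changes of the radii. -/
lemma exists_countable_varCap_ball [SFinite μ] (hp : 1 ≤ p) (hd : DoublingMeasure μ) (E : Set X)
    (x : X) : ∃ N : Set ℝ, N.Countable ∧ ∀ r ∉ N, 0 < r → ∀ e : ℝ≥0∞, e ≠ 0 →
      ∃ ρ, 0 < ρ ∧ ρ < r / 2 ∧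
        varCap μ p (E ∩ ball x (r + ρ)) (ball x (2 * r - ρ)) ≤
          varCap μ p (E ∩ ball x (r - ρ)) (ball x (2 * r + ρ)) + e := by
  have hp0 : 0 < p := zero_lt_one.trans_le hp
  set F : ℝ → ℝ → ℝ≥0∞ := fun a b => varCap μ p (E ∩ ball x a) (ball x b) with hFdef
  have hmono1 : ∀ b, Monotone fun a => F a b := fun b a a' h =>
    varCap_mono (inter_subset_inter_right _ (ball_subset_ball h)) Subset.rfl
  have hmono2 : ∀ a, Antitone fun t => F a (2 * t) := fun a t t' h =>
    varCap_mono Subset.rfl (ball_subset_ball (by linarith))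
  have hfin : ∀ {a b}, a < b → F a b ≠ ⊤ := fun h =>
    ((varCap_mono inter_subset_right Subset.rfl).trans_lt (varCap_ball_lt_top hd hp0 x h)).ne
  have hball : ∀ b, 0 < b → μ (ball x b) < ⊤ := fun b hb => (hd.1 x b hb).2
  have hsub : ∀ {a a' b b'}, a ≤ a' → b ≤ b' → 0 < b → F a' b' + F a b ≤ F a' b + F a b' := by
    intro a a' b b' ha hb hb0
    have := varCap_union_add_varCap_inter_le (μ := μ) hp (E := E ∩ ball x a') (E' := E ∩ ball x a)
      (hball b hb0) (hball b' (hb0.trans_le hb))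
    rwa [union_eq_left.2 (inter_subset_inter_right E (ball_subset_ball ha)),
      union_eq_right.2 (ball_subset_ball hb),
      inter_eq_right.2 (inter_subset_inter_right E (ball_subset_ball ha)),
      inter_eq_left.2 (ball_subset_ball hb)] at this
  refine ⟨⋃ q : ℚ, ({r | ¬ ContinuousAt (fun a => F a q) r} ∪
    {r | ¬ ContinuousAt (fun t => F q (2 * t)) r}),
    countable_iUnion fun q => ((hmono1 q).countable_not_continuousAt).union
      ((hmono2 q).countable_not_continuousAt), fun r hr hr0 e he => ?_⟩
  obtain ⟨q, hq1, hq2⟩ := exists_rat_btwn (show r < 2 * r by linarith)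
  have hq := fun h => hr (mem_iUnion.2 ⟨q, h⟩)
  have hc1 : ContinuousAt (fun a => F a q) r := by_contra fun h => hq (Or.inl h)
  have hc2 : ContinuousAt (fun t => F q (2 * t)) r := by_contra fun h => hq (Or.inr h)
  have he4 : 0 < e / 4 := ENNReal.div_pos he (by simp)
  have h1 := (ENNReal.tendsto_nhds (hfin hq1)).1 hc1.tendsto (e / 4) he4
  have h2 := (ENNReal.tendsto_nhds (hfin hq2)).1 hc2.tendsto (e / 4) he4
  obtain ⟨η, hη, hball⟩ := Metric.eventually_nhds_iff.1 (h1.and h2)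
  set ρ := min (η / 2) (min (r / 4) (min ((q - r) / 2) ((2 * r - q) / 2)))
  have hρη : ρ ≤ η / 2 := min_le_left _ _
  have hρr : ρ ≤ r / 4 := (min_le_right _ _).trans (min_le_left _ _)
  have hρq : ρ ≤ (q - r) / 2 := (min_le_right _ _).trans ((min_le_right _ _).trans (min_le_left _ _))
  have hρq' : ρ ≤ (2 * r - q) / 2 :=
    (min_le_right _ _).trans ((min_le_right _ _).trans (min_le_right _ _))
  have hρ : 0 < ρ := lt_min (by linarith) (lt_min (by linarith) (lt_min (by linarith) (by linarith)))
  have hstep : ∀ {L s t : ℝ≥0∞}, s ∈ Icc (L - e / 4) (L + e / 4) → t ∈ Icc (L - e / 4) (L + e / 4) →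
      s ≤ t + e / 2 := by
    intro L s t hs ht
    calc s ≤ L + e / 4 := hs.2
      _ ≤ (t + e / 4) + e / 4 := by gcongr; exact tsub_le_iff_right.1 ht.1
      _ = t + e / 2 := by
          rw [add_assoc, ← ENNReal.add_div, ← two_mul]
          congr 1
          rw [show (4 : ℝ≥0∞) = 2 * 2 by norm_num, ENNReal.mul_div_mul_left _ _ (by simp) (by simp)]
  have hd1 : ∀ s : ℝ, |s| ≤ ρ → dist (r + s) r < η := fun s hs => by
    rw [Real.dist_eq, add_sub_cancel_left]; linarith
  have hp1 := (hball (hd1 ρ (abs_of_pos hρ).le)).1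
  have hp2 := (hball (hd1 (-ρ) (by rw [abs_neg, abs_of_pos hρ]))).1
  have hp3 := (hball (hd1 (ρ / 2) (by rw [abs_of_pos (by linarith)]; linarith))).2
  have hp4 := (hball (hd1 (-(ρ / 2)) (by rw [abs_neg, abs_of_pos (by linarith)]; linarith))).2
  have e1 : F (r + ρ) q ≤ F (r - ρ) q + e / 2 := by
    have := hstep hp1 hp2
    rwa [← sub_eq_add_neg] at this
  have e2 : F q (2 * r - ρ) ≤ F q (2 * r + ρ) + e / 2 := by
    have := hstep hp4 hp3
    rwa [show 2 * (r + -(ρ / 2)) = 2 * r - ρ by ring, show 2 * (r + ρ / 2) = 2 * r + ρ by ring]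
      at this
  refine ⟨ρ, hρ, by linarith, ?_⟩
  have s1 : F (r + ρ) (2 * r - ρ) + F (r - ρ) q ≤ F (r + ρ) q + F (r - ρ) (2 * r - ρ) :=
    hsub (by linarith) (by linarith) (by linarith)
  have s2 : F q (2 * r + ρ) + F (r - ρ) (2 * r - ρ) ≤ F q (2 * r - ρ) + F (r - ρ) (2 * r + ρ) :=
    hsub (by linarith) (by linarith) (by linarith)
  have t1 : F (r + ρ) (2 * r - ρ) ≤ F (r - ρ) (2 * r - ρ) + e / 2 := by
    refine ENNReal.le_of_add_le_add_right (hfin (show r - ρ < q by linarith))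
      (s1.trans ((add_le_add e1 le_rfl).trans_eq ?_))
    ring
  have t2 : F (r - ρ) (2 * r - ρ) ≤ F (r - ρ) (2 * r + ρ) + e / 2 := by
    refine ENNReal.le_of_add_le_add_left (hfin (show (q : ℝ) < 2 * r + ρ by linarith))
      (s2.trans ((add_le_add e2 le_rfl).trans_eq ?_))
    ring
  calc F (r + ρ) (2 * r - ρ) ≤ (F (r - ρ) (2 * r + ρ) + e / 2) + e / 2 :=
        t1.trans (add_le_add t2 le_rfl)
    _ = F (r - ρ) (2 * r + ρ) + e := by rw [add_assoc, ENNReal.add_halves]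

/-- A lower semicontinuous Newtonian function with values in `[0, 1]` that equals `1` on `E`. -/
structure IsLayer (μ : Measure X) (p : ℝ) (E : Set X) (H : X → ℝ) (G : X → ℝ≥0∞) : Prop where
  lsc : LowerSemicontinuous H
  nonneg : ∀ x, 0 ≤ H x
  le_one : ∀ x, H x ≤ 1
  eq_one : ∀ x ∈ E, H x = 1
  grad_meas : Measurable G
  grad : IsWeakUpperGradientOn μ p H G univ
  grad_fin : ∫⁻ x, G x ^ p ∂μ < ⊤

/-- Some superlevel set of a layer adds at most `e` to the capacities of `E` in the balls
indexed by `T`. -/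
def LayerBound (μ : Measure X) (p : ℝ) (E : Set X) (e : ℝ≥0∞) (T : Set (X × ℝ)) : Prop :=
  ∃ (H : X → ℝ) (G : X → ℝ≥0∞) (σ : ℝ), IsLayer μ p E H G ∧ 0 ≤ σ ∧ σ < 1 ∧ ∀ y ∈ T,
    varCap μ p ((E ∪ {z | σ < H z}) ∩ ball y.1 y.2) (ball y.1 (2 * y.2)) ≤
      varCap μ p (E ∩ ball y.1 y.2) (ball y.1 (2 * y.2)) + e

lemma layerBound_empty [SFinite μ] (hp : 0 < p) (E : Set X) (e : ℝ≥0∞) :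
    LayerBound μ p E e ∅ := by
  refine ⟨fun _ => 1, fun _ => 0, 0, ⟨lowerSemicontinuous_const, fun _ => zero_le_one,
    fun _ => le_rfl, fun _ _ => rfl, measurable_const, ?_, ?_⟩, le_rfl, one_pos,
    fun y hy => hy.elim⟩
  · exact isWeakUpperGradientOn_of_forall hp fun γ => by simp
  · simp [ENNReal.zero_rpow_of_pos hp]

lemma LayerBound.union [SFinite μ] (hp : 1 ≤ p) {E : Set X} {e : ℝ≥0∞} {T T' : Set (X × ℝ)}
    (h : LayerBound μ p E e T) (h' : LayerBound μ p E e T') : LayerBound μ p E e (T ∪ T') := by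
  have hp0 : 0 < p := zero_lt_one.trans_le hp
  obtain ⟨H, G, σ, hH, h0, h1, hb⟩ := h
  obtain ⟨H', G', σ', hH', h0', h1', hb'⟩ := h'
  refine ⟨fun x => min (H x) (H' x), fun x => (1 : NNReal) * G x + (1 : NNReal) * G' x, max σ σ',
    ⟨hH.lsc.inf hH'.lsc, fun x => le_min (hH.nonneg x) (hH'.nonneg x),
      fun x => min_le_of_left_le (hH.le_one x),
      fun x hx => by simp only [hH.eq_one x hx, hH'.eq_one x hx, min_self],
      (hH.grad_meas.const_mul _).add (hH'.grad_meas.const_mul _),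
      hH.grad.of_abs_sub_le hp0 hH'.grad 1 1 fun x y => ?_, ?_⟩,
    le_max_of_le_left h0, max_lt h1 h1', ?_⟩
  · have := abs_min_sub_min_le_max (H x) (H' x) (H y) (H' y)
    simp only [NNReal.coe_one, one_mul]
    exact this.trans (max_le_add_of_nonneg (abs_nonneg _) (abs_nonneg _))
  · simp only [ENNReal.coe_one, one_mul]
    exact lintegral_add_rpow_lt_top hp hH.grad_meas hH.grad_fin hH'.grad_fin
  · rintro y (hy | hy)
    · refine (varCap_mono (inter_subset_inter_left _ (union_subset_union_right _ ?_))
        Subset.rfl).trans (hb y hy)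
      intro z hz
      exact (le_max_left σ σ').trans_lt (lt_of_lt_of_le hz (min_le_left _ _))
    · refine (varCap_mono (inter_subset_inter_left _ (union_subset_union_right _ ?_))
        Subset.rfl).trans (hb' y hy)
      intro z hz
      exact (le_max_right σ σ').trans_lt (lt_of_lt_of_le hz (min_le_right _ _))

end Layers

/-! ### Layers around compact sets -/

section LayerConstruction

variable {μ : Measure X} {p : ℝ}

/-- A capacity is almost attained by superlevel sets of lower semicontinuous functions. -/
lemma exists_lowerSemicontinuous_varCap_le [ProperSpace X] [SFinite μ] (hp : 1 ≤ p)
    {E Ω : Set X} (hΩ : IsOpen Ω) (hΩfin : μ Ω < ⊤) (hfin : varCap μ p E Ω ≠ ⊤) {e : ℝ≥0∞}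
    (he : e ≠ 0) (hetop : e ≠ ⊤) : ∃ (h : X → ℝ) (k : X → ℝ≥0∞) (σ : ℝ),
      LowerSemicontinuous h ∧ (∀ x, 0 ≤ h x) ∧ (∀ x, h x ≤ 1) ∧ (∀ x ∈ E, h x = 1) ∧
      Measurable k ∧ IsWeakUpperGradientOn μ p h k univ ∧ ∫⁻ x, k x ^ p ∂μ < ⊤ ∧ 0 ≤ σ ∧ σ < 1 ∧
      varCap μ p {x | σ < h x} Ω ≤ varCap μ p E Ω + e := by
  have hp0 : 0 < p := zero_lt_one.trans_le hp
  have he3 : e / 3 ≠ 0 := (ENNReal.div_pos he (by simp)).ne'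
  have he3' : e / 3 ≠ ⊤ := (ENNReal.div_lt_top hetop (by simp)).ne
  obtain ⟨f, G, hf, hG⟩ := exists_capPair_of_varCap_lt (ENNReal.lt_add_right hfin he3)
  have hGfin : ∫⁻ x, G x ^ p ∂μ < ⊤ := hG.trans_le le_top
  obtain ⟨h, k, -, hlsc, hfh, hh1, hhΩ, hk, hw, hke, -⟩ :=
    exists_lowerSemicontinuous_ge hp hf.meas hf.nonneg hf.le_one hΩ hΩfin hf.eq_zero hf.grad_meas
      hf.grad hGfin (q := fun _ => 0) (by simp) he3 he3'
  have hkfin : ∫⁻ x, k x ^ p ∂μ < ⊤ :=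
    hke.trans_lt (ENNReal.add_lt_top.2 ⟨hGfin, he3'.lt_top⟩)
  have hh0 : ∀ x, 0 ≤ h x := fun x => (hf.nonneg x).trans (hfh x)
  obtain ⟨δ, hδ0, hδtop, hδ⟩ :=
    exists_pos_lintegral_add_mul_rpow_le hp hk hk hkfin hkfin he3
  lift δ to NNReal using hδtop
  have hδpos : 0 < (δ : ℝ) := NNReal.coe_pos.2 (pos_iff_ne_zero.2 (by simpa using hδ0))
  refine ⟨h, k, 1 / (1 + δ), hlsc, hh0, hh1,
    fun x hx => le_antisymm (hh1 x) ((hf.eq_one x hx).symm.le.trans (hfh x)), hk, hw, hkfin,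
    by positivity, ?_, ?_⟩
  · rw [div_lt_one (by positivity)]; linarith
  have hcap : CapPair μ p {x | 1 / (1 + (δ : ℝ)) < h x} Ω (fun x => min ((1 + δ) * h x) 1)
      (fun x => (1 : NNReal) * k x + δ * k x) :=
    { meas := (hlsc.measurable.const_mul _).min measurable_const
      nonneg := fun x => le_min (mul_nonneg (by positivity) (hh0 x)) zero_le_one
      le_one := fun x => min_le_right _ _
      eq_one := fun x hx => by
        have : 1 / (1 + (δ : ℝ)) < h x := hx
        rw [div_lt_iff₀' (by positivity)] at this
        exact min_eq_right this.le
      eq_zero := fun x hx => by simp only [hhΩ x hx, mul_zero, zero_le_one, min_eq_left]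
      grad_meas := (hk.const_mul _).add (hk.const_mul _)
      grad := hw.of_abs_sub_le hp0 hw 1 δ fun x y => by
        have := abs_min_sub_min_le_max ((1 + (δ : ℝ)) * h x) 1 ((1 + δ) * h y) 1
        rw [sub_self, abs_zero, max_eq_left (abs_nonneg _), ← mul_sub, abs_mul,
          abs_of_pos (by positivity : (0 : ℝ) < 1 + δ)] at this
        rw [NNReal.coe_one]
        linarith }
  refine (hcap.varCap_le hp0 hΩfin).trans ?_
  simp only [ENNReal.coe_one, one_mul]
  calc ∫⁻ x, (k x + δ * k x) ^ p ∂μ ≤ ((varCap μ p E Ω + e / 3) + e / 3) + e / 3 := by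
        refine hδ.trans ?_
        gcongr
        refine hke.trans ?_
        gcongr
    _ = varCap μ p E Ω + e := by rw [add_assoc, add_assoc, ← add_assoc (e / 3), ENNReal.add_thirds]

lemma exists_layerBound_nhds [ProperSpace X] [SFinite μ] (hp : 1 ≤ p) (hd : DoublingMeasure μ)
    {E : Set X} {x : X} {r ρ : ℝ} {e : ℝ≥0∞} (he : e ≠ 0) (hetop : e ≠ ⊤) (hρ : 0 < ρ)
    (hρr : ρ < r / 2)
    (hr : varCap μ p (E ∩ ball x (r + ρ)) (ball x (2 * r - ρ)) ≤
      varCap μ p (E ∩ ball x (r - ρ)) (ball x (2 * r + ρ)) + e / 2) :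
    LayerBound μ p E e (ball x (ρ / 4) ×ˢ ball r (ρ / 4)) := by
  have hp0 : 0 < p := zero_lt_one.trans_le hp
  have he2 : e / 2 ≠ 0 := (ENNReal.half_pos he).ne'
  have he2' : e / 2 ≠ ⊤ := (ENNReal.div_lt_top hetop (by simp)).ne
  have hfin : varCap μ p (E ∩ ball x (r + ρ)) (ball x (2 * r - ρ)) ≠ ⊤ :=
    ((varCap_mono inter_subset_right Subset.rfl).trans_lt
      (varCap_ball_lt_top hd hp0 x (by linarith))).ne
  obtain ⟨h, k, σ, hlsc, hh0, hh1, hhE, hk, hw, hkfin, hσ0, hσ1, hcap⟩ :=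
    exists_lowerSemicontinuous_varCap_le hp isOpen_ball (hd.1 x (2 * r - ρ) (by linarith)).2 hfin
      he2 he2'
  set c := 4 / ρ
  have hc : 0 ≤ c := by positivity
  set v : X → ℝ := fun y => max 0 (min 1 (c * (r + ρ - dist y x)))
  have hv : LipschitzWith c.toNNReal v := lipschitzWith_clamp_dist x hc (r + ρ)
  have hv0 : ∀ y ∉ ball x (r + ρ), v y = 0 := by
    intro y hy
    have : r + ρ ≤ dist y x := not_lt.1 hy
    exact max_eq_left (min_le_of_right_le
      (mul_nonpos_of_nonneg_of_nonpos hc (by linarith)))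
  have hvmem : ∀ y, 0 ≤ v y ∧ v y ≤ 1 := fun y =>
    ⟨le_max_left _ _, max_le zero_le_one (min_le_left _ _)⟩
  have hv1 : ∀ y, dist y x ≤ r + 3 * ρ / 4 → v y = 1 := by
    intro y hy
    have h1 : 1 ≤ c * (r + ρ - dist y x) := by
      rw [div_mul_eq_mul_div, le_div_iff₀ hρ]
      linarith
    simp only [v, min_eq_left h1, max_eq_right zero_le_one]
  set G : X → ℝ≥0∞ := (ball x (r + ρ)).indicator fun _ => (c.toNNReal : ℝ≥0∞)
  have hG : Measurable G := measurable_const.indicator measurableSet_ball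
  have hvw : IsWeakUpperGradientOn μ p v G univ :=
    isWeakUpperGradientOn_of_forall hp0 fun γ =>
      edist_le_curveLint_indicator isOpen_ball hv0 (edist_le_curveLint_of_lipschitz hv) γ
  have hGfin : ∫⁻ y, G y ^ p ∂μ < ⊤ := by
    rw [lintegral_indicator_rpow hp0 measurableSet_ball, lintegral_const,
      Measure.restrict_apply_univ]
    exact ENNReal.mul_lt_top (ENNReal.rpow_lt_top_of_nonneg hp0.le ENNReal.coe_ne_top)
      (hd.1 x (r + ρ) (by linarith)).2
  refine ⟨fun y => max (h y) (1 - v y), fun y => (1 : NNReal) * k y + (1 : NNReal) * G y, σ,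
    ⟨hlsc.sup (continuous_const.sub hv.continuous).lowerSemicontinuous,
      fun y => le_max_of_le_left (hh0 y), fun y => max_le (hh1 y) (by linarith [hvmem y]),
      fun y hy => ?_, (hk.const_mul _).add (hG.const_mul _),
      hw.of_abs_sub_le hp0 hvw 1 1 fun y z => ?_, ?_⟩, hσ0, hσ1, ?_⟩
  · by_cases hyx : y ∈ ball x (r + ρ)
    · rw [hhE y ⟨hy, hyx⟩]
      exact max_eq_left (by linarith [hvmem y])
    · rw [hv0 y hyx, sub_zero]
      exact max_eq_right (hh1 y)
  · have := abs_max_sub_max_le_max (h y) (1 - v y) (h z) (1 - v z)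
    simp only [NNReal.coe_one, one_mul]
    refine this.trans ((max_le_add_of_nonneg (abs_nonneg _) (abs_nonneg _)).trans_eq ?_)
    rw [show 1 - v y - (1 - v z) = -(v y - v z) by ring, abs_neg]
  · simp only [ENNReal.coe_one, one_mul]
    exact lintegral_add_rpow_lt_top hp hk hkfin hGfin
  · rintro ⟨y, s⟩ ⟨hy, hs⟩
    have hy' : dist y x < ρ / 4 := hy
    have hs' : |s - r| < ρ / 4 := hs
    rw [abs_lt] at hs'
    simp only
    calc varCap μ p ((E ∪ {z | σ < max (h z) (1 - v z)}) ∩ ball y s) (ball y (2 * s))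
        ≤ varCap μ p {z | σ < h z} (ball x (2 * r - ρ)) := by
          refine varCap_mono ?_ ?_
          · rintro z ⟨hz, hzy⟩
            have hz1 : dist z y < s := hzy
            have hz2 := dist_triangle z y x
            change σ < h z
            rcases hz with hz | hz
            · rw [hhE z ⟨hz, mem_ball.2 (by linarith)⟩]
              exact hσ1
            · have hz3 : σ < max (h z) (1 - v z) := hz
              rwa [hv1 z (by linarith), sub_self, max_eq_left (hh0 z)] at hz3
          · intro z hz
            have hz1 : dist z x < 2 * r - ρ := hz
            have hz2 := dist_triangle_right z y x
            exact mem_ball.2 (by linarith)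
      _ ≤ varCap μ p (E ∩ ball x (r + ρ)) (ball x (2 * r - ρ)) + e / 2 := hcap
      _ ≤ (varCap μ p (E ∩ ball x (r - ρ)) (ball x (2 * r + ρ)) + e / 2) + e / 2 := by gcongr
      _ ≤ (varCap μ p (E ∩ ball y s) (ball y (2 * s)) + e / 2) + e / 2 := by
          gcongr ?_ + _ + _
          refine varCap_mono (inter_subset_inter_right _ ?_) ?_
          · intro z hz
            have hz1 : dist z x < r - ρ := hz
            have hz2 := dist_triangle_right z y x
            exact mem_ball.2 (by linarith)
          · intro z hz
            have hz1 : dist z y < 2 * s := hz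
            have hz2 := dist_triangle z y x
            exact mem_ball.2 (by linarith)
      _ = _ := by rw [add_assoc, ENNReal.add_halves]

/-- Every set `E` has a layer some superlevel set of which, for most radii, is barely larger than
`E` near a given compact set. -/
lemma exists_layer [ProperSpace X] [SFinite μ] (hp : 1 ≤ p) (hd : DoublingMeasure μ)
    (E : Set X) {K : Set X} (hK : IsCompact K) {a b : ℝ} (ha : 0 < a) {e β : ℝ≥0∞} (he : e ≠ 0)
    (hetop : e ≠ ⊤) (hβ : β ≠ 0) :
    ∃ (H : X → ℝ) (G : X → ℝ≥0∞) (σ : ℝ), IsLayer μ p E H G ∧ 0 ≤ σ ∧ σ < 1 ∧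
      ∀ x ∈ K, ∃ R ⊆ Icc a b, IsCompact R ∧ volume (Icc a b \ R) < β ∧ ∀ r ∈ R,
        varCap μ p ((E ∪ {z | σ < H z}) ∩ ball x r) (ball x (2 * r)) ≤
          varCap μ p (E ∩ ball x r) (ball x (2 * r)) + e := by
  have hp0 : 0 < p := zero_lt_one.trans_le hp
  have he2 : e / 2 ≠ 0 := (ENNReal.half_pos he).ne'
  suffices h : ∃ T : Set (X × ℝ), LayerBound μ p E e T ∧ ∀ x ∈ K, ∃ R ⊆ Icc a b, IsCompact R ∧
      volume (Icc a b \ R) < β ∧ ∀ r ∈ R, (x, r) ∈ T by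
    obtain ⟨T, ⟨H, G, σ, hH, h0, h1, hb⟩, hT⟩ := h
    refine ⟨H, G, σ, hH, h0, h1, fun x hx => ?_⟩
    obtain ⟨R, hR, hRc, hRβ, hRT⟩ := hT x hx
    exact ⟨R, hR, hRc, hRβ, fun r hr => hb (x, r) (hRT r hr)⟩
  refine hK.induction_on (p := fun S => ∃ T : Set (X × ℝ), LayerBound μ p E e T ∧ ∀ x ∈ S,
    ∃ R ⊆ Icc a b, IsCompact R ∧ volume (Icc a b \ R) < β ∧ ∀ r ∈ R, (x, r) ∈ T) ?_ ?_ ?_ ?_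
  · exact ⟨∅, layerBound_empty hp0 E e, fun x hx => hx.elim⟩
  · rintro S S' hS ⟨T, hT, hb⟩
    exact ⟨T, hT, fun x hx => hb x (hS hx)⟩
  · rintro S S' ⟨T, hT, hb⟩ ⟨T', hT', hb'⟩
    refine ⟨T ∪ T', hT.union hp hT', ?_⟩
    rintro x (hx | hx)
    · obtain ⟨R, hR, hRc, hRβ, hRT⟩ := hb x hx
      exact ⟨R, hR, hRc, hRβ, fun r hr => Or.inl (hRT r hr)⟩
    · obtain ⟨R, hR, hRc, hRβ, hRT⟩ := hb' x hx
      exact ⟨R, hR, hRc, hRβ, fun r hr => Or.inr (hRT r hr)⟩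
  intro x _
  obtain ⟨N, hN, hNr⟩ := exists_countable_varCap_ball hp hd E x
  have hm : MeasurableSet (Icc a b \ N) := measurableSet_Icc.diff hN.measurableSet
  have hfin : volume (Icc a b \ N) ≠ ⊤ :=
    ((measure_mono sdiff_subset).trans_lt measure_Icc_lt_top).ne
  obtain ⟨R, hR, hRc, hRβ⟩ := hm.exists_isCompact_sdiff_lt hfin hβ
  obtain ⟨T, hTo, hRT, hT⟩ : ∃ T : Set (X × ℝ), IsOpen T ∧ {x} ×ˢ R ⊆ T ∧ LayerBound μ p E e T := by
    refine hRc.induction_on (p := fun S => ∃ T : Set (X × ℝ), IsOpen T ∧ {x} ×ˢ S ⊆ T ∧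
      LayerBound μ p E e T) ?_ ?_ ?_ ?_
    · exact ⟨∅, isOpen_empty, by simp, layerBound_empty hp0 E e⟩
    · rintro S S' hS ⟨T, hTo, hST, hT⟩
      exact ⟨T, hTo, (prod_mono_right hS).trans hST, hT⟩
    · rintro S S' ⟨T, hTo, hST, hT⟩ ⟨T', hTo', hST', hT'⟩
      refine ⟨T ∪ T', hTo.union hTo', ?_, hT.union hp hT'⟩
      rw [prod_union]
      exact union_subset_union hST hST'
    · intro r hr
      obtain ⟨ρ, hρ, hρr, hle⟩ := hNr r (hR hr).2 (ha.trans_le (hR hr).1.1) (e / 2) he2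
      refine ⟨ball r (ρ / 4), mem_nhdsWithin_of_mem_nhds (ball_mem_nhds r (by linarith)),
        ball x (ρ / 4) ×ˢ ball r (ρ / 4), isOpen_ball.prod isOpen_ball,
        prod_mono_left (singleton_subset_iff.2 (mem_ball_self (by linarith))),
        exists_layerBound_nhds hp hd he hetop hρ hρr hle⟩
  obtain ⟨u, v, hu, -, hxu, hRv, huv⟩ := generalized_tube_lemma isCompact_singleton hRc hTo hRT
  refine ⟨u, mem_nhdsWithin_of_mem_nhds (hu.mem_nhds (hxu rfl)), T, hT, fun y hy =>
    ⟨R, hR.trans sdiff_subset, hRc, ?_, fun r hr => huv ⟨hy, hRv hr⟩⟩⟩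
  refine (measure_mono ?_).trans_lt (lt_of_le_of_lt (measure_union_le ((Icc a b \ N) \ R) N) ?_)
  · intro r hr
    by_cases h : r ∈ N
    · exact Or.inr h
    · exact Or.inl ⟨⟨hr.1, h⟩, hr.2⟩
  · rw [hN.measure_zero, add_zero]
    exact hRβ

end LayerConstruction

/-! ### Thinness -/

section Thinness

variable {μ : Measure X} {p : ℝ}

lemma Thin.mono (hp : 1 < p) {E E' : Set X} {x : X} (h : Thin μ p E x) (hE : E' ⊆ E) :
    Thin μ p E' x := by
  refine lt_of_le_of_lt (lintegral_mono fun r => ?_) h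
  have hp1 : 0 ≤ 1 / (p - 1) := by
    have := sub_pos.2 hp
    positivity
  gcongr
  unfold thinIntegrand
  split_ifs
  · exact le_rfl
  · refine ENNReal.rpow_le_rpow ?_ hp1
    gcongr
    exact varCap_mono (inter_subset_inter_left _ hE) Subset.rfl

lemma thinIntegrand_le_one (hp : 1 < p) (E : Set X) (x : X) (r : ℝ) :
    thinIntegrand μ p E x r ≤ 1 := by
  have hp1 : 0 ≤ 1 / (p - 1) := by
    have := sub_pos.2 hp
    positivity
  unfold thinIntegrand
  split_ifs with h
  · exact le_rfl
  · refine ENNReal.rpow_le_one ?_ hp1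
    refine ENNReal.div_le_of_le_mul ?_
    rw [one_mul]
    exact varCap_mono inter_subset_right Subset.rfl

lemma add_rpow_le_two_rpow_mul {s : ℝ} (hs : 0 ≤ s) (a b : ℝ≥0∞) :
    (a + b) ^ s ≤ 2 ^ s * (a ^ s + b ^ s) := by
  have h : ∀ c d : ℝ≥0∞, c ≤ d → (c + d) ^ s ≤ 2 ^ s * (c ^ s + d ^ s) := fun c d hcd => by
    calc (c + d) ^ s ≤ (2 * d) ^ s := by
          gcongr
          rw [two_mul]
          gcongr
      _ = 2 ^ s * d ^ s := ENNReal.mul_rpow_of_nonneg _ _ hs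
      _ ≤ _ := by gcongr; exact le_add_self
  rcases le_total a b with hab | hab
  · exact h a b hab
  · rw [add_comm a, add_comm (a ^ s)]
    exact h b a hab

/-- If `Z` is barely larger than `E` in the balls around `x` for most radii, then thinness of `E`
at `x` passes to `Z`. -/
lemma Thin.of_varCap_le [SFinite μ] (hp : 1 < p) (hd : DoublingMeasure μ) {E Z : Set X} {x : X}
    (h : Thin μ p E x) {r₀ : ℝ} (hr₀ : 0 < r₀)
    (hcap : ∀ r, 0 < r → r < r₀ → varCap μ p (ball x r) (ball x (2 * r)) ≠ 0) {B : Set ℝ}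
    (hB : MeasurableSet B) (hBfin : ∫⁻ r in B, (ENNReal.ofReal r)⁻¹ < ⊤)
    (hZ : ∀ r, 0 < r → r < r₀ → r ∉ B → varCap μ p (Z ∩ ball x r) (ball x (2 * r)) ≤
      varCap μ p (E ∩ ball x r) (ball x (2 * r)) +
        varCap μ p (ball x r) (ball x (2 * r)) * ENNReal.ofReal r ^ (p - 1)) :
    Thin μ p Z x := by
  have hp1 : 0 < p - 1 := sub_pos.2 hp
  set s := 1 / (p - 1)
  have hs : 0 ≤ s := by positivity
  set R : ℝ → ℝ≥0∞ := fun r =>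
    2 ^ s + B.indicator (fun r => (ENNReal.ofReal r)⁻¹) r + (ENNReal.ofReal r₀)⁻¹
  have hinv : Measurable fun r : ℝ => (ENNReal.ofReal r)⁻¹ := ENNReal.measurable_ofReal.inv
  have hR : Measurable R := (measurable_const.add (hinv.indicator hB)).add measurable_const
  have h2 : (2 : ℝ≥0∞) ^ s ≠ ⊤ := ENNReal.rpow_ne_top_of_nonneg hs (by simp)
  have hle : ∀ r ∈ Ioo (0 : ℝ) 1, thinIntegrand μ p Z x r / ENNReal.ofReal r ≤
      2 ^ s * (thinIntegrand μ p E x r / ENNReal.ofReal r) + R r := by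
    intro r hr
    have hrne : ENNReal.ofReal r ≠ 0 := (ENNReal.ofReal_pos.2 hr.1).ne'
    have htriv : thinIntegrand μ p Z x r / ENNReal.ofReal r ≤ (ENNReal.ofReal r)⁻¹ := by
      rw [div_eq_mul_inv]
      exact mul_le_of_le_one_left' (thinIntegrand_le_one hp Z x r)
    by_cases hr0 : r < r₀
    · by_cases hrB : r ∈ B
      · refine htriv.trans (le_add_left ?_)
        simp only [R, indicator_of_mem hrB]
        exact le_add_right le_add_self
      · have hne := hcap r hr.1 hr0
        have hfin : varCap μ p (ball x r) (ball x (2 * r)) ≠ ⊤ :=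
          (varCap_ball_lt_top hd (by linarith) x (by linarith [hr.1])).ne
        have key : thinIntegrand μ p Z x r ≤
            2 ^ s * (thinIntegrand μ p E x r + ENNReal.ofReal r) := by
          unfold thinIntegrand
          rw [if_neg hne, if_neg hne]
          refine (ENNReal.rpow_le_rpow (ENNReal.div_le_div_right (hZ r hr.1 hr0 hrB) _)
            hs).trans ?_
          rw [ENNReal.add_div, ENNReal.mul_div_right_comm, ENNReal.div_self hne hfin, one_mul]
          refine (add_rpow_le_two_rpow_mul hs _ _).trans_eq ?_
          rw [← ENNReal.rpow_mul, mul_one_div_cancel hp1.ne', ENNReal.rpow_one]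
        calc thinIntegrand μ p Z x r / ENNReal.ofReal r
            ≤ 2 ^ s * (thinIntegrand μ p E x r + ENNReal.ofReal r) / ENNReal.ofReal r := by
              gcongr
          _ = 2 ^ s * (thinIntegrand μ p E x r / ENNReal.ofReal r) + 2 ^ s := by
              rw [mul_div_assoc, ENNReal.add_div, ENNReal.div_self hrne ENNReal.ofReal_ne_top,
                mul_add, mul_one]
          _ ≤ _ := by
              gcongr
              exact le_add_right (le_add_right le_rfl)
    · refine htriv.trans (le_add_left (le_add_left ?_))
      rw [ENNReal.inv_le_inv]
      exact ENNReal.ofReal_le_ofReal (not_lt.1 hr0)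
  have hvol : volume (Ioo (0 : ℝ) 1) < ⊤ := measure_Ioo_lt_top
  refine lt_of_le_of_lt (setLIntegral_mono' measurableSet_Ioo hle) ?_
  rw [lintegral_add_right _ hR, lintegral_const_mul' _ _ h2]
  refine ENNReal.add_lt_top.2 ⟨ENNReal.mul_lt_top h2.lt_top h, ?_⟩
  have hR' : ∫⁻ r in Ioo (0 : ℝ) 1, R r = 2 ^ s * volume (Ioo (0 : ℝ) 1) +
      (∫⁻ r in Ioo (0 : ℝ) 1, B.indicator (fun r => (ENNReal.ofReal r)⁻¹) r) +
      (ENNReal.ofReal r₀)⁻¹ * volume (Ioo (0 : ℝ) 1) := by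
    rw [lintegral_add_right _ measurable_const, lintegral_add_left measurable_const,
      setLIntegral_const, setLIntegral_const]
  rw [hR']
  refine ENNReal.add_lt_top.2 ⟨ENNReal.add_lt_top.2 ⟨ENNReal.mul_lt_top h2.lt_top hvol, ?_⟩,
    ENNReal.mul_lt_top (ENNReal.inv_lt_top.2 (ENNReal.ofReal_pos.2 hr₀)) hvol⟩
  refine lt_of_le_of_lt (setLIntegral_le_lintegral _ _) ?_
  rwa [lintegral_indicator hB]

lemma iSup_rpow_le_tsum (hp : 0 < p) (a : ℕ → ℝ≥0∞) : (⨆ n, a n) ^ p ≤ ∑' n, a n ^ p := by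
  have := (ENNReal.orderIsoRpow p hp).map_iSup a
  simp only [ENNReal.orderIsoRpow_apply] at this
  rw [this]
  exact iSup_le fun n => ENNReal.le_tsum n

lemma eventually_curve_reverse (hp : 0 < p) {P : Curve X → Prop}
    (h : ∀ᶠ γ in curveFilter μ p hp, P γ) : ∀ᶠ γ in curveFilter μ p hp, P γ.reverse := by
  rw [eventually_curve_iff] at h ⊢
  obtain ⟨ρ, hρ, hfin, hP⟩ := h
  exact ⟨ρ, hρ, hfin, fun γ hγ => hP γ.reverse (by rwa [curveLint_reverse])⟩

end Thinness

/-! ### Shells around a compact set -/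

section Shells

variable {μ : Measure X} {p : ℝ}

lemma tsum_two_inv_pow_succ : ∑' n : ℕ, (2 : ℝ≥0∞)⁻¹ ^ (n + 1) = 1 := by
  rw [ENNReal.tsum_geometric_add_one, ENNReal.one_sub_inv_two, inv_inv,
    ENNReal.inv_mul_cancel (by simp) (by simp)]

/-- The distance to the complement of `O \ K`, truncated at `1`. -/
def shellDist (K O : Set X) (y : X) : ℝ := min 1 (infDist y (O \ K)ᶜ)

lemma lipschitzWith_shellDist (K O : Set X) : LipschitzWith 1 (shellDist K O) :=
  (lipschitz_infDist_pt _).const_min 1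

lemma mem_of_shellDist_pos {K O : Set X} {y : X} (h : 0 < shellDist K O y) : y ∈ O \ K := by
  by_contra hy
  have : infDist y (O \ K)ᶜ = 0 := infDist_zero_of_mem hy
  have h1 := h.trans_le (min_le_right _ _)
  linarith

lemma shellDist_pos {K O : Set X} (hK : IsClosed K) (hO : IsOpen O) {z : X} (hz : z ∉ O) {y : X}
    (hy : y ∈ O \ K) : 0 < shellDist K O y := by
  refine lt_min one_pos ?_
  have hcl : IsClosed (O \ K)ᶜ := (hO.sdiff hK).isClosed_compl
  exact (hcl.notMem_iff_infDist_pos ⟨z, fun h => hz h.1⟩).1 fun h => h hy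

/-- The points of `O \ K` at distance comparable with `2⁻ⁿ` to the complement of `O \ K`. -/
def shell (K O : Set X) (n : ℕ) : Set X :=
  {y | (1 / 2) ^ (n + 1) ≤ shellDist K O y ∧ shellDist K O y ≤ 2 * (1 / 2) ^ (n + 1)}

/-- A neighborhood of `shell K O n`. -/
def wideShell (K O : Set X) (n : ℕ) : Set X :=
  {y | (1 / 2) ^ (n + 1) / 2 < shellDist K O y ∧ shellDist K O y < 4 * (1 / 2) ^ (n + 1)}

lemma isClosed_shell (K O : Set X) (n : ℕ) : IsClosed (shell K O n) :=
  (isClosed_le continuous_const (lipschitzWith_shellDist K O).continuous).inter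
    (isClosed_le (lipschitzWith_shellDist K O).continuous continuous_const)

lemma isOpen_wideShell (K O : Set X) (n : ℕ) : IsOpen (wideShell K O n) :=
  (isOpen_lt continuous_const (lipschitzWith_shellDist K O).continuous).inter
    (isOpen_lt (lipschitzWith_shellDist K O).continuous continuous_const)

lemma mem_wideShell_of_dist_lt {K O : Set X} {n : ℕ} {x y : X} (hx : x ∈ shell K O n)
    (h : dist y x < (1 / 2) ^ (n + 1) / 2) : y ∈ wideShell K O n := by
  have h1 := (lipschitzWith_shellDist K O).dist_le_mul y x
  rw [NNReal.coe_one, one_mul, Real.dist_eq, abs_le] at h1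
  have h2 : (0 : ℝ) < (1 / 2) ^ (n + 1) := by positivity
  exact ⟨by linarith [hx.1], by linarith [hx.2]⟩

lemma wideShell_subset (K O : Set X) (n : ℕ) : wideShell K O n ⊆ O \ K := fun _ hy =>
  mem_of_shellDist_pos (lt_trans (by positivity) hy.1)

lemma shell_subset_wideShell (K O : Set X) (n : ℕ) : shell K O n ⊆ wideShell K O n := fun y hy =>
  mem_wideShell_of_dist_lt hy (by rw [dist_self]; positivity)

/-- The points of the `n`-th shell, relatively close to `M`, where `H ≤ σ`. -/
def shellPiece (K O M : Set X) (H : X → ℝ) (σ : ℝ) (n : ℕ) : Set X :=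
  shell K O n ∩ {y | 2 * infEDist y M ≤ infEDist y Oᶜ} ∩ {y | H y ≤ σ}

lemma isClosed_shellPiece (K O M : Set X) {H : X → ℝ} (hH : LowerSemicontinuous H) (σ : ℝ)
    (n : ℕ) : IsClosed (shellPiece K O M H σ n) := by
  refine ((isClosed_shell K O n).inter (isClosed_le ?_ continuous_infEDist)).inter
    (hH.isClosed_preimage σ)
  exact (ENNReal.continuous_const_mul (by simp)).comp continuous_infEDist

lemma shellPiece_subset (K O M : Set X) (H : X → ℝ) (σ : ℝ) (n : ℕ) :
    shellPiece K O M H σ n ⊆ O \ K := fun _ hy =>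
  wideShell_subset K O n (shell_subset_wideShell K O n hy.1.1)

lemma isClosed_union_iUnion_shellPiece {K O M : Set X} (hK : IsClosed K) (hO : IsOpen O)
    (hM : M ⊆ K) {z : X} (hz : z ∉ O) {H : ℕ → X → ℝ} (hH : ∀ n, LowerSemicontinuous (H n))
    (σ : ℕ → ℝ) : IsClosed (K ∪ ⋃ n, shellPiece K O M (H n) (σ n) n) := by
  rw [← isOpen_compl_iff, isOpen_iff_mem_nhds]
  intro y hy
  rw [mem_compl_iff, mem_union, mem_iUnion, not_or] at hy
  by_cases hyO : y ∈ O
  · have hδ := shellDist_pos hK hO hz ⟨hyO, hy.1⟩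
    obtain ⟨N, hN⟩ := exists_pow_lt_of_lt_one (half_pos hδ) (show (1 / 2 : ℝ) < 1 by norm_num)
    have h1 : ∀ᶠ w in nhds y, shellDist K O y / 2 < shellDist K O w :=
      (lipschitzWith_shellDist K O).continuous.continuousAt.eventually_const_lt (half_lt_self hδ)
    have h2 : ∀ᶠ w in nhds y, ∀ n ∈ Finset.range N, w ∉ shellPiece K O M (H n) (σ n) n :=
      (Finset.eventually_all _).2 fun n _ =>
        (isClosed_shellPiece K O M (hH n) (σ n) n).isOpen_compl.mem_nhds fun h => hy.2 ⟨n, h⟩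
    filter_upwards [h1, h2, hK.isOpen_compl.mem_nhds hy.1] with w hw1 hw2 hw3
    rw [mem_compl_iff, mem_union, mem_iUnion, not_or]
    refine ⟨hw3, fun ⟨n, hn⟩ => ?_⟩
    by_cases hnN : n < N
    · exact hw2 n (Finset.mem_range.2 hnN) hn
    · have h3 : (1 / 2 : ℝ) ^ n ≤ (1 / 2) ^ N :=
        pow_le_pow_of_le_one (by norm_num) (by norm_num) (not_lt.1 hnN)
      have h4 := hn.1.1.2
      rw [pow_succ] at h4
      linarith
  · have hyM : infEDist y M ≠ 0 := fun h =>
      hy.1 (hK.closure_subset_iff.2 hM (mem_closure_iff_infEDist_zero.2 h))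
    have hyC : y ∉ {w | 2 * infEDist w M ≤ infEDist w Oᶜ} := by
      change ¬ (2 * infEDist y M ≤ infEDist y Oᶜ)
      rw [infEDist_zero_of_mem (show y ∈ Oᶜ from hyO), nonpos_iff_eq_zero, mul_eq_zero]
      simpa using hyM
    have hC : IsClosed {w | 2 * infEDist w M ≤ infEDist w Oᶜ} :=
      isClosed_le ((ENNReal.continuous_const_mul (by simp)).comp continuous_infEDist)
        continuous_infEDist
    filter_upwards [hC.isOpen_compl.mem_nhds hyC, hK.isOpen_compl.mem_nhds hy.1] with w hw1 hw2
    rw [mem_compl_iff, mem_union, mem_iUnion, not_or]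
    exact ⟨hw2, fun ⟨n, hn⟩ => hw1 hn.1.2⟩

/-- Near a point of `M` the complement of the shell pieces is covered by superlevel sets. -/
lemma compl_inter_ball_subset {K O M : Set X} (hK : IsClosed K) (hO : IsOpen O)
    (hM : M ⊆ K) {z : X} (hz : z ∉ O) {H : ℕ → X → ℝ} {σ : ℕ → ℝ} {x : X} (hx : x ∈ M) {s r : ℝ}
    (hs : ball x (3 * s) ⊆ O) (hrs : r < s) :
    (K ∪ ⋃ n, shellPiece K O M (H n) (σ n) n)ᶜ ∩ ball x r ⊆
      {y | ∃ n, (1 / 2) ^ (n + 1) < r ∧ σ n < H n y} := by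
  rintro y ⟨hy, hyr⟩
  rw [mem_compl_iff, mem_union, mem_iUnion, not_or] at hy
  have hyx : dist y x < r := hyr
  have hs0 : 0 < s := dist_nonneg.trans_lt (hyx.trans hrs)
  have hyO : y ∈ O := hs (mem_ball.2 (by linarith))
  have hδ := shellDist_pos hK hO hz ⟨hyO, hy.1⟩
  obtain ⟨n, hn1, hn2⟩ := exists_nat_pow_near_of_lt_one hδ (min_le_left _ _)
    (show (0 : ℝ) < 1 / 2 by norm_num) (show (1 / 2 : ℝ) < 1 by norm_num)
  have hδr : shellDist K O y < r :=
    (min_le_right _ _).trans_lt ((infDist_le_dist_of_mem fun h => h.2 (hM hx)).trans_lt hyx)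
  refine ⟨n, hn1.trans hδr, lt_of_not_ge fun hle => hy.2 ⟨n, ⟨⟨hn1.le, ?_⟩, ?_⟩, hle⟩⟩
  · rw [pow_succ]
    linarith
  · change 2 * infEDist y M ≤ infEDist y Oᶜ
    calc 2 * infEDist y M ≤ 2 * ENNReal.ofReal s := by
          gcongr
          refine (infEDist_le_edist_of_mem hx).trans ?_
          rw [edist_dist]
          exact ENNReal.ofReal_le_ofReal (by linarith)
      _ = ENNReal.ofReal (2 * s) := by
          rw [ENNReal.ofReal_mul (by norm_num), ENNReal.ofReal_ofNat]
      _ ≤ infEDist y Oᶜ := by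
          refine le_infEDist.2 fun w hw => ?_
          rw [edist_dist]
          refine ENNReal.ofReal_le_ofReal ?_
          have h1 : 3 * s ≤ dist w x := not_lt.1 fun h => hw (hs h)
          have h2 := dist_triangle_left w x y
          linarith

/-- If the layers `H n` are sufficiently tight, the complement of the union of `K` and the shell
pieces is thin at the points of `M` where `E` is thin. -/
lemma thin_compl_union_shellPiece [SFinite μ] (hp : 1 < p) (hd : DoublingMeasure μ)
    {E K O M : Set X} (hK : IsClosed K) (hO : IsOpen O) (hM : M ⊆ K) (hMO : M ⊆ O) {z : X}
    (hz : z ∉ O) {H : ℕ → X → ℝ} {σ : ℕ → ℝ} {κ : ℕ → ℝ≥0∞} {r₁ : ℝ} (hr₁ : 0 < r₁)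
    (hκ0 : ∀ n, κ n ≠ 0)
    (hκ : ∀ n, ∀ x ∈ K, ∀ r, (1 / 2) ^ (n + 1) ≤ r → r ≤ r₁ →
      κ n ≤ varCap μ p (ball x r) (ball x (2 * r)))
    (hH : ∀ n, ∀ x ∈ K, ∃ R ⊆ Icc ((1 / 2) ^ (n + 1)) r₁, IsCompact R ∧
      volume (Icc ((1 / 2) ^ (n + 1)) r₁ \ R) < ENNReal.ofReal ((1 / 2) ^ (n + 1)) * 2⁻¹ ^ (n + 1) ∧
      ∀ r ∈ R, varCap μ p ((E ∪ {y | σ n < H n y}) ∩ ball x r) (ball x (2 * r)) ≤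
        varCap μ p (E ∩ ball x r) (ball x (2 * r)) +
          κ n * ENNReal.ofReal ((1 / 2) ^ (n + 1)) ^ (p - 1) * 2⁻¹ ^ (n + 1))
    {x : X} (hx : x ∈ M) (hE : Thin μ p E x) :
    Thin μ p (K ∪ ⋃ n, shellPiece K O M (H n) (σ n) n)ᶜ x := by
  have hp1 : 0 < p - 1 := sub_pos.2 hp
  choose! R hRI hRc hRβ hRr using fun n => hH n x (hM hx)
  obtain ⟨ε, hε, hball⟩ := Metric.isOpen_iff.1 hO x (hMO hx)
  set s := ε / 3
  have hs : ball x (3 * s) ⊆ O := by rwa [show 3 * s = ε by simp only [s]; ring]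
  set B : Set ℝ := ⋃ n : ℕ, Icc ((1 / 2) ^ (n + 1)) r₁ \ R n
  have hB : MeasurableSet B :=
    MeasurableSet.iUnion fun n => measurableSet_Icc.diff (hRc n).measurableSet
  have hBfin : ∫⁻ r in B, (ENNReal.ofReal r)⁻¹ < ⊤ := by
    refine (lintegral_iUnion_le _ _).trans_lt (lt_of_le_of_lt (ENNReal.tsum_le_tsum fun n => ?_)
      (tsum_two_inv_pow_succ.trans_lt ENNReal.one_lt_top))
    have hpos : (0 : ℝ) < (1 / 2) ^ (n + 1) := by positivity
    calc ∫⁻ r in Icc ((1 / 2) ^ (n + 1)) r₁ \ R n, (ENNReal.ofReal r)⁻¹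
        ≤ ∫⁻ _ in Icc ((1 / 2) ^ (n + 1)) r₁ \ R n, (ENNReal.ofReal ((1 / 2) ^ (n + 1)))⁻¹ := by
          refine setLIntegral_mono' (measurableSet_Icc.diff (hRc n).measurableSet) fun r hr => ?_
          rw [ENNReal.inv_le_inv]
          exact ENNReal.ofReal_le_ofReal hr.1.1
      _ = (ENNReal.ofReal ((1 / 2) ^ (n + 1)))⁻¹ * volume (Icc ((1 / 2) ^ (n + 1)) r₁ \ R n) :=
          setLIntegral_const _ _
      _ ≤ (ENNReal.ofReal ((1 / 2) ^ (n + 1)))⁻¹ *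
          (ENNReal.ofReal ((1 / 2) ^ (n + 1)) * 2⁻¹ ^ (n + 1)) := by
          gcongr
          exact (hRβ n).le
      _ = 2⁻¹ ^ (n + 1) := by
          rw [← mul_assoc, ENNReal.inv_mul_cancel (ENNReal.ofReal_pos.2 hpos).ne'
            ENNReal.ofReal_ne_top, one_mul]
  have hlevel : ∀ {r : ℝ}, 0 < r → ∃ n : ℕ, (1 / 2 : ℝ) ^ (n + 1) ≤ r := by
    intro r hr
    obtain ⟨n, hn⟩ := exists_pow_lt_of_lt_one hr (show (1 / 2 : ℝ) < 1 by norm_num)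
    exact ⟨n, (pow_le_pow_of_le_one (by norm_num) (by norm_num) n.le_succ).trans hn.le⟩
  refine hE.of_varCap_le hp hd (r₀ := min r₁ s) (lt_min hr₁ (by positivity)) ?_ hB hBfin ?_
  · intro r hr hrr
    obtain ⟨n, hn⟩ := hlevel hr
    exact fun h0 => hκ0 n (nonpos_iff_eq_zero.1
      ((hκ n x (hM hx) r hn (hrr.le.trans (min_le_left _ _))).trans_eq h0))
  · intro r hr hrr hrB
    have hr1 : r ≤ r₁ := hrr.le.trans (min_le_left _ _)
    have hcov := compl_inter_ball_subset hK hO hM hz (H := H) (σ := σ) hx hs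
      (hrr.trans_le (min_le_right _ _))
    set D : ℕ → Set X := fun n => {y | (1 / 2) ^ (n + 1) < r ∧ σ n < H n y} ∩ ball x r
    set c := varCap μ p (ball x r) (ball x (2 * r))
    have hΩ : μ (ball x (2 * r)) < ⊤ := (hd.1 x (2 * r) (by positivity)).2
    have hfin : varCap μ p (E ∩ ball x r) (ball x (2 * r)) ≠ ⊤ :=
      ((varCap_mono inter_subset_right Subset.rfl).trans_lt
        (varCap_ball_lt_top hd (by linarith) x (by linarith))).ne
    have hstep : ∀ n, varCap μ p ((E ∩ ball x r) ∪ D n) (ball x (2 * r)) ≤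
        varCap μ p (E ∩ ball x r) (ball x (2 * r)) +
          c * ENNReal.ofReal r ^ (p - 1) * 2⁻¹ ^ (n + 1) := by
      intro n
      by_cases hn : (1 / 2) ^ (n + 1) < r
      · have hrR : r ∈ R n := by
          by_contra h
          exact hrB (mem_iUnion.2 ⟨n, ⟨hn.le, hr1⟩, h⟩)
        calc varCap μ p ((E ∩ ball x r) ∪ D n) (ball x (2 * r))
            ≤ varCap μ p ((E ∪ {y | σ n < H n y}) ∩ ball x r) (ball x (2 * r)) := by
              refine varCap_mono ?_ Subset.rfl
              rw [union_inter_distrib_right]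
              exact union_subset_union_right _ (inter_subset_inter_left _ fun y hy => hy.2)
          _ ≤ _ := (hRr n r hrR).trans (by
              gcongr
              exact hκ n x (hM hx) r hn.le hr1)
      · have : D n = ∅ := by
          refine eq_empty_of_forall_notMem fun y hy => hn hy.1.1
        rw [this, union_empty]
        exact le_self_add
    calc varCap μ p ((K ∪ ⋃ n, shellPiece K O M (H n) (σ n) n)ᶜ ∩ ball x r) (ball x (2 * r))
        ≤ varCap μ p ((E ∩ ball x r) ∪ ⋃ n, D n) (ball x (2 * r)) := by
          refine varCap_mono (fun y hy => Or.inr ?_) Subset.rfl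
          obtain ⟨n, hn⟩ := hcov hy
          exact mem_iUnion.2 ⟨n, hn, hy.2⟩
      _ ≤ varCap μ p (E ∩ ball x r) (ball x (2 * r)) +
          ∑' n : ℕ, c * ENNReal.ofReal r ^ (p - 1) * 2⁻¹ ^ (n + 1) :=
          varCap_union_iUnion_le hp hΩ hfin hstep
      _ = _ := by rw [ENNReal.tsum_mul_left, tsum_two_inv_pow_succ, mul_one]

end Shells

/-! ### Barriers around the shell pieces -/

section Barrier

variable {μ : Measure X} {p : ℝ}

/-- The barrier of the `n`-th shell, vanishing on `F`. -/
def shellBarrier (K O F : Set X) (G : X → ℝ≥0∞) (σ : ℝ) (n : ℕ) : X → ℝ≥0∞ :=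
  (wideShell K O n \ F).indicator fun x =>
    (ENNReal.ofReal (1 - σ))⁻¹ * G x + (ENNReal.ofReal ((1 / 2) ^ (n + 1) / 2))⁻¹

lemma measurable_shellBarrier (K O : Set X) {F : Set X} (hF : IsClosed F) {G : X → ℝ≥0∞}
    (hG : Measurable G) (σ : ℝ) (n : ℕ) : Measurable (shellBarrier K O F G σ n) :=
  ((hG.const_mul _).add_const _).indicator ((isOpen_wideShell K O n).sdiff hF).measurableSet

lemma lintegral_shellBarrier_lt_top (hp : 1 ≤ p) {K O F : Set X} (hF : IsClosed F)
    (hO : μ O < ⊤) {G : X → ℝ≥0∞} (hG : Measurable G) (hGfin : ∫⁻ x, G x ^ p ∂μ < ⊤) {σ : ℝ}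
    (hσ : σ < 1) (n : ℕ) : ∫⁻ x, shellBarrier K O F G σ n x ^ p ∂μ < ⊤ := by
  have hp0 : 0 < p := by linarith
  have hW : MeasurableSet (wideShell K O n \ F) :=
    ((isOpen_wideShell K O n).sdiff hF).measurableSet
  unfold shellBarrier
  rw [lintegral_indicator_rpow hp0 hW]
  have h1 : (ENNReal.ofReal (1 - σ))⁻¹ ≠ ⊤ := by simpa using hσ
  have h2 : (ENNReal.ofReal ((1 / 2) ^ (n + 1) / 2))⁻¹ ≠ ⊤ := by
    rw [ENNReal.inv_ne_top]
    exact (ENNReal.ofReal_pos.2 (by positivity)).ne'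
  refine lintegral_add_rpow_lt_top hp (hG.const_mul _) ?_ ?_
  · exact lintegral_const_mul_rpow_lt_top hp0.le ((setLIntegral_le_lintegral _ _).trans_lt hGfin) h1
  · rw [lintegral_const, Measure.restrict_apply_univ]
    refine ENNReal.mul_lt_top (ENNReal.rpow_lt_top_of_nonneg hp0.le h2) ?_
    exact (measure_mono (sdiff_subset.trans ((wideShell_subset K O n).trans
      sdiff_subset))).trans_lt hO

lemma one_le_curveLint_shellBarrier {K O M F : Set X} {H : X → ℝ} {G : X → ℝ≥0∞}
    {σ : ℝ} (hσ : σ < 1) {n : ℕ} {γ : Curve X}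
    (hγ : edist (H (γ.toFun 0)) (H (γ.toFun γ.len)) ≤ curveLint γ G)
    (h0 : γ.toFun 0 ∈ shellPiece K O M H σ n) (h1 : H (γ.toFun γ.len) = 1)
    (hF : ∀ t ∈ Ioc 0 γ.len, γ.toFun t ∉ F) :
    1 ≤ curveLint γ (shellBarrier K O F G σ n) := by
  have hw : (0 : ℝ) < (1 / 2) ^ (n + 1) / 2 := by positivity
  have hmem : ∀ t ∈ Ioc 0 γ.len, t < (1 / 2) ^ (n + 1) / 2 →
      γ.toFun t ∈ wideShell K O n \ F := by
    intro t ht htw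
    refine ⟨mem_wideShell_of_dist_lt h0.1.1 ?_, hF t ht⟩
    have := γ.lip.dist_le_mul t ⟨ht.1.le, ht.2⟩ 0 ⟨le_rfl, γ.len_pos.le⟩
    rw [NNReal.coe_one, one_mul, Real.dist_eq, sub_zero, abs_of_pos ht.1] at this
    exact this.trans_lt htw
  have hval : ∀ t ∈ Ioc 0 γ.len, t < (1 / 2) ^ (n + 1) / 2 →
      shellBarrier K O F G σ n (γ.toFun t) = (ENNReal.ofReal (1 - σ))⁻¹ * G (γ.toFun t) +
        (ENNReal.ofReal ((1 / 2) ^ (n + 1) / 2))⁻¹ := fun t ht htw =>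
    indicator_of_mem (hmem t ht htw) _
  by_cases hlen : γ.len < (1 / 2) ^ (n + 1) / 2
  · have hσ0 : ENNReal.ofReal (1 - σ) ≠ 0 := (ENNReal.ofReal_pos.2 (by linarith)).ne'
    have hjump : ENNReal.ofReal (1 - σ) ≤ curveLint γ G := by
      refine le_trans ?_ hγ
      rw [edist_dist, h1, Real.dist_eq]
      have h2 : H (γ.toFun 0) ≤ σ := h0.2
      refine ENNReal.ofReal_le_ofReal ?_
      rw [abs_sub_comm]
      exact le_trans (by linarith) (le_abs_self _)
    calc 1 = (ENNReal.ofReal (1 - σ))⁻¹ * ENNReal.ofReal (1 - σ) :=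
          (ENNReal.inv_mul_cancel hσ0 ENNReal.ofReal_ne_top).symm
      _ ≤ (ENNReal.ofReal (1 - σ))⁻¹ * curveLint γ G := by gcongr
      _ = ∫⁻ t in Ioc 0 γ.len, (ENNReal.ofReal (1 - σ))⁻¹ * G (γ.toFun t) := by
          rw [curveLint, ← lintegral_const_mul' _ _ (ENNReal.inv_ne_top.2 hσ0),
            restrict_Ioc_eq_restrict_Icc]
      _ ≤ ∫⁻ t in Ioc 0 γ.len, shellBarrier K O F G σ n (γ.toFun t) := by
          refine setLIntegral_mono' measurableSet_Ioc fun t ht => ?_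
          rw [hval t ht (ht.2.trans_lt hlen)]
          exact le_self_add
      _ ≤ _ := lintegral_mono_set Ioc_subset_Icc_self
  · rw [not_lt] at hlen
    calc (1 : ℝ≥0∞) = ∫⁻ _ in Ioo (0 : ℝ) ((1 / 2) ^ (n + 1) / 2),
          (ENNReal.ofReal ((1 / 2) ^ (n + 1) / 2))⁻¹ := by
          rw [setLIntegral_const, Real.volume_Ioo, sub_zero,
            ENNReal.inv_mul_cancel (ENNReal.ofReal_pos.2 hw).ne' ENNReal.ofReal_ne_top]
      _ ≤ ∫⁻ t in Ioo (0 : ℝ) ((1 / 2) ^ (n + 1) / 2), shellBarrier K O F G σ n (γ.toFun t) := by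
          refine setLIntegral_mono' measurableSet_Ioo fun t ht => ?_
          rw [hval t ⟨ht.1, ht.2.le.trans hlen⟩ ht.2]
          exact le_add_self
      _ ≤ _ := lintegral_mono_set (Ioo_subset_Icc_self.trans (Icc_subset_Icc_right hlen))

lemma exists_isOpen_setLIntegral_iSup_shellBarrier_le [SecondCountableTopology X] (hp : 1 ≤ p)
    {K O F S : Set X} (hK : IsClosed K) (hO : IsOpen O) (hOfin : μ O < ⊤) {z : X} (hz : z ∉ O)
    (hF : IsClosed F) (hS : MeasurableSet S) (hSF : S ⊆ F) (hSO : S ⊆ O \ K) {G : ℕ → X → ℝ≥0∞}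
    (hG : ∀ n, Measurable (G n)) (hGfin : ∀ n, ∫⁻ x, G n x ^ p ∂μ < ⊤) {σ : ℕ → ℝ}
    (hσ : ∀ n, σ n < 1) {ε : ℝ≥0∞} (hε : ε ≠ 0) :
    ∃ O', IsOpen O' ∧ S ⊆ O' ∧ O' ⊆ O ∧
      ∫⁻ x in O', (⨆ n, shellBarrier K O F (G n) (σ n) n x) ^ p ∂μ ≤ ε := by
  have hp0 : 0 < p := by linarith
  set b : X → ℝ≥0∞ := fun x => ⨆ n, shellBarrier K O F (G n) (σ n) n x with hb
  have hbm : Measurable b := Measurable.iSup fun n => measurable_shellBarrier K O hF (hG n) _ n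
  have hbp : Measurable fun x => b x ^ p := hbm.pow_const p
  set W : ℕ → Set X := fun n => {y | (1 / 2) ^ (n + 1) / 2 < shellDist K O y} with hWdef
  have hW : ∀ n, IsOpen (W n) := fun n =>
    isOpen_lt continuous_const (lipschitzWith_shellDist K O).continuous
  have hWO : ∀ n, W n ⊆ O \ K := fun n y hy => mem_of_shellDist_pos (lt_trans (by positivity) hy)
  have hcov : O \ K ⊆ ⋃ n, W n := by
    intro y hy
    have hδ := shellDist_pos hK hO hz hy
    obtain ⟨N, hN⟩ := exists_pow_lt_of_lt_one hδ (show (1 / 2 : ℝ) < 1 by norm_num)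
    refine mem_iUnion.2 ⟨N, ?_⟩
    change (1 / 2) ^ (N + 1) / 2 < shellDist K O y
    have : (0 : ℝ) < (1 / 2) ^ N := by positivity
    rw [pow_succ]
    linarith
  have hfin : ∀ n, ∫⁻ x in W n, b x ^ p ∂μ < ⊤ := by
    intro n
    have hle : ∀ x ∈ W n, b x ^ p ≤
        ∑ m ∈ Finset.range (n + 3), shellBarrier K O F (G m) (σ m) m x ^ p := by
      intro x hx
      have hx' : (1 / 2) ^ (n + 1) / 2 < shellDist K O x := hx
      refine (iSup_rpow_le_tsum hp0 _).trans (tsum_eq_sum fun m hm => ?_).le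
      rw [shellBarrier, indicator_of_notMem, ENNReal.zero_rpow_of_pos hp0]
      rintro ⟨⟨-, h2⟩, -⟩
      rw [Finset.mem_range, not_lt] at hm
      have h3 : (1 / 2 : ℝ) ^ m ≤ (1 / 2) ^ (n + 3) :=
        pow_le_pow_of_le_one (by norm_num) (by norm_num) hm
      rw [pow_succ] at h2
      rw [pow_succ] at hx'
      rw [pow_add] at h3
      linarith
    calc ∫⁻ x in W n, b x ^ p ∂μ
        ≤ ∫⁻ x in W n, ∑ m ∈ Finset.range (n + 3), shellBarrier K O F (G m) (σ m) m x ^ p ∂μ :=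
          setLIntegral_mono' (hW n).measurableSet hle
      _ = ∑ m ∈ Finset.range (n + 3), ∫⁻ x in W n, shellBarrier K O F (G m) (σ m) m x ^ p ∂μ :=
          lintegral_finsetSum _ fun m _ =>
            (measurable_shellBarrier K O hF (hG m) _ m).pow_const p
      _ < ⊤ := ENNReal.sum_lt_top.2 fun m _ => (setLIntegral_le_lintegral _ _).trans_lt
          (lintegral_shellBarrier_lt_top hp hF hOfin (hG m) (hGfin m) (hσ m) m)
  have key : ∀ n, ∃ Q, IsOpen Q ∧ S ⊆ Q ∧ ∫⁻ x in Q ∩ W n, b x ^ p ∂μ ≤ ε * 2⁻¹ ^ (n + 1) := by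
    intro n
    set ν := (μ.restrict (W n)).withDensity fun x => b x ^ p with hν
    have : IsFiniteMeasure ν := isFiniteMeasure_withDensity (hfin n).ne
    have hνS : ν S = 0 := by
      rw [hν, withDensity_apply _ hS, setLIntegral_congr_fun hS (g := fun _ => 0), lintegral_zero]
      intro x hx
      have : b x = 0 := by
        simp only [hb, ENNReal.iSup_eq_zero]
        exact fun m => indicator_of_notMem (fun h => h.2 (hSF hx)) _
      simp only [this, ENNReal.zero_rpow_of_pos hp0]
    obtain ⟨Q, hSQ, hQ, hQν⟩ := S.exists_isOpen_lt_of_lt (ε * 2⁻¹ ^ (n + 1))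
      (show ν S < ε * 2⁻¹ ^ (n + 1) by
        rw [hνS]
        exact pos_iff_ne_zero.2 (mul_ne_zero hε (pow_ne_zero _ (by simp))))
    refine ⟨Q, hQ, hSQ, le_trans (le_of_eq ?_) hQν.le⟩
    rw [hν, withDensity_apply _ hQ.measurableSet, Measure.restrict_restrict hQ.measurableSet]
  choose Q hQ hSQ hQb using key
  refine ⟨⋃ n, Q n ∩ W n, isOpen_iUnion fun n => (hQ n).inter (hW n), fun x hx => ?_,
    iUnion_subset fun n => inter_subset_right.trans ((hWO n).trans sdiff_subset), ?_⟩
  · obtain ⟨n, hn⟩ := mem_iUnion.1 (hcov (hSO hx))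
    exact mem_iUnion.2 ⟨n, hSQ n hx, hn⟩
  · calc ∫⁻ x in ⋃ n, Q n ∩ W n, b x ^ p ∂μ ≤ ∑' n, ∫⁻ x in Q n ∩ W n, b x ^ p ∂μ :=
          lintegral_iUnion_le _ _
      _ ≤ ∑' n, ε * 2⁻¹ ^ (n + 1) := ENNReal.tsum_le_tsum hQb
      _ = ε := by rw [ENNReal.tsum_mul_left, tsum_two_inv_pow_succ, mul_one]

/-- One step of the construction of a finely open set around a compact set: the compact set `K`
is enlarged by a set `M'`, such that `V` remains a fine neighborhood of the points of `M`, and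
curves leaving `V` from the enlarged set pay a price. -/
lemma exists_barrier [ProperSpace X] [SFinite μ] (hp : 1 < p) (hd : DoublingMeasure μ)
    (hPI : PoincareInequality μ p) {V K M O : Set X} (hK : IsCompact K) {z : X}
    {D : ℝ} (hD : 0 < D) (hKz : ∀ x ∈ K, D ≤ dist z x) (hMK : M ⊆ K) (hMO : M ⊆ O)
    (hO : IsOpen O) (hOb : Bornology.IsBounded O) (hOz : ∀ x ∈ O, D ≤ dist z x) :
    ∃ (M' : Set X) (b : X → ℝ≥0∞), M' ⊆ V ∧ M' ⊆ O ∧ IsCompact (K ∪ M') ∧ Measurable b ∧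
      (∀ x ∈ K ∪ M', b x = 0) ∧
      (∀ x ∈ M, Thin μ p Vᶜ x → Thin μ p (K ∪ M')ᶜ x) ∧
      (∀ ε : ℝ≥0∞, ε ≠ 0 → ∃ O', IsOpen O' ∧ M' ⊆ O' ∧ O' ⊆ O ∧ ∫⁻ x in O', b x ^ p ∂μ ≤ ε) ∧
      ∀ᶠ γ in curveFilter μ p (by linarith), γ.toFun 0 ∈ M' → γ.toFun γ.len ∉ V →
        (∀ t ∈ Ioc 0 γ.len, γ.toFun t ∉ K ∪ M') → 1 ≤ curveLint γ b := by
  have hp0 : 0 < p := by linarith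
  have hzO : z ∉ O := fun h => by
    have := hOz z h
    rw [dist_self] at this
    linarith
  have hκ : ∀ n : ℕ, ∃ κ : ℝ≥0∞, κ ≠ 0 ∧ κ ≠ ⊤ ∧ ∀ x ∈ K, ∀ r, (1 / 2) ^ (n + 1) ≤ r →
      r ≤ D / 4 → κ ≤ varCap μ p (ball x r) (ball x (2 * r)) := by
    intro n
    by_cases hn : (1 / 2) ^ (n + 1) ≤ D / 4
    · exact exists_pos_le_varCap_ball hp.le hd hPI hK (by positivity) hn hKz
    · exact ⟨1, one_ne_zero, ENNReal.one_ne_top, fun x _ r h1 h2 => absurd (h1.trans h2) hn⟩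
  choose κ hκ0 hκtop hκle using hκ
  have hdpos : ∀ n : ℕ, ENNReal.ofReal ((1 / 2) ^ (n + 1)) ≠ 0 := fun n =>
    (ENNReal.ofReal_pos.2 (by positivity)).ne'
  have h2pow : ∀ n : ℕ, (2⁻¹ : ℝ≥0∞) ^ (n + 1) ≠ 0 := fun n => pow_ne_zero _ (by simp)
  have hlay := fun n : ℕ => exists_layer (μ := μ) hp.le hd Vᶜ hK
    (a := (1 / 2) ^ (n + 1)) (b := D / 4) (by positivity)
    (e := κ n * ENNReal.ofReal ((1 / 2) ^ (n + 1)) ^ (p - 1) * 2⁻¹ ^ (n + 1))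
    (β := ENNReal.ofReal ((1 / 2) ^ (n + 1)) * 2⁻¹ ^ (n + 1))
    (mul_ne_zero (mul_ne_zero (hκ0 n) (ENNReal.rpow_pos (pos_iff_ne_zero.2 (hdpos n))
      ENNReal.ofReal_ne_top).ne') (h2pow n))
    (ENNReal.mul_ne_top (ENNReal.mul_ne_top (hκtop n) (ENNReal.rpow_ne_top_of_nonneg
      (by linarith) ENNReal.ofReal_ne_top)) (ENNReal.pow_ne_top (by simp)))
    (mul_ne_zero (hdpos n) (h2pow n))
  choose H G σ hL hσ0 hσ1 hR using hlay
  set M' : Set X := ⋃ n, shellPiece K O M (H n) (σ n) n with hM'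
  have hcl : IsClosed (K ∪ M') :=
    isClosed_union_iUnion_shellPiece hK.isClosed hO hMK hzO (fun n => (hL n).lsc) σ
  have hM'O : M' ⊆ O \ K := iUnion_subset fun n => shellPiece_subset K O M (H n) (σ n) n
  have hM'V : M' ⊆ V := by
    refine iUnion_subset fun n x hx => not_not.1 fun hxV => ?_
    have h1 : H n x ≤ σ n := hx.2
    rw [(hL n).eq_one x hxV] at h1
    linarith [hσ1 n]
  refine ⟨M', fun x => ⨆ n, shellBarrier K O (K ∪ M') (G n) (σ n) n x, hM'V,
    hM'O.trans sdiff_subset, ?_, ?_, ?_, ?_, ?_, ?_⟩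
  · exact Metric.isCompact_of_isClosed_isBounded hcl
      (hK.isBounded.union (hOb.subset (hM'O.trans sdiff_subset)))
  · exact Measurable.iSup fun n => measurable_shellBarrier K O hcl (hL n).grad_meas _ n
  · intro x hx
    simp only [ENNReal.iSup_eq_zero]
    exact fun m => indicator_of_notMem (fun h => h.2 hx) _
  · intro x hx hthin
    exact thin_compl_union_shellPiece hp hd hK.isClosed hO hMK hMO hzO (by positivity) hκ0 hκle
      hR hx hthin
  · intro ε hε
    have hOfin : μ O < ⊤ := by
      rcases O.eq_empty_or_nonempty with rfl | ⟨y, hy⟩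
      · simp
      · obtain ⟨R, hR0, hOR⟩ := hOb.subset_ball_lt 0 y
        exact (measure_mono hOR).trans_lt (hd.1 y R hR0).2
    exact exists_isOpen_setLIntegral_iSup_shellBarrier_le hp.le hK.isClosed hO hOfin hzO hcl
      (MeasurableSet.iUnion fun n =>
        (isClosed_shellPiece K O M (hL n).lsc (σ n) n).measurableSet)
      subset_union_right hM'O (fun n => (hL n).grad_meas) (fun n => (hL n).grad_fin) hσ1 hε
  · have hUG : ∀ᶠ γ in curveFilter μ p hp0, ∀ n, edist (H n (γ.toFun 0))
        (H n (γ.toFun γ.len)) ≤ curveLint γ (G n) := by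
      refine eventually_curve_nat fun n => ?_
      have h := (isWeakUpperGradientOn_iff hp0).1 (hL n).grad
      filter_upwards [h] with γ hγ using hγ fun _ _ => mem_univ _
    filter_upwards [hUG] with γ hγ h0 hlen havoid
    obtain ⟨n, hn⟩ := mem_iUnion.1 h0
    refine (one_le_curveLint_shellBarrier (hσ1 n) (hγ n) hn ((hL n).eq_one _ hlen)
      havoid).trans (curveLint_mono γ fun x => ?_)
    exact le_iSup (fun n => shellBarrier K O (K ∪ M') (G n) (σ n) n x) n

end Barrier

/-! ### Finely open neighborhoods -/

section FineNeighborhood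

variable {μ : Measure X} {p : ℝ}

lemma exists_mem_Ioo_of_ae {P : ℝ → Prop} {L a b : ℝ} (h : ∀ᵐ t ∂volume.restrict (Icc 0 L), P t)
    (ha : 0 ≤ a) (hab : a < b) (hb : b ≤ L) : ∃ t ∈ Ioo a b, P t := by
  by_contra! hne
  rw [ae_restrict_iff' measurableSet_Icc, ae_iff] at h
  have h1 : volume (Ioo a b) = 0 := by
    refine measure_mono_null (fun t ht => ?_) h
    change ¬ (t ∈ Icc 0 L → P t)
    exact fun h2 => hne t ht (h2 ⟨ha.trans ht.1.le, ht.2.le.trans hb⟩)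
  rw [Real.volume_Ioo, ENNReal.ofReal_eq_zero] at h1
  linarith

/-- The data carried along in the inductive construction of a finely open neighborhood. -/
structure FineStage (V O₀ : Set X) where
  /-- the part of the neighborhood which is already constructed -/
  K : Set X
  /-- the part added in the last step -/
  M : Set X
  /-- an open set containing everything to be added in later steps -/
  O : Set X
  isCompact : IsCompact K
  subset_V : K ⊆ V
  subset_O₀ : K ⊆ O₀
  M_subset_K : M ⊆ K
  M_subset_O : M ⊆ O
  isOpen : IsOpen O
  O_subset : O ⊆ O₀

/-- The relation between consecutive stages, with the barrier `b` separating them. -/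
structure FineStage.Step (μ : Measure X) (p : ℝ) (hp : 0 < p) {V O₀ : Set X} (ε : ℝ≥0∞)
    (s s' : FineStage V O₀) (b : X → ℝ≥0∞) : Prop where
  K_eq : s'.K = s.K ∪ s'.M
  O_subset : s'.O ⊆ s.O
  measurable : Measurable b
  eq_zero : ∀ x ∈ s'.K, b x = 0
  thin : ∀ x ∈ s.M, Thin μ p Vᶜ x → Thin μ p s'.Kᶜ x
  lintegral_le : ∫⁻ x in s'.O, b x ^ p ∂μ ≤ ε
  barrier : ∀ᶠ γ in curveFilter μ p hp, γ.toFun 0 ∈ s'.M → γ.toFun γ.len ∉ V →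
    (∀ t ∈ Ioc 0 γ.len, γ.toFun t ∉ s'.K) → 1 ≤ curveLint γ b

lemma FineStage.exists_step [ProperSpace X] [SFinite μ] (hp : 1 < p) (hd : DoublingMeasure μ)
    (hPI : PoincareInequality μ p) {V O₀ : Set X} (hOb : Bornology.IsBounded O₀) {z : X} {D : ℝ}
    (hD : 0 < D) (hOz : ∀ x ∈ O₀, D ≤ dist z x) {ε : ℝ≥0∞} (hε : ε ≠ 0) (s : FineStage V O₀) :
    ∃ s' b, FineStage.Step μ p (by linarith) ε s s' b := by
  obtain ⟨M', b, hV, hO, hc, hb, hb0, hthin, hsmall, hbar⟩ := exists_barrier hp hd hPI (V := V)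
    s.isCompact hD (fun x hx => hOz x (s.subset_O₀ hx)) s.M_subset_K s.M_subset_O s.isOpen
    (hOb.subset s.O_subset) (fun x hx => hOz x (s.O_subset hx))
  obtain ⟨O', hO', hMO', hO'O, hint⟩ := hsmall ε hε
  exact ⟨⟨s.K ∪ M', M', O', hc, union_subset s.subset_V hV,
    union_subset s.subset_O₀ (hO.trans s.O_subset), subset_union_right, hMO', hO',
    hO'O.trans s.O_subset⟩, b, rfl, hO'O, hb, hb0, hthin, hint, hbar⟩

section Sequence

variable {V O₀ : Set X} {s : ℕ → FineStage V O₀} {b : ℕ → X → ℝ≥0∞} {ε : ℕ → ℝ≥0∞} {hp : 0 < p}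

lemma FineStage.monotone_K (h : ∀ m, FineStage.Step μ p hp (ε m) (s m) (s (m + 1)) (b m)) :
    Monotone fun m => (s m).K :=
  monotone_nat_of_le_succ fun m => by
    rw [(h m).K_eq]
    exact subset_union_left

lemma FineStage.K_subset (h : ∀ m, FineStage.Step μ p hp (ε m) (s m) (s (m + 1)) (b m)) (i j : ℕ) :
    (s j).K ⊆ (s i).K ∪ (s i).O := by
  have hO : Antitone fun m => (s m).O := antitone_nat_of_succ_le fun m => (h m).O_subset
  induction j with
  | zero => exact (FineStage.monotone_K h (Nat.zero_le i)).trans subset_union_left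
  | succ j ih =>
    rw [(h j).K_eq]
    refine union_subset ih ?_
    rcases le_total i (j + 1) with hij | hij
    · exact (s (j + 1)).M_subset_O.trans ((hO hij).trans subset_union_right)
    · exact (s (j + 1)).M_subset_K.trans ((FineStage.monotone_K h hij).trans subset_union_left)

lemma FineStage.exists_mem_M (h : ∀ m, FineStage.Step μ p hp (ε m) (s m) (s (m + 1)) (b m))
    (h0 : (s 0).K ⊆ (s 0).M) {x : X} {j : ℕ} (hx : x ∈ (s j).K) : ∃ i, x ∈ (s i).M := by
  induction j with
  | zero => exact ⟨0, h0 hx⟩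
  | succ j ih =>
    rw [(h j).K_eq] at hx
    exact hx.elim ih fun hx => ⟨j + 1, hx⟩

lemma FineStage.finelyOpen_iUnion (hp1 : 1 < p) (hV : FinelyOpen μ p V)
    (h : ∀ m, FineStage.Step μ p hp (ε m) (s m) (s (m + 1)) (b m)) (h0 : (s 0).K ⊆ (s 0).M) :
    FinelyOpen μ p (⋃ m, (s m).K) := by
  intro x hx
  obtain ⟨j, hj⟩ := mem_iUnion.1 hx
  obtain ⟨i, hi⟩ := FineStage.exists_mem_M h h0 hj
  exact ((h i).thin x hi (hV x ((s i).subset_V ((s i).M_subset_K hi)))).mono hp1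
    (compl_subset_compl.2 (subset_iUnion (fun m => (s m).K) (i + 1)))

lemma FineStage.setLIntegral_iSup_le (h : ∀ m, FineStage.Step μ p hp (ε m) (s m) (s (m + 1)) (b m)) :
    ∫⁻ x in ⋃ m, (s m).K, (⨆ m : ℕ, ((m + 1 : ℕ) : ℝ≥0∞) * b m x) ^ p ∂μ ≤
      ∑' m : ℕ, ((m + 1 : ℕ) : ℝ≥0∞) ^ p * ε m := by
  have hVm : MeasurableSet (⋃ m, (s m).K) :=
    MeasurableSet.iUnion fun m => (s m).isCompact.isClosed.measurableSet
  have hbm : ∀ m, Measurable fun x => b m x ^ p := fun m => (h m).measurable.pow_const p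
  calc ∫⁻ x in ⋃ m, (s m).K, (⨆ m : ℕ, ((m + 1 : ℕ) : ℝ≥0∞) * b m x) ^ p ∂μ
      ≤ ∫⁻ x in ⋃ m, (s m).K, ∑' m : ℕ, ((m + 1 : ℕ) : ℝ≥0∞) ^ p * b m x ^ p ∂μ := by
        refine lintegral_mono fun x => (iSup_rpow_le_tsum hp _).trans (le_of_eq ?_)
        exact tsum_congr fun m => ENNReal.mul_rpow_of_nonneg _ _ hp.le
    _ = ∑' m : ℕ, ((m + 1 : ℕ) : ℝ≥0∞) ^ p * ∫⁻ x in ⋃ m, (s m).K, b m x ^ p ∂μ := by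
        rw [lintegral_tsum fun m => ((hbm m).const_mul _).aemeasurable]
        exact tsum_congr fun m => lintegral_const_mul _ (hbm m)
    _ ≤ _ := by
        refine ENNReal.tsum_le_tsum fun m => ?_
        gcongr
        refine le_trans ?_ (h m).lintegral_le
        rw [← lintegral_indicator hVm, ← lintegral_indicator (s (m + 1)).isOpen.measurableSet]
        refine lintegral_mono fun x => ?_
        by_cases hxV : x ∈ ⋃ m, (s m).K
        · rw [indicator_of_mem hxV]
          obtain ⟨j, hj⟩ := mem_iUnion.1 hxV
          rcases FineStage.K_subset h (m + 1) j hj with hx | hx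
          · rw [(h m).eq_zero x hx, ENNReal.zero_rpow_of_pos hp]
            exact zero_le
          · rw [indicator_of_mem hx]
        · rw [indicator_of_notMem hxV]
          exact zero_le

open Classical in
/-- A curve of finite length with respect to the barriers cannot leave `V`. -/
lemma FineStage.mem_of_curveLint_lt_top
    (h : ∀ m, FineStage.Step μ p hp (ε m) (s m) (s (m + 1)) (b m)) {γ : Curve X}
    (hbar : ∀ m, ∀ (r t : ℝ) (hr : 0 ≤ r) (hrt : r < t) (ht : t ≤ γ.len),
      γ.toFun r ∈ (s (m + 1)).M → γ.toFun t ∉ V → (∀ t' ∈ Ioc r t, γ.toFun t' ∉ (s (m + 1)).K) →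
      1 ≤ curveLint (γ.sub r t hr hrt ht) (b m))
    (hγ : curveLint γ ((⋃ m, (s m).K).piecewise
      (fun x => ⨆ m : ℕ, ((m + 1 : ℕ) : ℝ≥0∞) * b m x) fun _ => ⊤) < ⊤) :
    γ.toFun γ.len ∈ V := by
  by_contra hlen
  have hVm : MeasurableSet (⋃ m, (s m).K) :=
    MeasurableSet.iUnion fun m => (s m).isCompact.isClosed.measurableSet
  have hlm : Measurable fun x => ⨆ m : ℕ, ((m + 1 : ℕ) : ℝ≥0∞) * b m x :=
    Measurable.iSup fun m => (h m).measurable.const_mul _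
  have hae : ∀ᵐ t ∂volume.restrict (Icc 0 γ.len), γ.toFun t ∈ ⋃ m, (s m).K := by
    filter_upwards [ae_lt_top' (γ.aemeasurable_comp (hlm.piecewise hVm measurable_const))
      hγ.ne] with t ht
    by_contra hn
    rw [piecewise_eq_of_notMem _ _ _ hn] at ht
    exact lt_irrefl _ ht
  have hmono := FineStage.monotone_K h
  have hT : ∀ m, (∃ t ∈ Icc 0 γ.len, γ.toFun t ∈ (s m).K) →
      ∃ t, IsGreatest {t | t ∈ Icc 0 γ.len ∧ γ.toFun t ∈ (s m).K} t := fun m ⟨t, ht, htm⟩ =>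
    ((isCompact_Icc.of_isClosed_subset (γ.continuousOn.preimage_isClosed_of_isClosed isClosed_Icc
      (s m).isCompact.isClosed) inter_subset_left)).exists_isGreatest ⟨t, ht, htm⟩
  obtain ⟨N, hN⟩ := ENNReal.exists_nat_gt hγ.ne
  obtain ⟨t₀, ht₀, ht₀V⟩ := exists_mem_Ioo_of_ae hae le_rfl γ.len_pos le_rfl
  obtain ⟨m₀, hm₀⟩ := mem_iUnion.1 ht₀V
  obtain ⟨t₁, ⟨ht₁, ht₁K⟩, ht₁max⟩ := hT (max m₀ N)
    ⟨t₀, Ioo_subset_Icc_self ht₀, hmono (le_max_left _ _) hm₀⟩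
  have hlt : ∀ {t m}, t ∈ Icc 0 γ.len → γ.toFun t ∈ (s m).K → t < γ.len := fun {t m} ht htK =>
    ht.2.lt_of_ne fun he => hlen ((s m).subset_V (he ▸ htK))
  have hex : ∃ j, ∃ t ∈ Ioc t₁ γ.len, γ.toFun t ∈ (s j).K := by
    obtain ⟨t, ht, htV⟩ := exists_mem_Ioo_of_ae hae ht₁.1 (hlt ht₁ ht₁K) le_rfl
    obtain ⟨j, hj⟩ := mem_iUnion.1 htV
    exact ⟨j, t, Ioo_subset_Ioc_self ht, hj⟩
  obtain ⟨t, ht, htK⟩ := Nat.find_spec hex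
  have hmj : max m₀ N < Nat.find hex := not_le.1 fun hle =>
    not_lt.2 (ht₁max ⟨⟨ht₁.1.trans ht.1.le, ht.2⟩, hmono hle htK⟩) ht.1
  obtain ⟨i, hi⟩ := Nat.exists_eq_succ_of_ne_zero (Nat.ne_of_gt (Nat.zero_lt_of_lt hmj))
  rw [Nat.succ_eq_add_one] at hi
  rw [hi] at htK hmj
  obtain ⟨t', ⟨ht', ht'K⟩, ht'max⟩ := hT (i + 1) ⟨t, ⟨ht₁.1.trans ht.1.le, ht.2⟩, htK⟩
  have htt' : t ≤ t' := ht'max ⟨⟨ht₁.1.trans ht.1.le, ht.2⟩, htK⟩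
  have ht'M : γ.toFun t' ∈ (s (i + 1)).M := by
    have h1 := ht'K
    rw [(h i).K_eq] at h1
    refine h1.resolve_left fun h2 => ?_
    exact Nat.find_min hex (by omega : i < Nat.find hex) ⟨t', ⟨ht.1.trans_le htt', ht'.2⟩, h2⟩
  have hbar' := hbar i t' γ.len ht'.1 (hlt ht' ht'K) le_rfl ht'M hlen fun r hr hrK =>
    not_lt.2 (ht'max ⟨⟨ht'.1.trans hr.1.le, hr.2⟩, hrK⟩) hr.1
  have hNi : (N : ℝ≥0∞) ≤ ((i + 1 : ℕ) : ℝ≥0∞) := by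
    exact_mod_cast (le_max_right m₀ N).trans hmj.le
  refine (hN.trans_le (hNi.trans ?_)).false
  calc ((i + 1 : ℕ) : ℝ≥0∞) = ((i + 1 : ℕ) : ℝ≥0∞) * 1 := (mul_one _).symm
    _ ≤ ((i + 1 : ℕ) : ℝ≥0∞) * curveLint γ (b i) := by
        gcongr
        exact hbar'.trans (curveLint_sub_le γ _ _ _ _)
    _ = curveLint γ fun x => ((i + 1 : ℕ) : ℝ≥0∞) * b i x :=
        (curveLint_const_mul γ (h i).measurable _).symm
    _ ≤ _ := by
        refine curveLint_mono γ fun x => ?_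
        by_cases hx : x ∈ ⋃ m, (s m).K
        · rw [piecewise_eq_of_mem _ _ _ hx]
          exact le_iSup (fun m : ℕ => ((m + 1 : ℕ) : ℝ≥0∞) * b m x) i
        · rw [piecewise_eq_of_notMem _ _ _ hx]
          exact le_top

end Sequence

open Classical in
/-- Any compact subset of a finely open set `V` has a finely open neighborhood `W` in `V`, such
that almost no curve of finite `ρ`-length in `W` leaves `V`. -/
lemma exists_finelyOpen_between [ProperSpace X] [SFinite μ] (hp : 1 < p) (hd : DoublingMeasure μ)
    (hPI : PoincareInequality μ p) {V K : Set X} (hV : FinelyOpen μ p V) (hK : IsCompact K)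
    (hKV : K ⊆ V) {z : X} {D : ℝ} (hD : 0 < D) (hKz : ∀ x ∈ K, D ≤ dist z x) :
    ∃ (W : Set X) (ρ : X → ℝ≥0∞), K ⊆ W ∧ W ⊆ V ∧ MeasurableSet W ∧ FinelyOpen μ p W ∧
      Measurable ρ ∧ ∫⁻ x in W, ρ x ^ p ∂μ < ⊤ ∧
      ∀ᶠ γ in curveFilter μ p (by linarith), curveLint γ (W.piecewise ρ fun _ => ⊤) < ⊤ →
        γ.InSet V := by
  have hp0 : 0 < p := by linarith
  set O₀ := thickening (D / 2) K with hO₀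
  have hO₀z : ∀ x ∈ O₀, D / 2 ≤ dist z x := by
    intro x hx
    obtain ⟨y, hy, hxy⟩ := mem_thickening_iff.1 hx
    have h1 := hKz y hy
    have h2 := dist_triangle z x y
    linarith
  have hKO : K ⊆ O₀ := self_subset_thickening (by positivity) K
  set ε : ℕ → ℝ≥0∞ := fun m => (((m + 1 : ℕ) : ℝ≥0∞) ^ p)⁻¹ * 2⁻¹ ^ (m + 1) with hε
  have hpow : ∀ m : ℕ, ((m + 1 : ℕ) : ℝ≥0∞) ^ p ≠ ⊤ := fun m =>
    ENNReal.rpow_ne_top_of_nonneg hp0.le (ENNReal.natCast_ne_top _)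
  have hpow0 : ∀ m : ℕ, ((m + 1 : ℕ) : ℝ≥0∞) ^ p ≠ 0 := fun m =>
    (ENNReal.rpow_pos (by simp) (ENNReal.natCast_ne_top _)).ne'
  have hstep := fun (m : ℕ) (s : FineStage V O₀) =>
    FineStage.exists_step (μ := μ) hp hd hPI hK.isBounded.thickening (half_pos hD) hO₀z
      (ε := ε m) (mul_ne_zero (ENNReal.inv_ne_zero.2 (hpow m)) (pow_ne_zero _ (by simp))) s
  choose next bar hnext using hstep
  set s₀ : FineStage V O₀ :=
    ⟨K, K, O₀, hK, hKV, hKO, Subset.rfl, hKO, isOpen_thickening, Subset.rfl⟩ with hs₀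
  set s : ℕ → FineStage V O₀ := fun m => Nat.rec s₀ next m with hs
  have h : ∀ m, FineStage.Step μ p hp0 (ε m) (s m) (s (m + 1)) (bar m (s m)) := fun m =>
    hnext m (s m)
  refine ⟨⋃ m, (s m).K, fun x => ⨆ m : ℕ, ((m + 1 : ℕ) : ℝ≥0∞) * bar m (s m) x,
    subset_iUnion (fun m => (s m).K) 0, iUnion_subset fun m => (s m).subset_V,
    MeasurableSet.iUnion fun m => (s m).isCompact.isClosed.measurableSet,
    FineStage.finelyOpen_iUnion hp hV h Subset.rfl,
    Measurable.iSup fun m => (h m).measurable.const_mul _, ?_, ?_⟩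
  · refine (FineStage.setLIntegral_iSup_le h).trans_lt ?_
    have : ∀ m : ℕ, ((m + 1 : ℕ) : ℝ≥0∞) ^ p * ε m = 2⁻¹ ^ (m + 1) := fun m => by
      rw [hε, ← mul_assoc, ENNReal.mul_inv_cancel (hpow0 m) (hpow m), one_mul]
    rw [tsum_congr this, tsum_two_inv_pow_succ]
    exact ENNReal.one_lt_top
  · have hend : ∀ᶠ γ in curveFilter μ p hp0, curveLint γ ((⋃ m, (s m).K).piecewise
        (fun x => ⨆ m : ℕ, ((m + 1 : ℕ) : ℝ≥0∞) * bar m (s m) x) fun _ => ⊤) < ⊤ →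
        γ.toFun γ.len ∈ V := by
      have h1 := eventually_curve_nat fun m => eventually_curve_sub (h m).barrier
      filter_upwards [h1] with γ hγ hfin
      refine FineStage.mem_of_curveLint_lt_top h (fun m r t hr hrt ht hM hVt hav => ?_) hfin
      refine hγ m r t hr hrt ht ?_ ?_ ?_
      · change γ.toFun (r + 0) ∈ _
        rwa [add_zero]
      · change γ.toFun (r + (t - r)) ∉ _
        rwa [add_sub_cancel]
      · intro t' ht'
        have ht'2 : t' ≤ t - r := ht'.2
        exact hav (r + t') ⟨by linarith [ht'.1], by linarith⟩
    filter_upwards [eventually_curve_sub hend, hend, eventually_curve_reverse hp0 hend]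
      with γ h1 h2 h3 hfin t ht
    rcases ht.1.eq_or_lt with rfl | ht0
    · rw [curveLint_reverse] at h3
      have := h3 hfin
      change γ.toFun (γ.len - γ.len) ∈ V at this
      rwa [sub_self] at this
    · have := h1 0 t le_rfl ht0 ht.2 ((curveLint_sub_le γ _ _ _ _).trans_lt hfin)
      change γ.toFun (0 + (t - 0)) ∈ V at this
      rwa [zero_add, sub_zero] at this

end FineNeighborhood

section Truncation

variable {μ : Measure X} {p : ℝ}

lemma eventually_tsum_curveLint_lt_top (hp : 1 ≤ p) {D : ℕ → X → ℝ≥0∞}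
    (hD : ∀ n, Measurable (D n)) (h : ∀ n, ∫⁻ x, D n x ^ p ∂μ ≤ (2⁻¹ ^ n) ^ p) :
    ∀ᶠ γ in curveFilter μ p (by linarith), ∑' n, curveLint γ (D n) < ⊤ := by
  have hp0 : 0 < p := by linarith
  have hfin : ∫⁻ x, (∑' n, D n x) ^ p ∂μ < ⊤ := by
    have h1 := lintegral_tsum_rpow_le (ν := μ) hp hD
    have h2 : ∑' n, (∫⁻ x, D n x ^ p ∂μ) ^ (1 / p) ≤ 2 := by
      refine (ENNReal.tsum_le_tsum fun n => ?_).trans_eq (ENNReal.tsum_geometric_two)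
      rw [one_div]
      exact (ENNReal.rpow_inv_le_iff hp0).2 (h n)
    have h3 : (∫⁻ x, (∑' n, D n x) ^ p ∂μ) ^ (1 / p) < ⊤ :=
      (h1.trans h2).trans_lt (by simp)
    rwa [one_div, ENNReal.rpow_lt_top_iff_of_pos (inv_pos.2 hp0)] at h3
  filter_upwards [eventually_curveLint_lt_top (hp := hp0) (Measurable.tsum hD) hfin]
    with γ hγ
  rw [curveLint, lintegral_tsum fun n => γ.aemeasurable_comp (hD n)] at hγ
  exact hγ

/-- Almost every curve avoids a set of zero capacity. -/
lemma eventually_forall_notMem_of_sobolevCap_eq_zero [SFinite μ] (hp : 1 ≤ p) {N : Set X}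
    (hN : sobolevCap μ p N = 0) :
    ∀ᶠ γ in curveFilter μ p (by linarith), γ.InSet Nᶜ := by
  have hp0 : 0 < p := by linarith
  have hex : ∀ n : ℕ, ∃ (f : X → ℝ) (g : X → ℝ≥0∞), Measurable f ∧ (∀ x ∈ N, 1 ≤ f x) ∧
      Measurable g ∧ IsWeakUpperGradientOn μ p f g univ ∧
      ∫⁻ x, ENNReal.ofReal |f x| ^ p ∂μ ≤ (2⁻¹ ^ n) ^ p ∧
      ∫⁻ x, g x ^ p ∂μ ≤ (2⁻¹ ^ n) ^ p := by
    intro n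
    have hpos : (0 : ℝ≥0∞) < (2⁻¹ ^ n) ^ p :=
      ENNReal.rpow_pos (ENNReal.pow_pos (by simp) n) (ENNReal.pow_lt_top (by simp)).ne
    rw [← hN] at hpos
    obtain ⟨f, hf⟩ := iInf_lt_iff.1 hpos
    obtain ⟨hfm, hf⟩ := iInf_lt_iff.1 hf
    obtain ⟨hf1, hf⟩ := iInf_lt_iff.1 hf
    have h2 := (le_add_self).trans_lt hf
    obtain ⟨g, hg⟩ := iInf_lt_iff.1 h2
    obtain ⟨hgm, hg⟩ := iInf_lt_iff.1 hg
    obtain ⟨hgw, hg⟩ := iInf_lt_iff.1 hg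
    have h3 := (le_self_add).trans_lt hf
    rw [Measure.restrict_univ] at h3 hg
    exact ⟨f, g, hfm.1, hf1, hgm, hgw, h3.le, hg.le⟩
  choose f g hfm hf1 hgm hgw hfe hge using hex
  have hDm : ∀ n, Measurable fun x => ENNReal.ofReal |f n x| := fun n =>
    (measurable_abs.comp (hfm n)).ennreal_ofReal
  filter_upwards [eventually_tsum_curveLint_lt_top hp hDm hfe,
    eventually_tsum_curveLint_lt_top hp hgm hge,
    eventually_curve_nat fun n => (hgw n).eventually_ugAlong hp0] with γ h1 h2 h3 t ht htN
  have hae : ∀ᵐ r ∂volume.restrict (Icc 0 γ.len),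
      ∑' n, ENNReal.ofReal |f n (γ.toFun r)| < ⊤ := by
    refine ae_lt_top' (AEMeasurable.tsum fun n => γ.aemeasurable_comp (hDm n)) ?_
    rw [lintegral_tsum fun n => γ.aemeasurable_comp (hDm n)]
    exact h1.ne
  have hne : (ae (volume.restrict (Icc 0 γ.len))).NeBot := by
    rw [ae_neBot, Ne, Measure.restrict_eq_zero, Real.volume_Icc, sub_zero]
    simp [γ.len_pos]
  obtain ⟨r, hr, hrI⟩ := (hae.and (ae_restrict_mem measurableSet_Icc)).exists
  have hlim := (ENNReal.tendsto_atTop_zero_of_tsum_ne_top hr.ne).add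
    (ENNReal.tendsto_atTop_zero_of_tsum_ne_top h2.ne)
  rw [add_zero] at hlim
  have hge1 : ∀ n, 1 ≤ ENNReal.ofReal |f n (γ.toFun r)| + curveLint γ (g n) := by
    intro n
    have hle : edist (f n (γ.toFun t)) (f n (γ.toFun r)) ≤ curveLint γ (g n) := by
      rcases le_total t r with htr | htr
      · exact (h3 n t r ht.1 htr hrI.2 fun _ _ => mem_univ _).trans
          (lintegral_mono_set (Icc_subset_Icc ht.1 hrI.2))
      · rw [edist_comm]
        exact (h3 n r t hrI.1 htr ht.2 fun _ _ => mem_univ _).trans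
          (lintegral_mono_set (Icc_subset_Icc hrI.1 ht.2))
    have h1 : (1 : ℝ≥0∞) ≤ edist (f n (γ.toFun t)) 0 := by
      rw [edist_dist, Real.dist_eq, sub_zero, ← ENNReal.ofReal_one]
      exact ENNReal.ofReal_le_ofReal ((hf1 n _ htN).trans (le_abs_self _))
    refine h1.trans ((edist_triangle _ (f n (γ.toFun r)) _).trans ?_)
    rw [add_comm]
    refine add_le_add ?_ hle
    rw [edist_dist, Real.dist_eq, sub_zero]
  exact absurd (ge_of_tendsto' hlim hge1) (by simp)

/-- Let `0 ≤ y ≤ z`, where `z` is absolutely continuous on almost every curve. A weak upper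
gradient of `y` on `{z > 0}` is, extended by zero, a global weak upper gradient. -/
lemma isWeakUpperGradientOn_indicator [SFinite μ] (hp : 0 < p) {y z : X → ℝ} {G : X → ℝ≥0∞}
    (hz : ∀ᶠ γ in curveFilter μ p hp, γ.ACAlong z)
    (hy : ∀ x, 0 ≤ y x) (hyz : ∀ x, y x ≤ z x)
    (hG : IsWeakUpperGradientOn μ p y G {x | 0 < z x}) :
    IsWeakUpperGradientOn μ p y ({x | 0 < z x}.indicator G) univ := by
  have key : ∀ᶠ γ in curveFilter μ p hp, (∃ t ∈ Icc 0 γ.len, z (γ.toFun t) ≤ 0) →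
      ENNReal.ofReal (y (γ.toFun 0)) ≤ curveLint γ ({x | 0 < z x}.indicator G) := by
    filter_upwards [hz, hG.eventually_ugAlong hp] with γ h1 h2 ⟨t₀, ht₀, hzt₀⟩
    have hc : ContinuousOn (fun t => z (γ.toFun t)) (Icc 0 γ.len) := h1.continuousOn
    set S : Set ℝ := {t ∈ Icc 0 γ.len | z (γ.toFun t) ≤ 0} with hS
    have hScl : IsClosed S := by
      have := hc.preimage_isClosed_of_isClosed isClosed_Icc (isClosed_Iic (a := (0 : ℝ)))
      exact this
    have hSne : S.Nonempty := ⟨t₀, ht₀, hzt₀⟩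
    have hSbdd : BddBelow S := ⟨0, fun t ht => ht.1.1⟩
    obtain ⟨hsI, hsz⟩ : sInf S ∈ S := hScl.csInf_mem hSne hSbdd
    set s := sInf S
    have hlt : ∀ r, 0 ≤ r → r < s → 0 < z (γ.toFun r) := by
      intro r hr0 hrs
      by_contra hcon
      exact absurd (csInf_le hSbdd (⟨⟨hr0, (hrs.le.trans hsI.2)⟩, not_lt.1 hcon⟩ : r ∈ S))
        (not_le.2 hrs)
    have hys : y (γ.toFun s) = 0 := le_antisymm ((hyz _).trans hsz) (hy _)
    rcases hsI.1.eq_or_lt with h0 | h0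
    · rw [h0, hys]; simp
    have hbd : ∀ r ∈ Ioo 0 s, ENNReal.ofReal (y (γ.toFun 0)) ≤
        curveLint γ ({x | 0 < z x}.indicator G) + ENNReal.ofReal (z (γ.toFun r)) := by
      intro r hr
      have hin : ∀ q ∈ Icc 0 r, γ.toFun q ∈ {x | 0 < z x} := fun q hq =>
        hlt q hq.1 (hq.2.trans_lt hr.2)
      have h3 := h2 0 r le_rfl hr.1.le (hr.2.le.trans hsI.2) hin
      have h4 : ∫⁻ q in Icc 0 r, G (γ.toFun q) ≤
          curveLint γ ({x | 0 < z x}.indicator G) := by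
        rw [setLIntegral_congr_fun measurableSet_Icc
          (g := fun q => ({x | 0 < z x}.indicator G) (γ.toFun q))
          fun q hq => (indicator_of_mem (hin q hq) G).symm]
        exact lintegral_mono_set (Icc_subset_Icc le_rfl (hr.2.le.trans hsI.2))
      calc ENNReal.ofReal (y (γ.toFun 0)) ≤
          ENNReal.ofReal (|y (γ.toFun 0) - y (γ.toFun r)| + z (γ.toFun r)) :=
            ENNReal.ofReal_le_ofReal (by
              have := le_abs_self (y (γ.toFun 0) - y (γ.toFun r))
              have := hyz (γ.toFun r)
              linarith)
        _ = edist (y (γ.toFun 0)) (y (γ.toFun r)) + ENNReal.ofReal (z (γ.toFun r)) := by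
            rw [ENNReal.ofReal_add (abs_nonneg _) ((hy _).trans (hyz _)), edist_dist,
              Real.dist_eq]
        _ ≤ _ := add_le_add (h3.trans h4) le_rfl
    have hlim : Tendsto (fun r => curveLint γ ({x | 0 < z x}.indicator G) +
        ENNReal.ofReal (z (γ.toFun r))) (nhdsWithin s (Ioo 0 s))
        (nhds (curveLint γ ({x | 0 < z x}.indicator G) + ENNReal.ofReal (z (γ.toFun s)))) := by
      have h5 : Tendsto (fun r => z (γ.toFun r)) (nhdsWithin s (Ioo 0 s))
          (nhds (z (γ.toFun s))) :=
        (hc s hsI).mono_left (nhdsWithin_mono _ fun r hr => ⟨hr.1.le, hr.2.le.trans hsI.2⟩)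
      exact tendsto_const_nhds.add ((ENNReal.continuous_ofReal.tendsto _).comp h5)
    rw [ENNReal.ofReal_of_nonpos hsz, add_zero] at hlim
    have : (nhdsWithin s (Ioo 0 s)).NeBot := by
      rw [← mem_closure_iff_nhdsWithin_neBot, closure_Ioo h0.ne]
      exact ⟨h0.le, le_rfl⟩
    exact ge_of_tendsto hlim (eventually_nhdsWithin_of_forall hbd)
  rw [isWeakUpperGradientOn_iff hp]
  filter_upwards [key, eventually_curve_reverse hp key, hG.eventually_ugAlong hp]
    with γ h1 h2 h3 _
  by_cases hex : ∃ t ∈ Icc 0 γ.len, z (γ.toFun t) ≤ 0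
  · have h4 := h1 hex
    have h5 := h2 (by
      obtain ⟨t, ht, hzt⟩ := hex
      refine ⟨γ.len - t, ⟨by linarith [ht.2], by change γ.len - t ≤ γ.len; linarith [ht.1]⟩, ?_⟩
      change z (γ.toFun (γ.len - (γ.len - t))) ≤ 0
      have : γ.len - (γ.len - t) = t := by ring
      rwa [this])
    rw [curveLint_reverse] at h5
    have h6 : γ.reverse.toFun 0 = γ.toFun γ.len := by
      change γ.toFun (γ.len - 0) = _
      rw [sub_zero]
    rw [h6] at h5
    rw [edist_dist, Real.dist_eq]
    rcases abs_cases (y (γ.toFun 0) - y (γ.toFun γ.len)) with ⟨h, -⟩ | ⟨h, -⟩ <;> rw [h]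
    · exact (ENNReal.ofReal_le_ofReal (by linarith [hy (γ.toFun γ.len)])).trans h4
    · exact (ENNReal.ofReal_le_ofReal (by linarith [hy (γ.toFun 0)])).trans h5
  · push Not at hex
    rw [curveLint_congr (E := {x | 0 < z x}) (h := G) hex fun x hx => indicator_of_mem hx G]
    exact h3 0 γ.len le_rfl γ.len_pos.le le_rfl hex

end Truncation

section Approximation

variable {μ : Measure X} {p : ℝ}

lemma exists_measure_le_of_antitone {α : Type*} [MeasurableSpace α] {ν : Measure α}
    [IsFiniteMeasure ν] {S : ℕ → Set α} (hS : ∀ n, MeasurableSet (S n)) (hanti : Antitone S)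
    (hempty : ⋂ n, S n = ∅) {e : ℝ≥0∞} (he : e ≠ 0) : ∃ n, ν (S n) ≤ e := by
  have h := tendsto_measure_iInter_atTop (μ := ν) (fun n => (hS n).nullMeasurableSet) hanti
    ⟨0, measure_ne_top _ _⟩
  rw [hempty, measure_empty] at h
  exact (h.eventually (eventually_le_nhds (pos_iff_ne_zero.2 he))).exists

/-- Data of an approximation `θ` from below of a nonnegative function `τ`, which is supported in
a closed subset of `{τ > 0}` and, off a small set, coincides with a translate of `τ` or with a
constant. -/
structure SupportApprox (μ : Measure X) (p : ℝ) (τ : X → ℝ) (q : X → ℝ≥0∞) (η : ℝ≥0∞) where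
  θ : X → ℝ
  G : X → ℝ≥0∞
  K : Set X
  B : Set X
  T : Set X
  c : ℝ
  C : ℝ
  nonneg : ∀ x, 0 ≤ θ x
  memNp : MemNp μ p θ univ
  isClosed : IsClosed K
  pos_subset : {x | 0 < θ x} ⊆ K
  subset_pos : K ⊆ {x | 0 < τ x}
  measurable_G : Measurable G
  gradient : IsWeakUpperGradientOn μ p θ G univ
  lintegral_G : ∫⁻ x, G x ^ p ∂μ < ⊤
  measurableSet_B : MeasurableSet B
  eq_of_notMem : ∀ x ∉ T, 0 < τ x → 0 < θ x ∧ θ x = τ x - c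
  eq_or_eq : ∀ x ∉ B, 0 < θ x → θ x = τ x - c ∨ θ x = C
  lintegral_T : ∫⁻ x in T ∩ {x | 0 < τ x}, q x ∂μ ≤ η
  lintegral_B : ∫⁻ x in B, G x ^ p ∂μ ≤ η

lemma nonempty_supportApprox [ProperSpace X] [SFinite μ] (hp : 1 ≤ p) {τ : X → ℝ}
    (hτ : MemNp μ p τ univ) (hτ0 : ∀ x, 0 ≤ τ x) {Ω : Set X} (hΩ : IsOpen Ω) (hΩfin : μ Ω < ⊤)
    (hτΩ : ∀ x ∉ Ω, τ x = 0) {q : X → ℝ≥0∞} (hq : ∫⁻ x in {x | 0 < τ x}, q x ∂μ < ⊤)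
    {η : ℝ≥0∞} (hη : η ≠ 0) (hηtop : η ≠ ⊤) : Nonempty (SupportApprox μ p τ q η) := by
  have hp0 : 0 < p := by linarith
  have hτm : Measurable τ := hτ.1
  have hP : MeasurableSet {x | 0 < τ x} := measurableSet_lt measurable_const hτm
  have hPle : ∀ a : ℝ, MeasurableSet {x | 0 < τ x ∧ τ x ≤ a} := fun a =>
    hP.inter (measurableSet_le hτm measurable_const)
  set q' : X → ℝ≥0∞ := {x | 0 < τ x}.indicator q with hq'
  have hq'fin : ∫⁻ x, q' x ∂μ < ⊤ := by rwa [hq', lintegral_indicator hP]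
  have : IsFiniteMeasure (μ.withDensity q') := isFiniteMeasure_withDensity hq'fin.ne
  have hη3 : η / 3 ≠ 0 := (ENNReal.div_pos hη (by simp)).ne'
  obtain ⟨m, hm⟩ := exists_measure_le_of_antitone (ν := μ.withDensity q')
    (S := fun n : ℕ => {x | (n : ℝ) + 1 ≤ τ x})
    (fun n => measurableSet_le measurable_const hτm)
    (fun n k hnk x hx => by
      have h1 : (k : ℝ) + 1 ≤ τ x := hx
      have h2 : (n : ℝ) ≤ k := by exact_mod_cast hnk
      change (n : ℝ) + 1 ≤ τ x
      linarith)
    (by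
      refine eq_empty_of_forall_notMem fun x hx => ?_
      obtain ⟨n, hn⟩ := exists_nat_gt (τ x)
      have : (n : ℝ) + 1 ≤ τ x := mem_iInter.1 hx n
      linarith) hη3
  set M : ℝ := (m : ℝ) + 1 with hM
  have hM0 : 0 < M := by positivity
  obtain ⟨n, hn⟩ := exists_measure_le_of_antitone (ν := μ.withDensity q')
    (S := fun n : ℕ => {x | 0 < τ x ∧ τ x ≤ 1 / ((n : ℝ) + 1) * M})
    (fun n => hPle _)
    (fun n k hnk x hx => by
      refine ⟨hx.1, hx.2.trans ?_⟩
      have h2 : (n : ℝ) ≤ k := by exact_mod_cast hnk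
      gcongr)
    (by
      refine eq_empty_of_forall_notMem fun x hx => ?_
      have h0 := (mem_iInter.1 hx 0).1
      obtain ⟨n, hn⟩ := exists_nat_one_div_lt (div_pos h0 hM0)
      have h1 := (mem_iInter.1 hx n).2
      rw [lt_div_iff₀ hM0] at hn
      linarith) hη3
  set ε : ℝ := 1 / ((n : ℝ) + 1) with hε
  have hε0 : 0 < ε := by positivity
  set f : X → ℝ := fun x => 1 - min (τ x) M / M with hf
  have hfm : Measurable f := by fun_prop
  have hf0 : ∀ x, 0 ≤ f x := fun x => by
    have : min (τ x) M / M ≤ 1 := (div_le_one hM0).2 (min_le_right _ _)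
    simp only [hf]; linarith
  have hf1 : ∀ x, f x ≤ 1 := fun x => by
    have : 0 ≤ min (τ x) M / M := div_nonneg (le_min (hτ0 x) hM0.le) hM0.le
    simp only [hf]; linarith
  have hfc : ∀ x ∉ Ω, f x = 1 := fun x hx => by
    simp [hf, hτΩ x hx, hM0.le]
  obtain ⟨g, hg, hw, hgfin⟩ := hτ.exists_gradient
  rw [Measure.restrict_univ] at hgfin
  have hM' : ((Real.toNNReal M⁻¹ : NNReal) : ℝ) = M⁻¹ :=
    Real.coe_toNNReal _ (inv_nonneg.2 hM0.le)
  have hwf := IsWeakUpperGradientOn.of_abs_sub_le (f := f) hp0 hw hw (Real.toNNReal M⁻¹) 0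
    (fun x y => by
      rw [hM', NNReal.coe_zero, zero_mul, add_zero, hf]
      have h1 : (1 - min (τ x) M / M) - (1 - min (τ y) M / M) =
        M⁻¹ * (min (τ y) M - min (τ x) M) := by field_simp; ring
      rw [h1, abs_mul, abs_of_pos (inv_pos.2 hM0), abs_sub_comm]
      have := abs_min_sub_min_le_max (τ x) M (τ y) M
      rw [sub_self, abs_zero, max_eq_left (abs_nonneg _)] at this
      gcongr)
  simp only [ENNReal.coe_zero, zero_mul, add_zero] at hwf
  set e : ℝ≥0∞ := min (η / 3) (η / ENNReal.ofReal M ^ p) with he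
  have hMp0 : ENNReal.ofReal M ^ p ≠ 0 :=
    (ENNReal.rpow_pos (ENNReal.ofReal_pos.2 hM0) ENNReal.ofReal_ne_top).ne'
  have hMptop : ENNReal.ofReal M ^ p ≠ ⊤ :=
    (ENNReal.rpow_lt_top_of_nonneg hp0.le ENNReal.ofReal_ne_top).ne
  have he0 : e ≠ 0 := (lt_min (pos_iff_ne_zero.2 hη3) (ENNReal.div_pos hη hMptop)).ne'
  have hetop : e ≠ ⊤ := (min_lt_of_left_lt (ENNReal.div_lt_top hηtop (by simp))).ne
  obtain ⟨h, k, A, hlsc, hfh, hh1, hhΩ, hk, hwk, hkfin, hA, hhA, hqA, hkA⟩ :=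
    exists_lowerSemicontinuous_ge hp hfm hf0 hf1 hΩ hΩfin hfc (hg.const_mul _) hwf
      (lintegral_const_mul_rpow_lt_top hp0.le hgfin ENNReal.coe_ne_top) hq'fin he0 hetop
  have hkfin' : ∫⁻ x, k x ^ p ∂μ < ⊤ := hkfin.trans_lt (ENNReal.add_lt_top.2
    ⟨lintegral_const_mul_rpow_lt_top hp0.le hgfin ENNReal.coe_ne_top, hetop.lt_top⟩)
  have hFle : ∀ x, 1 - h x ≤ min (τ x) M / M := fun x => by
    have := hfh x
    simp only [hf] at this
    linarith
  set θ : X → ℝ := fun x => M * max (1 - h x - ε) 0 with hθ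
  have hhm : Measurable h := hlsc.measurable
  have hθm : Measurable θ := by fun_prop
  have hθ0 : ∀ x, 0 ≤ θ x := fun x => mul_nonneg hM0.le (le_max_right _ _)
  have hθpos : ∀ x, 0 < θ x → 0 < 1 - h x - ε := fun x hx => by
    by_contra hcon
    simp only [hθ, max_eq_right (not_lt.1 hcon), mul_zero, lt_irrefl] at hx
  have hθM : ∀ x, θ x ≤ M := fun x => by
    have h1 : max (1 - h x - ε) 0 ≤ 1 := max_le (by linarith [hf0 x, hfh x]) zero_le_one
    calc θ x ≤ M * 1 := mul_le_mul_of_nonneg_left h1 hM0.le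
      _ = M := mul_one M
  have hθA : ∀ x ∈ A, 0 < θ x → θ x = min (τ x) M - ε * M := fun x hx hpos => by
    have h1 : θ x = M * (1 - h x - ε) := by
      simp only [hθ]
      rw [max_eq_left (hθpos x hpos).le]
    rw [h1, hhA x hx]
    simp only [hf]
    field_simp
    ring
  have hM'' : ((Real.toNNReal M : NNReal) : ℝ) = M := Real.coe_toNNReal _ hM0.le
  have hGθ : IsWeakUpperGradientOn μ p θ (fun x => ENNReal.ofReal M * k x) univ := by
    have := IsWeakUpperGradientOn.of_abs_sub_le (f := θ) hp0 hwk hwk (Real.toNNReal M) 0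
      (fun x y => by
        rw [hM'', NNReal.coe_zero, zero_mul, add_zero]
        simp only [hθ]
        rw [← mul_sub, abs_mul, abs_of_pos hM0]
        refine mul_le_mul_of_nonneg_left ?_ hM0.le
        refine (abs_max_sub_max_le_abs _ _ _).trans ?_
        rw [show 1 - h x - ε - (1 - h y - ε) = -(h x - h y) by ring, abs_neg])
    simp only [ENNReal.coe_zero, zero_mul, add_zero] at this
    exact this
  have hGfin : ∫⁻ x, (ENNReal.ofReal M * k x) ^ p ∂μ < ⊤ :=
    lintegral_const_mul_rpow_lt_top hp0.le hkfin' ENNReal.ofReal_ne_top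
  have hMem : MemNp μ p θ univ := by
    refine memNp_of_gradient hθm ?_ (hk.const_mul _) hGθ (by rwa [Measure.restrict_univ])
    rw [Measure.restrict_univ]
    calc ∫⁻ x, ENNReal.ofReal |θ x| ^ p ∂μ
        ≤ ∫⁻ x, Ω.indicator (fun _ => ENNReal.ofReal M ^ p) x ∂μ := by
          refine lintegral_mono fun x => ?_
          by_cases hx : x ∈ Ω
          · rw [indicator_of_mem hx, abs_of_nonneg (hθ0 x)]
            exact ENNReal.rpow_le_rpow (ENNReal.ofReal_le_ofReal (hθM x)) hp0.le
          · have : θ x = 0 := by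
              simp only [hθ, hhΩ x hx, sub_self, zero_sub, max_eq_right (neg_nonpos.2 hε0.le),
                mul_zero]
            simp [this, hp0]
      _ = ENNReal.ofReal M ^ p * μ Ω := by
          rw [lintegral_indicator hΩ.measurableSet, setLIntegral_const]
      _ < ⊤ := ENNReal.mul_lt_top hMptop.lt_top hΩfin
  refine ⟨{
    θ := θ
    G := fun x => ENNReal.ofReal M * k x
    K := h ⁻¹' Iic (1 - ε)
    B := Aᶜ
    T := Aᶜ ∪ ({x | M ≤ τ x} ∪ {x | 0 < τ x ∧ τ x ≤ ε * M})
    c := ε * M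
    C := M - ε * M
    nonneg := hθ0
    memNp := hMem
    isClosed := lowerSemicontinuous_iff_isClosed_preimage.1 hlsc _
    pos_subset := fun x hx => ?_
    subset_pos := fun x hx => ?_
    measurable_G := hk.const_mul _
    gradient := hGθ
    lintegral_G := hGfin
    measurableSet_B := hA.compl
    eq_of_notMem := fun x hx hpos => ?_
    eq_or_eq := fun x hx hpos => ?_
    lintegral_T := ?_
    lintegral_B := ?_ }⟩
  · have := hθpos x hx
    change h x ≤ 1 - ε
    linarith
  · have h1 : h x ≤ 1 - ε := hx
    have h2 : ε ≤ min (τ x) M / M := le_trans (by linarith) (hFle x)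
    have h3 : 0 < min (τ x) M / M := hε0.trans_le h2
    exact (lt_min_iff.1 ((div_pos_iff_of_pos_right hM0).1 h3)).1
  · simp only [mem_union, not_or] at hx
    have hxA : x ∈ A := not_not.1 hx.1
    have h1 : τ x < M := not_le.1 hx.2.1
    have h2 : ε * M < τ x := not_le.1 fun hle => hx.2.2 ⟨hpos, hle⟩
    have h3 : θ x = max (τ x - ε * M) 0 := by
      simp only [hθ, hhA x hxA, hf, min_eq_left h1.le]
      rw [mul_max_of_nonneg _ _ hM0.le, mul_zero]
      congr 1
      field_simp
      ring
    rw [max_eq_left (by linarith)] at h3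
    exact ⟨by linarith, h3⟩
  · have h1 := hθA x (not_not.1 hx) hpos
    rcases le_total (τ x) M with hle | hle
    · rw [min_eq_left hle] at h1
      exact Or.inl h1
    · rw [min_eq_right hle] at h1
      exact Or.inr h1
  · rw [inter_comm, ← setLIntegral_indicator hP]
    have h1 : ∫⁻ x in {x | M ≤ τ x}, q' x ∂μ ≤ η / 3 := by
      rwa [withDensity_apply _ (measurableSet_le measurable_const hτm)] at hm
    have h2 : ∫⁻ x in {x | 0 < τ x ∧ τ x ≤ ε * M}, q' x ∂μ ≤ η / 3 := by
      rwa [withDensity_apply _ (hPle _)] at hn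
    calc _ ≤ ∫⁻ x in Aᶜ, q' x ∂μ + (∫⁻ x in {x | M ≤ τ x}, q' x ∂μ +
            ∫⁻ x in {x | 0 < τ x ∧ τ x ≤ ε * M}, q' x ∂μ) :=
          (lintegral_union_le _ _ _).trans (add_le_add le_rfl (lintegral_union_le _ _ _))
      _ ≤ η / 3 + (η / 3 + η / 3) :=
          add_le_add (hqA.le.trans (min_le_left _ _)) (add_le_add h1 h2)
      _ = η := by rw [← add_assoc, ENNReal.add_thirds]
  · simp_rw [ENNReal.mul_rpow_of_nonneg _ _ hp0.le]
    rw [lintegral_const_mul _ (hk.pow_const p)]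
    calc _ ≤ ENNReal.ofReal M ^ p * (η / ENNReal.ofReal M ^ p) :=
          mul_le_mul_right (hkA.le.trans (min_le_right _ _)) _
      _ = η := ENNReal.mul_div_cancel hMp0 hMptop

end Approximation

section Comparison

variable {μ : Measure X} {p : ℝ}

lemma Curve.DBound.of_inter {γ : Curve X} {f : X → ℝ} {g : X → ℝ≥0∞} {A E : Set X}
    (h : γ.DBound f g (A ∩ E)) (hγ : γ.InSet E) : γ.DBound f g A := by
  have h' : ∀ᵐ t ∂volume.restrict (Icc 0 γ.len), γ.toFun t ∈ A ∩ E → _ := h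
  filter_upwards [h', ae_restrict_mem measurableSet_Icc] with t ht htI htA
  exact ht ⟨htA, hγ t htI⟩

lemma Curve.UGAlong.congr_neg {γ : Curve X} {f₁ f₂ : X → ℝ} {g : X → ℝ≥0∞} {A E F : Set X}
    (h : γ.UGAlong f₁ g E) (hγ : γ.InSet F) (hA : A ∩ F ⊆ E)
    (heq : ∀ x ∈ A ∩ F, f₂ x = - f₁ x) : γ.UGAlong f₂ g A := by
  intro s t hs hst ht hin
  have hin' : ∀ r ∈ Icc s t, γ.toFun r ∈ A ∩ F := fun r hr =>
    ⟨hin r hr, hγ r ⟨hs.trans hr.1, hr.2.trans ht⟩⟩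
  rw [heq _ (hin' s ⟨le_rfl, hst⟩), heq _ (hin' t ⟨hst, le_rfl⟩), edist_neg_neg]
  exact h s t hs hst ht fun r hr => hA (hin' r hr)

lemma eventually_curveLint_indicator_lt_top {hp : 0 < p} {g : X → ℝ≥0∞} (hg : Measurable g)
    {A S : Set X} (hA : MeasurableSet A) (hAS : A ⊆ S) (hfin : ∫⁻ x in S, g x ^ p ∂μ < ⊤) :
    ∀ᶠ γ in curveFilter μ p hp, curveLint γ (A.indicator g) < ⊤ := by
  refine eventually_curveLint_lt_top (hg.indicator hA) ?_
  rw [lintegral_indicator_rpow hp hA]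
  exact (lintegral_mono_set hAS).trans_lt hfin

open Classical in
/-- A fine superminimizer has finite energy on the sets given by `exists_finelyOpen_between`. -/
lemma fineEnergy_lt_top_of_forall_inSet [SFinite μ] (hp : 1 ≤ p) {χ : X → ℝ} {U V W : Set X}
    (hχ : MemNp μ p χ V) (hWV : W ⊆ V) (hW : MeasurableSet W) {ρ : X → ℝ≥0∞} (hρ : Measurable ρ)
    (hρfin : ∫⁻ x in W, ρ x ^ p ∂μ < ⊤)
    (hbar : ∀ᶠ γ in curveFilter μ p (by linarith), curveLint γ (W.piecewise ρ fun _ => ⊤) < ⊤ →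
      γ.InSet V) : fineEnergy μ p χ U W < ⊤ := by
  have hp0 : 0 < p := by linarith
  obtain ⟨g, hg, hw, hgfin⟩ := hχ.exists_gradient
  have hk : IsWeakUpperGradientOn μ p χ (W.piecewise (fun x => g x + ρ x) fun _ => ⊤) U := by
    refine isWeakUpperGradientOn_of_eventually hp0 ?_
    filter_upwards [hbar, hw.eventually_acAlong hp0 hg hgfin] with γ h1 h2 _ hfin
    have hγV : γ.InSet V := by
      refine h1 (curveLint_mono_lt_top (fun x => ?_) hfin)
      by_cases hx : x ∈ W
      · rw [piecewise_eq_of_mem _ _ _ hx, piecewise_eq_of_mem _ _ _ hx]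
        exact le_add_self
      · rw [piecewise_eq_of_notMem _ _ _ hx, piecewise_eq_of_notMem _ _ _ hx]
    obtain ⟨ha, hb, -⟩ := h2 hγV
    refine ⟨ha, hb.mono subset_rfl fun x _ => ?_⟩
    by_cases hx : x ∈ W
    · rw [piecewise_eq_of_mem _ _ _ hx]
      exact le_self_add
    · rw [piecewise_eq_of_notMem _ _ _ hx]
      exact le_top
  refine (fineEnergy_le ((hg.add hρ).piecewise hW measurable_const) hk).trans_lt ?_
  rw [setLIntegral_congr_fun hW (g := fun x => (g x + ρ x) ^ p) fun x hx => by
    simp only [piecewise_eq_of_mem _ _ _ hx, Pi.add_apply]]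
  exact lintegral_add_rpow_lt_top hp hg ((lintegral_mono_set hWV).trans_lt hgfin) hρfin

lemma setLIntegral_add_rpow_le (hp : 0 ≤ p) {S : Set X} {a b : X → ℝ≥0∞} (ha : Measurable a) :
    ∫⁻ x in S, (a x + b x) ^ p ∂μ ≤
      2 ^ p * (∫⁻ x in S, a x ^ p ∂μ + ∫⁻ x in S, b x ^ p ∂μ) := by
  rw [← lintegral_add_left (ha.pow_const p),
    ← lintegral_const_mul' _ _ (ENNReal.rpow_lt_top_of_nonneg hp (by simp)).ne]
  exact lintegral_mono fun x => add_rpow_le_two_rpow_mul hp _ _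

open Classical in
/-- The comparison of energies on the support of an approximation `θ` of `τ`, obtained from the
superminimality of `χ`. -/
lemma setLIntegral_le_of_fineEnergy_le [SFinite μ] (hp : 1 ≤ p) {χ v τ : X → ℝ} {U V W N : Set X}
    (hv : MemNp μ p v U) (hτ : MemNp0 μ p τ V) (hVU : V ⊆ U)
    (hN : sobolevCap μ p N = 0) (hvτ : ∀ x ∈ U, x ∉ N → 0 < τ x → v x + τ x = - χ x)
    (hW : MeasurableSet W) {ρ : X → ℝ≥0∞} (hρ : Measurable ρ) (hρfin : ∫⁻ x in W, ρ x ^ p ∂μ < ⊤)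
    (hbar : ∀ᶠ γ in curveFilter μ p (by linarith), curveLint γ (W.piecewise ρ fun _ => ⊤) < ⊤ →
      γ.InSet V)
    {gχ g k : X → ℝ≥0∞} {e : ℝ≥0∞} (hgχ : Measurable gχ) (hwχ : IsWeakUpperGradientOn μ p χ gχ V)
    (hgχfin : ∫⁻ x in V, gχ x ^ p ∂μ < ⊤) (hg : Measurable g)
    (hw : IsWeakUpperGradientOn μ p v g U) (hgfin : ∫⁻ x in V, g x ^ p ∂μ < ⊤)
    (S : SupportApprox μ p τ (fun x => gχ x ^ p) e) (hSW : S.K ⊆ W)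
    (hk : Measurable k) (hwk : IsWeakUpperGradientOn μ p χ k U)
    (hkfin : ∫⁻ x in W, k x ^ p ∂μ < ⊤)
    (hkle : ∫⁻ x in W, k x ^ p ∂μ ≤ fineEnergy μ p (fun x => χ x + S.θ x) U W + e) :
    ∫⁻ x in {x | 0 < S.θ x}, k x ^ p ∂μ ≤
      ∫⁻ x in {x | 0 < S.θ x ∧ S.θ x = τ x - S.c}, g x ^ p ∂μ + (2 ^ p * (e + e) + e) := by
  have hp0 : 0 < p := by linarith
  have hθm : Measurable S.θ := S.memNp.1
  have hτm : Measurable τ := hτ.1.1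
  set A : Set X := {x | 0 < τ x} with hA_def
  have hA : MeasurableSet A := measurableSet_lt measurable_const hτm
  have hAV : A ⊆ V := fun x hx => by
    by_contra hcon
    have h0 : 0 < τ x := hx
    rw [hτ.2 x hcon] at h0
    exact lt_irrefl _ h0
  set Ω : Set X := {x | 0 < S.θ x} with hΩ_def
  have hΩ : MeasurableSet Ω := measurableSet_lt measurable_const hθm
  have hΩA : Ω ⊆ A := S.pos_subset.trans S.subset_pos
  have hΩW : Ω ⊆ W := S.pos_subset.trans hSW
  set Ω₁ : Set X := {x | 0 < S.θ x ∧ S.θ x = τ x - S.c} with hΩ₁_def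
  have hΩ₁ : MeasurableSet Ω₁ := hΩ.inter (measurableSet_eq_fun hθm (hτm.sub_const _))
  have hΩ₁Ω : Ω₁ ⊆ Ω := fun x hx => hx.1
  set b : X → ℝ≥0∞ := S.B.indicator S.G with hb
  have hbm : Measurable b := S.measurable_G.indicator S.measurableSet_B
  set k₀ : X → ℝ≥0∞ := Ω₁.piecewise g fun x => gχ x + b x with hk₀
  set κ : X → ℝ≥0∞ := Ω.piecewise k₀ (W.piecewise k fun _ => ⊤) with hκ
  have hk₀m : Measurable k₀ := hg.piecewise hΩ₁ (hgχ.add hbm)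
  have hκm : Measurable κ := hk₀m.piecewise hΩ (hk.piecewise hW measurable_const)
  have hκW : ∀ x ∉ W, κ x = ⊤ := fun x hx => by
    rw [hκ, piecewise_eq_of_notMem _ _ _ fun h => hx (hΩW h), piecewise_eq_of_notMem _ _ _ hx]
  have hκwug : IsWeakUpperGradientOn μ p (fun x => χ x + S.θ x) κ U := by
    refine isWeakUpperGradientOn_of_eventually hp0 ?_
    obtain ⟨gv, hgv, hwv, hgvfin⟩ := hv.exists_gradient
    obtain ⟨gτ, hgτ, hwτ, hgτfin⟩ := hτ.1.exists_gradient
    filter_upwards [hbar, eventually_curveLint_indicator_lt_top hρ hW subset_rfl hρfin,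
      eventually_curveLint_indicator_lt_top hk hW subset_rfl hkfin,
      eventually_curveLint_indicator_lt_top hg hA hAV hgfin,
      hwχ.eventually_acAlong hp0 hgχ hgχfin, hwv.eventually_acAlong hp0 hgv hgvfin,
      hwτ.eventually_acAlong hp0 hgτ hgτfin,
      S.gradient.eventually_acAlong hp0 S.measurable_G (by
        rw [Measure.restrict_univ]
        exact S.lintegral_G),
      hw.eventually_ugAlong hp0, hwk.eventually_ugAlong hp0,
      eventually_forall_notMem_of_sobolevCap_eq_zero hp hN]
      with γ h1 h2 h3 h4 h5 h6 h7 h8 h9 h10 h11 hγ hfin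
    have hγV : γ.InSet V := by
      refine h1 (curveLint_mono_lt_top (h := fun x => W.indicator ρ x + κ x) (fun x => ?_) ?_)
      · by_cases hx : x ∈ W
        · rw [piecewise_eq_of_mem _ _ _ hx, indicator_of_mem hx]
          exact le_self_add
        · rw [hκW x hx, add_top]
          exact le_top
      · rw [curveLint_add γ (hρ.indicator hW)]
        exact ENNReal.add_lt_top.2 ⟨h2, hfin⟩
    have hkγ : curveLint γ k < ⊤ := by
      refine curveLint_mono_lt_top (h := fun x => W.indicator k x + κ x) (fun x => ?_) ?_
      · by_cases hx : x ∈ W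
        · rw [indicator_of_mem hx]
          exact le_self_add
        · rw [hκW x hx, add_top]
          exact le_top
      · rw [curveLint_add γ (hk.indicator hW)]
        exact ENNReal.add_lt_top.2 ⟨h3, hfin⟩
    obtain ⟨hχac, hχd, -⟩ := h5 hγV
    obtain ⟨hvac, -, -⟩ := h6 hγ
    obtain ⟨hτac, -, -⟩ := h7 fun t _ => mem_univ _
    obtain ⟨hθac, hθd, -⟩ := h8 fun t _ => mem_univ _
    refine ⟨hχac.add hθac, ?_⟩
    rw [← union_compl_self Ω]
    refine Curve.DBound.union ?_ ?_
    · rw [← inter_union_sdiff Ω Ω₁]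
      refine Curve.DBound.union ?_ ?_
      · have hvA : γ.DBound v g A :=
          (h9.mono_set (hAV.trans hVU)).dBound hvac hg hA h4 hτac.eventually_lt
        have hvA' : γ.DBound (fun x => - v x + - S.c) g (Ω ∩ Ω₁ ∩ (U ∩ Nᶜ)) := by
          have h := hvA.neg.add (Curve.dBound_of_eqOn_const (g := fun _ => 0)
            (Curve.acAlong_const γ (-S.c)) fun _ _ => rfl) hvac.neg (Curve.acAlong_const γ _)
          exact h.mono (fun x hx => hΩA hx.1.1) fun x _ => by simp
        refine (((hvA'.congr (hvac.neg.add (Curve.acAlong_const γ _)) (hχac.add hθac)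
          fun x hx => ?_).of_inter fun t ht => ⟨hγ t ht, h11 t ht⟩)).mono subset_rfl
          fun x hx => ?_
        · have h12 := hvτ x hx.2.1 hx.2.2 (hΩA hx.1.1)
          have h13 := hx.1.2.2
          change - v x + - S.c = χ x + S.θ x
          linarith
        · rw [hκ, piecewise_eq_of_mem _ _ _ hx.1, hk₀, piecewise_eq_of_mem _ _ _ hx.2]
      · have hθb : γ.DBound S.θ b (Ω \ Ω₁) := by
          rw [← inter_union_sdiff (Ω \ Ω₁) S.B]
          refine Curve.DBound.union ?_ ?_
          · exact hθd.mono (subset_univ _) fun x hx => by rw [hb, indicator_of_mem hx.2]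
          · exact Curve.dBound_of_eqOn_const (c := S.C) hθac fun x hx =>
              (S.eq_or_eq x hx.2 hx.1.1).resolve_left fun h => hx.1.2 ⟨hx.1.1, h⟩
        refine ((hχd.mono (subset_univ _) fun x _ => le_rfl).add hθb hχac hθac).mono subset_rfl
          fun x hx => ?_
        rw [hκ, piecewise_eq_of_mem _ _ _ hx.1, hk₀, piecewise_eq_of_notMem _ _ _ hx.2]
    · refine ((h10.dBound_univ hγ hk hkγ).mono (subset_univ _) fun x hx => ?_).congr hχac
        (hχac.add hθac) fun x hx => ?_
      · rw [hκ, piecewise_eq_of_notMem _ _ _ hx]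
        by_cases hxW : x ∈ W
        · rw [piecewise_eq_of_mem _ _ _ hxW]
        · rw [piecewise_eq_of_notMem _ _ _ hxW]
          exact le_top
      · have h0 : S.θ x = 0 := le_antisymm (not_lt.1 hx) (S.nonneg x)
        change χ x = χ x + S.θ x
        rw [h0, add_zero]
  have hΩWi : Ω ∩ W = Ω := inter_eq_left.2 hΩW
  have hmain : ∫⁻ x in Ω, k x ^ p ∂μ ≤ ∫⁻ x in Ω, k₀ x ^ p ∂μ + e := by
    have h1 := hkle.trans (add_le_add (fineEnergy_le hκm hκwug) le_rfl)
    rw [hκ, setLIntegral_piecewise_rpow hΩ, hΩWi, ← setLIntegral_inter_add_compl hΩ W, hΩWi] at h1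
    have h2 : ∫⁻ x in Ωᶜ ∩ W, (W.piecewise k (fun _ => ⊤) x) ^ p ∂μ =
        ∫⁻ x in Ωᶜ ∩ W, k x ^ p ∂μ :=
      setLIntegral_congr_fun (hΩ.compl.inter hW) fun x hx => by
        simp only [piecewise_eq_of_mem _ _ _ hx.2]
    rw [h2] at h1
    have hne : ∫⁻ x in Ωᶜ ∩ W, k x ^ p ∂μ ≠ ⊤ :=
      ((lintegral_mono_set inter_subset_right).trans_lt hkfin).ne
    refine (ENNReal.add_le_add_iff_right hne).1 (h1.trans_eq ?_)
    ring
  refine hmain.trans ?_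
  rw [hk₀, setLIntegral_piecewise_rpow hΩ₁, inter_eq_left.2 hΩ₁Ω, ← add_assoc]
  refine add_le_add (add_le_add le_rfl ?_) le_rfl
  refine (setLIntegral_add_rpow_le hp0.le hgχ).trans ?_
  gcongr
  · have hsub : Ω₁ᶜ ∩ Ω ⊆ S.T ∩ A := by
      refine fun x hx => ⟨?_, hΩA hx.2⟩
      by_contra hcon
      exact hx.1 ⟨hx.2, (S.eq_of_notMem x hcon (hΩA hx.2)).2⟩
    exact (lintegral_mono_set hsub).trans S.lintegral_T
  · refine (lintegral_mono' Measure.restrict_le_self le_rfl).trans ?_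
    rw [hb, lintegral_indicator_rpow hp0 S.measurableSet_B]
    exact S.lintegral_B

end Comparison

section Gluing

variable {μ : Measure X} {p : ℝ}

open Classical in
/-- Replacing `v` by `v + τ`, which agrees with `-χ` on `{τ > 0}` up to a set of zero capacity,
does not increase the energy if `χ` is a fine superminimizer. -/
lemma fineEnergy_add_le [ProperSpace X] [SFinite μ] (hp : 1 < p) (hd : DoublingMeasure μ)
    (hPI : PoincareInequality μ p) {χ v τ : X → ℝ} {U V N : Set X} (hUne : Uᶜ.Nonempty)
    (hχ : FineSuperminimizer μ p χ U) (hv : MemNp μ p v U) (hV : GoodSubset μ p V U)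
    (hτ : MemNp0 μ p τ V) (hτ0 : ∀ x, 0 ≤ τ x) (hN : sobolevCap μ p N = 0)
    (hvτ : ∀ x ∈ U, x ∉ N → 0 < τ x → v x + τ x = - χ x) :
    fineEnergy μ p (fun x => v x + τ x) U V ≤ fineEnergy μ p v U V := by
  have hp0 : 0 < p := by linarith
  have hVU : V ⊆ U := hV.2.1.1
  refine le_iInf₂ fun g hg => le_iInf fun hw => ?_
  refine ENNReal.le_of_forall_pos_le_add fun η hη hgfin => ?_
  obtain ⟨gχ, hgχ, hwχ, hgχfin⟩ := (hχ.1 V hV).exists_gradient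
  set A : Set X := {x | 0 < τ x} with hA_def
  have hτm : Measurable τ := hτ.1.1
  have hA : MeasurableSet A := measurableSet_lt measurable_const hτm
  have hAV : A ⊆ V := fun x hx => by
    by_contra hcon
    have h0 : 0 < τ x := hx
    rw [hτ.2 x hcon] at h0
    exact lt_irrefl _ h0
  obtain ⟨z, hz⟩ := hUne
  obtain ⟨D, hD, hDz⟩ := Metric.isOpen_iff.1 isClosed_closure.isOpen_compl z
    (fun h => hz (hV.2.2.2 h) : z ∈ (closure V)ᶜ)
  obtain ⟨r, hr⟩ := hV.2.2.1.isBounded.subset_ball z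
  have hrfin : μ (ball z r) < ⊤ := by
    rcases le_or_gt r 0 with h | h
    · simp [ball_eq_empty.2 h]
    · exact (hd.1 z r h).2
  set M : ℝ≥0∞ := 2 ^ p * 2 + 2 with hM
  have hMtop : M ≠ ⊤ := ENNReal.add_ne_top.2 ⟨ENNReal.mul_ne_top
    (ENNReal.rpow_lt_top_of_nonneg hp0.le (by simp)).ne (by simp), by simp⟩
  have hM0 : M ≠ 0 := by simp [hM]
  set e : ℝ≥0∞ := η / M with he
  have he0 : e ≠ 0 := (ENNReal.div_pos (ENNReal.coe_pos.2 hη).ne' hMtop).ne'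
  have hetop : e ≠ ⊤ := (ENNReal.div_lt_top ENNReal.coe_ne_top hM0).ne
  obtain ⟨S⟩ := nonempty_supportApprox hp.le hτ.1 hτ0 (isOpen_ball (x := z) (ε := r)) hrfin
    (fun x hx => hτ.2 x fun h => hx (hr (subset_closure h)))
    ((lintegral_mono_set hAV).trans_lt hgχfin) he0 hetop
  have hKV : S.K ⊆ V := S.subset_pos.trans hAV
  obtain ⟨W, ρ, hKW, hWV, hW, hWfine, hρ, hρfin, hbar⟩ := exists_finelyOpen_between hp hd hPI
    hV.1 (hV.2.2.1.of_isClosed_subset S.isClosed (hKV.trans subset_closure)) hKV (z := z) hD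
    fun x hx => by
      by_contra hcon
      exact hDz (mem_ball'.2 (not_le.1 hcon)) (subset_closure (hKV hx))
  have hWgood : GoodSubset μ p W U := by
    obtain ⟨ζ, hζ, hζV⟩ := hV.2.1.2
    exact ⟨hWfine, ⟨hWV.trans hVU, ζ, hζ, fun x hx => hζV x (hWV hx)⟩,
      hV.2.2.1.of_isClosed_subset isClosed_closure (closure_mono hWV),
      (closure_mono hWV).trans hV.2.2.2⟩
  obtain ⟨k, hk, hwk, hklt⟩ := exists_of_fineEnergy_lt (ENNReal.lt_add_right
    (fineEnergy_lt_top_of_forall_inSet (U := U) hp.le (hχ.1 V hV) hWV hW hρ hρfin hbar).ne he0)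
  have hkfin : ∫⁻ x in W, k x ^ p ∂μ < ⊤ := hklt.trans_le le_top
  have hθW : MemNp0 μ p S.θ W := ⟨S.memNp, fun x hx =>
    le_antisymm (not_lt.1 fun h => hx (hKW (S.pos_subset h))) (S.nonneg x)⟩
  have hkle := hklt.le.trans (add_le_add (hχ.2 W hWgood S.θ hθW S.nonneg) le_rfl)
  have hΩk := setLIntegral_le_of_fineEnergy_le hp.le hv hτ hVU hN hvτ hW hρ hρfin hbar hgχ hwχ
    hgχfin hg hw hgfin S hKW hk hwk hkfin hkle
  have hθm : Measurable S.θ := S.memNp.1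
  set Ω : Set X := {x | 0 < S.θ x} with hΩ_def
  have hΩ : MeasurableSet Ω := measurableSet_lt measurable_const hθm
  have hΩA : Ω ⊆ A := S.pos_subset.trans S.subset_pos
  have hwug : IsWeakUpperGradientOn μ p (fun x => v x + τ x)
      (A.piecewise (Ω.piecewise k gχ) g) U := by
    refine isWeakUpperGradientOn_of_eventually hp0 ?_
    obtain ⟨gv, hgv, hwv, hgvfin⟩ := hv.exists_gradient
    obtain ⟨gτ, hgτ, hwτ, hgτfin⟩ := hτ.1.exists_gradient
    filter_upwards [
      eventually_curveLint_indicator_lt_top hk hΩ (S.pos_subset.trans hKW) hkfin,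
      eventually_curveLint_indicator_lt_top hg hA hAV hgfin,
      eventually_curveLint_indicator_lt_top hgχ hA hAV hgχfin,
      hwv.eventually_acAlong hp0 hgv hgvfin, hwτ.eventually_acAlong hp0 hgτ hgτfin,
      S.gradient.eventually_acAlong hp0 S.measurable_G (by
        rw [Measure.restrict_univ]
        exact S.lintegral_G),
      hw.eventually_ugAlong hp0, hwk.eventually_ugAlong hp0, hwχ.eventually_ugAlong hp0,
      eventually_forall_notMem_of_sobolevCap_eq_zero hp.le hN]
      with γ h1 h2 h3 h4 h5 h6 h7 h8 h9 h10 hγ hfin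
    obtain ⟨hvac, -, -⟩ := h4 hγ
    obtain ⟨hτac, -, -⟩ := h5 fun t _ => mem_univ _
    obtain ⟨hθac, -, -⟩ := h6 fun t _ => mem_univ _
    have hac := hvac.add hτac
    have hγ' : γ.InSet (U ∩ Nᶜ) := fun t ht => ⟨hγ t ht, h10 t ht⟩
    refine ⟨hac, ?_⟩
    rw [← union_compl_self A]
    refine Curve.DBound.union ?_ ?_
    · refine Curve.DBound.mono (Curve.DBound.union ?_ ?_) (inter_union_sdiff A Ω).ge
        fun x _ => le_rfl
      · have h11 : γ.UGAlong (fun x => v x + τ x) k Ω := h8.congr_neg hγ'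
          (inter_subset_right.trans inter_subset_left)
          fun x hx => hvτ x hx.2.1 hx.2.2 (hΩA hx.1)
        refine (h11.dBound hac hk hΩ h1 hθac.eventually_lt).mono inter_subset_right
          fun x hx => ?_
        rw [piecewise_eq_of_mem _ _ _ hx.1, piecewise_eq_of_mem _ _ _ hx.2]
      · have h11 : γ.UGAlong (fun x => v x + τ x) gχ A := h9.congr_neg hγ'
          (inter_subset_left.trans hAV) fun x hx => hvτ x hx.2.1 hx.2.2 hx.1
        refine (h11.dBound hac hgχ hA h3 hτac.eventually_lt).mono sdiff_subset
          fun x hx => ?_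
        rw [piecewise_eq_of_mem _ _ _ hx.1, piecewise_eq_of_notMem _ _ _ hx.2]
    · have hgγ : curveLint γ g < ⊤ := by
        refine curveLint_mono_lt_top (h := fun x => A.indicator g x +
          A.piecewise (Ω.piecewise k gχ) g x) (fun x => ?_) ?_
        · by_cases hx : x ∈ A
          · rw [indicator_of_mem hx]
            exact le_self_add
          · rw [piecewise_eq_of_notMem _ _ _ hx]
            exact le_add_self
        · rw [curveLint_add γ (hg.indicator hA)]
          exact ENNReal.add_lt_top.2 ⟨h2, hfin⟩
      refine ((h7.dBound_univ hγ hg hgγ).mono (subset_univ _) fun x hx => ?_).congr hvac hac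
        fun x hx => ?_
      · rw [piecewise_eq_of_notMem _ _ _ hx]
      · have h0 : τ x = 0 := le_antisymm (not_lt.1 hx) (hτ0 x)
        change v x = v x + τ x
        rw [h0, add_zero]
  refine (fineEnergy_le ((((hk.piecewise hΩ hgχ)).piecewise hA hg)) hwug).trans ?_
  have hAVi : A ∩ V = A := inter_eq_left.2 hAV
  rw [setLIntegral_piecewise_rpow hA, setLIntegral_piecewise_rpow hΩ, hAVi,
    inter_eq_left.2 hΩA, ← setLIntegral_inter_add_compl hA V fun x => g x ^ p, hAVi]
  have h1 : ∫⁻ x in Ωᶜ ∩ A, gχ x ^ p ∂μ ≤ e := by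
    have hsub : Ωᶜ ∩ A ⊆ S.T ∩ A := by
      refine fun x hx => ⟨?_, hx.2⟩
      by_contra hcon
      exact hx.1 (S.eq_of_notMem x hcon hx.2).1
    exact (lintegral_mono_set hsub).trans S.lintegral_T
  have h2 : ∫⁻ x in {x | 0 < S.θ x ∧ S.θ x = τ x - S.c}, g x ^ p ∂μ ≤
      ∫⁻ x in A, g x ^ p ∂μ := lintegral_mono_set fun x hx => hΩA hx.1
  have h3 : M * e = η := ENNReal.mul_div_cancel hM0 hMtop
  calc _ ≤ ∫⁻ x in A, g x ^ p ∂μ + (2 ^ p * (e + e) + e) + e +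
        ∫⁻ x in Aᶜ ∩ V, g x ^ p ∂μ :=
        add_le_add (add_le_add (hΩk.trans (add_le_add h2 le_rfl)) h1) le_rfl
    _ = ∫⁻ x in A, g x ^ p ∂μ + ∫⁻ x in Aᶜ ∩ V, g x ^ p ∂μ + M * e := by
        rw [hM]
        ring
    _ = _ := by rw [h3]

end Gluing

section Obstacle

variable {μ : Measure X} {p : ℝ}

/-- The truncation of `ψ - (u + φ)` to `[0, φ⁻]` inherits the Newtonian regularity. -/
lemma memNp0_truncation [SFinite μ] (hp : 1 ≤ p) {ψ u φ : X → ℝ} {V : Set X}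
    (hψ : MemNp μ p (fun x => - ψ x) V) (hu : MemNp μ p u V) (hφ : MemNp0 μ p φ V) :
    MemNp0 μ p (fun x => min (max (ψ x - (u x + φ x)) 0) (max (- φ x) 0)) V := by
  have hp0 : 0 < p := by linarith
  have hφm : Measurable φ := hφ.1.1
  have hum : Measurable u := hu.1
  have hψm : Measurable ψ := measurable_neg_iff.1 hψ.1
  set τ : X → ℝ := fun x => min (max (ψ x - (u x + φ x)) 0) (max (- φ x) 0) with hτ
  set z : X → ℝ := fun x => max (- φ x) 0 with hz
  have hτ0 : ∀ x, 0 ≤ τ x := fun x => le_min (le_max_right _ _) (le_max_right _ _)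
  have hτz : ∀ x, τ x ≤ z x := fun x => min_le_right _ _
  have hPm : MeasurableSet {x | 0 < z x} :=
    measurableSet_lt measurable_const (hφm.neg.max measurable_const)
  have hPV : {x | 0 < z x} ⊆ V := fun x hx => by
    by_contra hcon
    have h0 : 0 < max (- φ x) 0 := hx
    rw [hφ.2 x hcon] at h0
    simp at h0
  obtain ⟨g₁, hg₁, hw₁, hfin₁⟩ :=
    ((hψ.mono_set hp0 hPV).add hp (hu.mono_set hp0 hPV)).exists_gradient
  obtain ⟨g₂, hg₂, hw₂, hfin₂⟩ := (hφ.1.mono_set hp0 (subset_univ {x | 0 < z x})).exists_gradient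
  obtain ⟨gφ, hgφ, hwφ, hfinφ⟩ := hφ.1.exists_gradient
  have hG := hw₁.of_abs_sub_le hp0 (f := τ) hw₂ 1 1 fun x y => by
    simp only [NNReal.coe_one, one_mul, hτ]
    refine (abs_min_sub_min_le_max _ _ _ _).trans (max_le ?_ ?_)
    · refine (abs_max_sub_max_le_abs _ _ _).trans ?_
      rw [show ψ x - (u x + φ x) - (ψ y - (u y + φ y)) =
        -((-ψ x + u x - (-ψ y + u y)) + (φ x - φ y)) by ring, abs_neg]
      exact abs_add_le _ _
    · refine (abs_max_sub_max_le_abs _ _ _).trans ?_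
      rw [show - φ x - - φ y = -(φ x - φ y) by ring, abs_neg]
      exact le_add_of_nonneg_left (abs_nonneg _)
  simp only [ENNReal.coe_one, one_mul] at hG
  have hac : ∀ᶠ γ in curveFilter μ p hp0, γ.ACAlong z := by
    filter_upwards [hwφ.eventually_acAlong hp0 hgφ hfinφ] with γ h
    exact (h fun t _ => mem_univ _).1.neg.max (Curve.acAlong_const γ 0)
  have hw := isWeakUpperGradientOn_indicator hp0 hac hτ0 hτz hG
  refine ⟨memNp_of_gradient (by fun_prop) ?_ ((hg₁.add hg₂).indicator hPm) hw ?_, fun x hx => ?_⟩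
  · refine lt_of_le_of_lt (lintegral_mono fun x => ?_) (le_self_add.trans_lt hφ.1.2)
    refine ENNReal.rpow_le_rpow (ENNReal.ofReal_le_ofReal ?_) hp0.le
    rw [abs_of_nonneg (hτ0 x)]
    exact (hτz x).trans (max_le (neg_le_abs _) (abs_nonneg _))
  · rw [Measure.restrict_univ, lintegral_indicator_rpow hp0 hPm]
    exact lintegral_add_rpow_lt_top hp hg₁ hfin₁ hfin₂
  · have h0 := hτz x
    simp only [hz, hφ.2 x hx, neg_zero, max_self] at h0
    exact le_antisymm h0 (hτ0 x)

lemma fineEnergy_le_of_fineSubminimizer [ProperSpace X] [SFinite μ] (hp : 1 < p)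
    (hd : DoublingMeasure μ) (hPI : PoincareInequality μ p) {U V : Set X} (hUne : Uᶜ.Nonempty)
    {f u φ ψ₀ : X → ℝ} {ψ : X → EReal} (hψ : ∀ x ∈ U, ψ x = ((ψ₀ x : ℝ) : EReal))
    (hψ₀ : FineSubminimizer μ p ψ₀ U) (hu : u ∈ obstacleClass μ p U ψ f)
    (hsol : ∀ v ∈ obstacleClass μ p U ψ f, fineEnergy μ p u U U ≤ fineEnergy μ p v U U)
    (hV : GoodSubset μ p V U) (hφ : MemNp0 μ p φ V) :
    fineEnergy μ p u U V ≤ fineEnergy μ p (fun x => u x + φ x) U V := by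
  have hp0 : 0 < p := by linarith
  have hVU : V ⊆ U := hV.2.1.1
  have hτmem := memNp0_truncation hp.le (hψ₀.1 V hV) (hu.1.mono_set hp0 hVU) hφ
  set τ : X → ℝ := fun x => min (max (ψ₀ x - (u x + φ x)) 0) (max (- φ x) 0) with hτ
  have hmem : (fun x => u x + (φ x + τ x)) ∈ obstacleClass μ p U ψ f := by
    refine add_mem_obstacleClass hp hu hVU (hφ.add hp.le hτmem)
      (le_antisymm ((sobolevCap_mono fun x hx => ?_).trans_eq hu.2.2) zero_le)
    obtain ⟨hxU, hx⟩ := hx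
    refine ⟨hxU, ?_⟩
    rw [hψ x hxU, EReal.coe_lt_coe_iff] at hx ⊢
    simp only [hτ] at hx
    rcases min_cases (max (ψ₀ x - (u x + φ x)) 0) (max (- φ x) 0) with ⟨h, -⟩ | ⟨h, -⟩
    · rw [h] at hx
      linarith [le_max_left (ψ₀ x - (u x + φ x)) 0]
    · rw [h] at hx
      linarith [le_max_left (- φ x) 0]
  have h1 := fineEnergy_le_of_fineEnergy_le hp hu.1 (hφ.add hp.le hτmem) hVU (hsol _ hmem)
  have h2 := fineEnergy_add_le hp hd hPI hUne hψ₀ (v := fun x => u x + φ x)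
    (hu.1.add hp.le (hφ.1.mono_set hp0 (subset_univ U))) hV hτmem
    (fun x => le_min (le_max_right _ _) (le_max_right _ _)) hu.2.2 fun x hxU hxN hpos => by
      have hle : ψ₀ x ≤ u x := by
        by_contra hcon
        refine hxN ⟨hxU, ?_⟩
        rw [hψ x hxU]
        exact EReal.coe_lt_coe_iff.2 (not_le.1 hcon)
      obtain ⟨hpos₁, hpos₂⟩ := lt_min_iff.1 hpos
      have h3 : 0 < ψ₀ x - (u x + φ x) := by
        by_contra hcon
        rw [max_eq_right (not_lt.1 hcon)] at hpos₁
        exact lt_irrefl _ hpos₁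
      have h4 : 0 < - φ x := by
        by_contra hcon
        rw [max_eq_right (not_lt.1 hcon)] at hpos₂
        exact lt_irrefl _ hpos₂
      simp only [hτ]
      rw [max_eq_left h3.le, max_eq_left h4.le, min_eq_left (by linarith)]
      ring
  simp only [add_assoc] at h1 h2
  exact h1.trans h2

end Obstacle

/-- a solution of the `K_{ψ,f}(U)`-obstacle problem on a bounded
quasiopen set `U` with `C_p(X \ U) > 0` is a fine superminimizer in `U`;
if moreover `ψ ≡ -∞` or `ψ` is a fine subminimizer in `U`, it is a fine
minimizer in `U`. -/
theorem obstacle_solution_fineSuperminimizer {X : Type*} [MetricSpace X]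
    [CompleteSpace X] [MeasurableSpace X] [BorelSpace X]
    (μ : Measure X) (p : ℝ) (hp : 1 < p)
    (hd : DoublingMeasure μ) (hPI : PoincareInequality μ p)
    (U : Set X) (hU : Quasiopen μ p U) (hUb : Bornology.IsBounded U)
    (hUc : 0 < sobolevCap μ p Uᶜ)
    (f : X → ℝ) (hf : MemNp μ p f U) (ψ : X → EReal)
    (hne : (obstacleClass μ p U ψ f).Nonempty)
    (u : X → ℝ) (hu : u ∈ obstacleClass μ p U ψ f)
    (hsol : ∀ v ∈ obstacleClass μ p U ψ f,
      fineEnergy μ p u U U ≤ fineEnergy μ p v U U) :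
    FineSuperminimizer μ p u U ∧
      (((∀ x ∈ U, ψ x = ⊥) ∨
          ∃ ψ₀ : X → ℝ, (∀ x ∈ U, ψ x = ((ψ₀ x : ℝ) : EReal)) ∧
            FineSubminimizer μ p ψ₀ U) →
        FineMinimizer μ p u U) := by
  have := hd.properSpace
  have := hd.sigmaFinite
  have hp0 : 0 < p := by linarith
  have hUne : Uᶜ.Nonempty := by
    rw [nonempty_iff_ne_empty]
    intro h
    rw [h] at hUc
    exact hUc.not_ge ((sobolevCap_mono (empty_subset _)).trans_eq hu.2.2)
  have key : ∀ V φ, GoodSubset μ p V U → MemNp0 μ p φ V →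
      (∀ x ∈ U, ((u x + φ x : ℝ) : EReal) < ψ x → ((u x : ℝ) : EReal) < ψ x) →
      fineEnergy μ p u U V ≤ fineEnergy μ p (fun x => u x + φ x) U V := by
    intro V φ hV hφ h
    have hVU : V ⊆ U := hV.2.1.1
    refine fineEnergy_le_of_fineEnergy_le hp hu.1 hφ hVU
      (hsol _ (add_mem_obstacleClass hp hu hVU hφ (le_antisymm ?_ zero_le)))
    have hsub : {x | x ∈ U ∧ ((u x + φ x : ℝ) : EReal) < ψ x} ⊆
        {x | x ∈ U ∧ ((u x : ℝ) : EReal) < ψ x} := fun x hx => ⟨hx.1, h x hx.1 hx.2⟩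
    exact (sobolevCap_mono hsub).trans_eq hu.2.2
  refine ⟨⟨hu.1.memNpFineLoc hp0, fun V hV φ hφ hφ0 => ?_⟩,
    fun hcase => ⟨hu.1.memNpFineLoc hp0, fun V hV φ hφ => ?_⟩⟩
  · exact key V φ hV hφ fun x _ hx =>
      (EReal.coe_le_coe_iff.2 (le_add_of_nonneg_right (hφ0 x))).trans_lt hx
  · rcases hcase with hψ | ⟨ψ₀, hψ, hψ₀⟩
    · exact key V φ hV hφ fun x hxU hx => absurd hx (by rw [hψ x hxU]; exact not_lt_bot)
    · exact fineEnergy_le_of_fineSubminimizer hp hd hPI hUne hψ hψ₀ hu hsol hV hφ
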